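/- Assume the algebraically closed field k has characteristic 2. Then for every integer n ≥ 1, the algebra Ω(n) over k is τ-tilting finite; moreover its poset of basic support τ-tilting modules is isomorphic to that of A(1,n). -/

import Mathlib

open MulOpposite CategoryTheory CategoryTheory.Limits

noncomputable section

/-- A submodule `N ≤ M` is superfluous if `N ⊔ K = ⊤` implies `K = ⊤`. -/
def SuperfluousSubmodule {R M : Type} [Ring R] [AddCommGroup M] [Module R M]
    (N : Submodule R M) : Prop :=
  ∀ K : Submodule R M, N ⊔ K = ⊤ → K = ⊤

section TauTilting

variable (k : Type) [Field k]
variable (B : Type) [Ring B] [Algebra k B]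

/-- A minimal projective presentation `P1 → P0 → M → 0` of a right `B`-module `M`. -/
def IsMinimalProjPresentation (M P1 P0 : ModuleCat.{0} Bᵐᵒᵖ)
    (f : P1 →ₗ[Bᵐᵒᵖ] P0) (g : P0 →ₗ[Bᵐᵒᵖ] M) : Prop :=
  Module.Projective Bᵐᵒᵖ P1 ∧ Module.Projective Bᵐᵒᵖ P0 ∧
    Function.Surjective g ∧ LinearMap.range f = LinearMap.ker g ∧
    SuperfluousSubmodule (LinearMap.ker g) ∧ SuperfluousSubmodule (LinearMap.ker f)

/-- Left multiplication by `b` on the left `B`-module `Hom_B(P, B)` of a right module `P`. -/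
def leftMulHom {P : Type} [AddCommGroup P] [Module Bᵐᵒᵖ P] (b : B)
    (h : P →ₗ[Bᵐᵒᵖ] B) : P →ₗ[Bᵐᵒᵖ] B where
  toFun p := b * h p
  map_add' x y := by simp [mul_add]
  map_smul' r p := by
    simp only [map_smul, RingHom.id_apply]
    rw [MulOpposite.smul_eq_mul_unop, MulOpposite.smul_eq_mul_unop, mul_assoc]

/-- `M` is τ-rigid:  `Hom_B(M, τM) = 0`, where `τM = D(Tr M)` is computed from a minimal
projective presentation `P1 --f--> P0 → M → 0`, `Tr M = coker(Hom(P0,B) → Hom(P1,B))`, and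
`D = Hom_k(-, k)`.  A right-module map `M → D(Tr M)` is encoded as an additive map
`β : M →+ Hom_k(Hom_B(P1, B), k)` which is balanced (`β (m·b) = β m (b·-)`) and vanishes on
the image of `Hom(P0,B)`, i.e. descends to the cokernel `Tr M`. -/
def IsTauRigid (M : ModuleCat.{0} Bᵐᵒᵖ) : Prop :=
  ∀ (P1 P0 : ModuleCat.{0} Bᵐᵒᵖ) (f : P1 →ₗ[Bᵐᵒᵖ] P0) (g : P0 →ₗ[Bᵐᵒᵖ] M),
    IsMinimalProjPresentation B M P1 P0 f g →
    ∀ β : M →+ ((P1 →ₗ[Bᵐᵒᵖ] B) →ₗ[k] k),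
      (∀ (m : M) (b : B) (h : P1 →ₗ[Bᵐᵒᵖ] B),
        β (op b • m) h = β m (leftMulHom B b h)) →
      (∀ (m : M) (g0 : P0 →ₗ[Bᵐᵒᵖ] B), β m (g0.comp f) = 0) →
      β = 0

/-- A module is indecomposable if it is nonzero and admits no nontrivial direct sum
decomposition. -/
def IndecomposableMod (M : ModuleCat.{0} Bᵐᵒᵖ) : Prop :=
  Nontrivial M ∧ ∀ (L L' : ModuleCat.{0} Bᵐᵒᵖ),
    Nonempty (M ≃ₗ[Bᵐᵒᵖ] (L × L')) → Subsingleton L ∨ Subsingleton L'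

/-- A module is basic (multiplicity-free) if it has no repeated direct summand. -/
def IsBasicMod (M : ModuleCat.{0} Bᵐᵒᵖ) : Prop :=
  ∀ (L C : ModuleCat.{0} Bᵐᵒᵖ),
    Nonempty (M ≃ₗ[Bᵐᵒᵖ] (L × L × C)) → Subsingleton L

/-- `L` is an indecomposable direct summand of `M`. -/
def IsIndecSummand (L M : ModuleCat.{0} Bᵐᵒᵖ) : Prop :=
  IndecomposableMod B L ∧ ∃ L' : ModuleCat.{0} Bᵐᵒᵖ, Nonempty (M ≃ₗ[Bᵐᵒᵖ] (L × L'))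

/-- The rank of the Grothendieck group `K_0(B)` is `n`, i.e. there are exactly `n`
isomorphism classes of simple right `B`-modules. -/
def RankK0Is (n : ℕ) : Prop :=
  ∃ S : Fin n → ModuleCat.{0} Bᵐᵒᵖ,
    (∀ i, IsSimpleModule Bᵐᵒᵖ (S i)) ∧
    (∀ i j, i ≠ j → IsEmpty ((S i) ≃ₗ[Bᵐᵒᵖ] (S j))) ∧
    (∀ T : ModuleCat.{0} Bᵐᵒᵖ, IsSimpleModule Bᵐᵒᵖ T → ∃ i, Nonempty (T ≃ₗ[Bᵐᵒᵖ] S i))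

/-- The number of isomorphism classes of indecomposable direct summands of `M` is `n`. -/
def NumIndecSummandsIs (M : ModuleCat.{0} Bᵐᵒᵖ) (n : ℕ) : Prop :=
  ∃ N : Fin n → ModuleCat.{0} Bᵐᵒᵖ,
    (∀ i, IsIndecSummand B (N i) M) ∧
    (∀ i j, i ≠ j → IsEmpty ((N i) ≃ₗ[Bᵐᵒᵖ] (N j))) ∧
    (∀ L, IsIndecSummand B L M → ∃ i, Nonempty (L ≃ₗ[Bᵐᵒᵖ] N i))

/-- `M` is a τ-tilting module over `B`: it is a finitely generated τ-rigid module whose number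
of non-isomorphic indecomposable direct summands equals the rank of `K_0(B)`. -/
def IsTauTiltingMod (M : ModuleCat.{0} Bᵐᵒᵖ) : Prop :=
  Module.Finite Bᵐᵒᵖ M ∧ IsTauRigid k B M ∧
    ∃ n : ℕ, NumIndecSummandsIs B M n ∧ RankK0Is B n

end TauTilting

section Support

variable (k : Type) [Field k]
variable (A : Type) [Ring A] [Algebra k A]

/-- The quotient of `A` by the two-sided ideal `AeA` generated by `e`. -/
def IdemQuot (e : A) : Type := ((TwoSidedIdeal.span {e}).ringCon).Quotient

instance (e : A) : Ring (IdemQuot A e) :=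
  inferInstanceAs (Ring ((TwoSidedIdeal.span {e}).ringCon).Quotient)

/-- The quotient map `A → A/AeA`. -/
def IdemQuot.mk (e : A) : A →+* IdemQuot A e := RingCon.mk' _

instance (e : A) : Algebra k (IdemQuot A e) :=
  RingHom.toAlgebra' ((IdemQuot.mk A e).comp (algebraMap k A)) (by
    intro c x
    induction x using Quotient.ind with
    | _ a =>
      show (IdemQuot.mk A e) (algebraMap k A c) * (IdemQuot.mk A e) a
          = (IdemQuot.mk A e) a * (IdemQuot.mk A e) (algebraMap k A c)
      rw [← map_mul, ← map_mul, Algebra.commutes])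

/-- `M` is a support τ-tilting module over `A`: there is an idempotent `e ∈ A` such that `M` is
(the restriction of) a τ-tilting module over `A/AeA`. -/
def IsSupportTauTilting (M : ModuleCat.{0} Aᵐᵒᵖ) : Prop :=
  ∃ e : A, IsIdempotentElem e ∧
    ∃ N : ModuleCat.{0} (IdemQuot A e)ᵐᵒᵖ,
      IsTauTiltingMod k (IdemQuot A e) N ∧
      letI : Module Aᵐᵒᵖ N := Module.compHom N (RingHom.op (IdemQuot.mk A e))
      Nonempty (M ≃ₛₗ[RingHom.id Aᵐᵒᵖ] N)

/-- `A` is τ-tilting finite: it admits only finitely many basic support τ-tilting modules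
up to isomorphism. -/
def TauTiltingFinite : Prop :=
  ∃ (n : ℕ) (R : Fin n → ModuleCat.{0} Aᵐᵒᵖ),
    ∀ M : ModuleCat.{0} Aᵐᵒᵖ, IsSupportTauTilting k A M → IsBasicMod A M →
      ∃ i, Nonempty (M ≃ₗ[Aᵐᵒᵖ] R i)

/-- `A` is representation-finite: it has only finitely many isomorphism classes of finitely
generated indecomposable right modules. -/
def RepresentationFinite : Prop :=
  ∃ (n : ℕ) (R : Fin n → ModuleCat.{0} Aᵐᵒᵖ),
    ∀ M : ModuleCat.{0} Aᵐᵒᵖ, Module.Finite Aᵐᵒᵖ M → IndecomposableMod A M →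
      ∃ i, Nonempty (M ≃ₗ[Aᵐᵒᵖ] R i)

end Support

section Fac
variable (B : Type) [Ring B]

/-- `X` is a quotient of a finite direct sum of copies of `M`. -/
def QuotOfCopies (M X : ModuleCat.{0} Bᵐᵒᵖ) : Prop :=
  ∃ (m : ℕ) (f : (Fin m → M) →ₗ[Bᵐᵒᵖ] X), Function.Surjective f

/-- `Fac M ⊆ Fac N`: the partial order on support τ-tilting modules. -/
def FacLE (M N : ModuleCat.{0} Bᵐᵒᵖ) : Prop :=
  ∀ X : ModuleCat.{0} Bᵐᵒᵖ, QuotOfCopies B M X → QuotOfCopies B N X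

end Fac

section QuiverAlg
variable (k : Type) [Field k]

/-- The product in the path algebra of a word of arrows (paths are composed from left to
right, so the path `α₁α₂` corresponds to the product `α₁ * α₂`). -/
def arrWord {V E : Type} (l : List E) : FreeAlgebra k (V ⊕ E) :=
  (l.map (fun a => FreeAlgebra.ι k (Sum.inr a))).prod

/-- The defining relations of a bound quiver algebra `kQ/I`: the vertices `e_v` are orthogonal
idempotents summing to `1`, each arrow `a : u → v` satisfies `e_u a = a = a e_v`, and the
extra relations generating the admissible ideal `I` hold. -/
def quivRel {V E : Type} [Fintype V] [DecidableEq V] (s t : E → V)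
    (extra : FreeAlgebra k (V ⊕ E) → FreeAlgebra k (V ⊕ E) → Prop) :
    FreeAlgebra k (V ⊕ E) → FreeAlgebra k (V ⊕ E) → Prop := fun x y =>
  (∃ v w : V, x = FreeAlgebra.ι k (Sum.inl v) * FreeAlgebra.ι k (Sum.inl w) ∧
    y = if v = w then FreeAlgebra.ι k (Sum.inl v) else 0) ∨
  (x = ∑ v : V, FreeAlgebra.ι k (Sum.inl v) ∧ y = 1) ∨
  (∃ a : E, x = FreeAlgebra.ι k (Sum.inl (s a)) * FreeAlgebra.ι k (Sum.inr a) ∧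
    y = FreeAlgebra.ι k (Sum.inr a)) ∨
  (∃ a : E, x = FreeAlgebra.ι k (Sum.inr a) * FreeAlgebra.ι k (Sum.inl (t a)) ∧
    y = FreeAlgebra.ι k (Sum.inr a)) ∨
  extra x y

/-- The bound quiver algebra presented by a quiver `(V, E, s, t)` and extra relations. -/
def BoundQuiverAlg {V E : Type} [Fintype V] [DecidableEq V] (s t : E → V)
    (extra : FreeAlgebra k (V ⊕ E) → FreeAlgebra k (V ⊕ E) → Prop) : Type :=
  RingQuot (quivRel k s t extra)

instance {V E : Type} [Fintype V] [DecidableEq V] (s t : E → V)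
    (extra : FreeAlgebra k (V ⊕ E) → FreeAlgebra k (V ⊕ E) → Prop) :
    Ring (BoundQuiverAlg k s t extra) :=
  inferInstanceAs (Ring (RingQuot (quivRel k s t extra)))

instance {V E : Type} [Fintype V] [DecidableEq V] (s t : E → V)
    (extra : FreeAlgebra k (V ⊕ E) → FreeAlgebra k (V ⊕ E) → Prop) :
    Algebra k (BoundQuiverAlg k s t extra) :=
  inferInstanceAs (Algebra k (RingQuot (quivRel k s t extra)))

end QuiverAlg

section QuiverAlg
variable (k : Type) [Field k]

/-! ### The quiver `Δ(p,q)`: two oriented cycles of lengths `p` and `q` glued at a vertex `0` -/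

/-- Vertices of `Δ(p,q)`: `none` is the common vertex `0`. -/
def CycV (p q : ℕ) : Type := Option ({i : ZMod p // i ≠ 0} ⊕ {j : ZMod q // j ≠ 0})

/-- The vertex of the `α`-cycle with index `i`. -/
def cycVL (p q : ℕ) (i : ZMod p) : CycV p q :=
  if h : i = 0 then none else some (Sum.inl ⟨i, h⟩)

/-- The vertex of the `β`-cycle with index `j`. -/
def cycVR (p q : ℕ) (j : ZMod q) : CycV p q :=
  if h : j = 0 then none else some (Sum.inr ⟨j, h⟩)

instance (p q : ℕ) : DecidableEq (CycV p q) :=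
  inferInstanceAs (DecidableEq (Option ({i : ZMod p // i ≠ 0} ⊕ {j : ZMod q // j ≠ 0})))

instance (p q : ℕ) [NeZero p] [NeZero q] : Fintype (CycV p q) :=
  inferInstanceAs (Fintype (Option ({i : ZMod p // i ≠ 0} ⊕ {j : ZMod q // j ≠ 0})))

/-- Arrows of `Δ(p,q)`: `Sum.inl i` is the arrow `α_{i+1}`, `Sum.inr j` is `β_{j+1}`. -/
def CycE (p q : ℕ) : Type := ZMod p ⊕ ZMod q

def cycSrc (p q : ℕ) : CycE p q → CycV p q
  | Sum.inl i => cycVL p q i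
  | Sum.inr j => cycVR p q j

def cycTgt (p q : ℕ) : CycE p q → CycV p q
  | Sum.inl i => cycVL p q (i + 1)
  | Sum.inr j => cycVR p q (j + 1)

/-- The word `α_{s+1} α_{s+2} ⋯ α_{s+len}` of arrows on the `α`-cycle of `Δ(p,q)`. -/
def aw (p q : ℕ) (st len : ℕ) : List (CycE p q) :=
  (List.range len).map (fun u => Sum.inl ((st + u : ℕ) : ZMod p))

/-- The word `β_{s+1} β_{s+2} ⋯ β_{s+len}` of arrows on the `β`-cycle of `Δ(p,q)`. -/
def bw (p q : ℕ) (st len : ℕ) : List (CycE p q) :=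
  (List.range len).map (fun u => Sum.inr ((st + u : ℕ) : ZMod q))

section TwoCycles
variable (p q : ℕ)

/-- The relations `I₁(p,q)` of the algebra `A(p,q)`. -/
def ARelExtra : FreeAlgebra k (CycV p q ⊕ CycE p q) → FreeAlgebra k (CycV p q ⊕ CycE p q) →
    Prop := fun x y =>
  (x = arrWord k (aw p q 0 p ++ bw p q 0 q) ∧ y = arrWord k (bw p q 0 q ++ aw p q 0 p)) ∨
  (x = arrWord k (aw p q (p - 1) 1 ++ aw p q 0 1) ∧ y = 0) ∨
  (x = arrWord k (bw p q (q - 1) 1 ++ bw p q 0 1) ∧ y = 0) ∨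
  (∃ i : ℕ, 2 ≤ i ∧ i ≤ p - 1 ∧
    x = arrWord k (aw p q (i - 1) (p - i + 1) ++ bw p q 0 q ++ aw p q 0 i) ∧ y = 0) ∨
  (∃ j : ℕ, 2 ≤ j ∧ j ≤ q - 1 ∧
    x = arrWord k (bw p q (j - 1) (q - j + 1) ++ aw p q 0 p ++ bw p q 0 j) ∧ y = 0)

/-- The algebra `A(p,q) = kΔ(p,q)/I₁(p,q)`. -/
def AAlg (_ : 0 < p) (_ : 0 < q) : Type :=
  haveI : NeZero p := ⟨by omega⟩
  haveI : NeZero q := ⟨by omega⟩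
  BoundQuiverAlg k (cycSrc p q) (cycTgt p q) (ARelExtra k p q)

instance (hp : 0 < p) (hq : 0 < q) : Ring (AAlg k p q hp hq) :=
  haveI : NeZero p := ⟨by omega⟩
  haveI : NeZero q := ⟨by omega⟩
  inferInstanceAs (Ring (BoundQuiverAlg k (cycSrc p q) (cycTgt p q) (ARelExtra k p q)))

instance (hp : 0 < p) (hq : 0 < q) : Algebra k (AAlg k p q hp hq) :=
  haveI : NeZero p := ⟨by omega⟩
  haveI : NeZero q := ⟨by omega⟩
  inferInstanceAs (Algebra k (BoundQuiverAlg k (cycSrc p q) (cycTgt p q) (ARelExtra k p q)))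

/-- The relations `I₂(m)` of the algebra `Λ(m)` (on the quiver `Δ(1,m)`). -/
def LamRelExtra (m : ℕ) : FreeAlgebra k (CycV 1 m ⊕ CycE 1 m) →
    FreeAlgebra k (CycV 1 m ⊕ CycE 1 m) → Prop := fun x y =>
  (x = arrWord k (aw 1 m 0 1 ++ aw 1 m 0 1) ∧
    y = arrWord k (bw 1 m 0 m ++ bw 1 m 0 m)) ∨
  (x = arrWord k (aw 1 m 0 1 ++ bw 1 m 0 1) ∧ y = 0) ∨
  (x = arrWord k (bw 1 m (m - 1) 1 ++ aw 1 m 0 1) ∧ y = 0) ∨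
  (∃ j : ℕ, 2 ≤ j ∧ j ≤ m - 1 ∧
    x = arrWord k (bw 1 m (j - 1) (m - j + 1) ++ bw 1 m 0 m ++ bw 1 m 0 j) ∧ y = 0)

/-- The algebra `Λ(m) = kΔ(1,m)/I₂(m)`. -/
def LamAlg (m : ℕ) (_ : 0 < m) : Type :=
  haveI : NeZero m := ⟨by omega⟩
  BoundQuiverAlg k (cycSrc 1 m) (cycTgt 1 m) (LamRelExtra k m)

instance (m : ℕ) (hm : 0 < m) : Ring (LamAlg k m hm) :=
  haveI : NeZero m := ⟨by omega⟩
  inferInstanceAs (Ring (BoundQuiverAlg k (cycSrc 1 m) (cycTgt 1 m) (LamRelExtra k m)))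

instance (m : ℕ) (hm : 0 < m) : Algebra k (LamAlg k m hm) :=
  haveI : NeZero m := ⟨by omega⟩
  inferInstanceAs (Algebra k (BoundQuiverAlg k (cycSrc 1 m) (cycTgt 1 m) (LamRelExtra k m)))

/-- The relations `I₇(n)` of the algebra `Ω(n)` (on the quiver `Δ(1,n)`). -/
def OmRelExtra (n : ℕ) : FreeAlgebra k (CycV 1 n ⊕ CycE 1 n) →
    FreeAlgebra k (CycV 1 n ⊕ CycE 1 n) → Prop := fun x y =>
  (x = arrWord k (aw 1 n 0 1 ++ bw 1 n 0 n) + arrWord k (bw 1 n 0 n ++ aw 1 n 0 1) ∧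
    y = 0) ∨
  (x = arrWord k (aw 1 n 0 1 ++ aw 1 n 0 1) ∧
    y = arrWord k (aw 1 n 0 1 ++ bw 1 n 0 n)) ∨
  (x = arrWord k (bw 1 n (n - 1) 1 ++ bw 1 n 0 1) ∧ y = 0) ∨
  (∃ j : ℕ, 2 ≤ j ∧ j ≤ n - 1 ∧
    x = arrWord k (bw 1 n (j - 1) (n - j + 1) ++ aw 1 n 0 1 ++ bw 1 n 0 j) ∧ y = 0)

/-- The algebra `Ω(n) = kΔ(1,n)/I₇(n)`. -/
def OmAlg (n : ℕ) (_ : 0 < n) : Type :=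
  haveI : NeZero n := ⟨by omega⟩
  BoundQuiverAlg k (cycSrc 1 n) (cycTgt 1 n) (OmRelExtra k n)

instance (n : ℕ) (hn : 0 < n) : Ring (OmAlg k n hn) :=
  haveI : NeZero n := ⟨by omega⟩
  inferInstanceAs (Ring (BoundQuiverAlg k (cycSrc 1 n) (cycTgt 1 n) (OmRelExtra k n)))

instance (n : ℕ) (hn : 0 < n) : Algebra k (OmAlg k n hn) :=
  haveI : NeZero n := ⟨by omega⟩
  inferInstanceAs (Algebra k (BoundQuiverAlg k (cycSrc 1 n) (cycTgt 1 n) (OmRelExtra k n)))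

end TwoCycles
end QuiverAlg

section FacRigid

variable {R : Type} [Ring R]

/-- `X` is a quotient of a finite direct sum of copies of `M`. -/
def IsFac (R : Type) [Ring R] (M X : Type) [AddCommGroup M] [Module R M] [AddCommGroup X]
    [Module R X] : Prop :=
  ∃ (m : ℕ) (f : (Fin m → M) →ₗ[R] X), Function.Surjective f

/-- Every map from `M` lifts along a surjection whose kernel lies in `Fac M`
(that is, `Ext¹(M, Fac M) = 0`). -/
def ExtRigid (R : Type) [Ring R] (M : Type) [AddCommGroup M] [Module R M] : Prop :=
  ∀ (Y Z : Type) [AddCommGroup Y] [AddCommGroup Z] [Module R Y] [Module R Z] (p : Y →ₗ[R] Z),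
    Function.Surjective p → IsFac R M (LinearMap.ker p) →
    ∀ g : M →ₗ[R] Z, ∃ h : M →ₗ[R] Y, ∀ x, p (h x) = g x

variable {M N X Y Z P₀ P₁ : Type} [AddCommGroup M] [Module R M] [AddCommGroup N] [Module R N]
  [AddCommGroup X] [Module R X] [AddCommGroup Y] [Module R Y] [AddCommGroup Z] [Module R Z]
  [AddCommGroup P₀] [Module R P₀] [AddCommGroup P₁] [Module R P₁]

theorem exists_factor_of_surjective (p : X →ₗ[R] Y) (hp : Function.Surjective p)
    (f : X →ₗ[R] Z) (h : ∀ x, p x = 0 → f x = 0) : ∃ g : Y →ₗ[R] Z, ∀ x, g (p x) = f x := by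
  refine ⟨((LinearMap.ker p).liftQ f fun x hx => h x hx) ∘ₗ
    (p.quotKerEquivOfSurjective hp).symm.toLinearMap, fun x => ?_⟩
  have : (p.quotKerEquivOfSurjective hp).symm (p x) = Submodule.Quotient.mk x := by
    rw [LinearEquiv.symm_apply_eq]; rfl
  rw [LinearMap.comp_apply, LinearEquiv.coe_coe, this]
  rfl

theorem IsFac.of_surjective (f : M →ₗ[R] X) (hf : Function.Surjective f) : IsFac R M X :=
  ⟨1, f ∘ₗ LinearMap.proj 0, fun x => by
    obtain ⟨m, rfl⟩ := hf x
    exact ⟨fun _ => m, rfl⟩⟩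

theorem IsFac.of_fintype {ι : Type} [Finite ι] (f : (ι → M) →ₗ[R] X)
    (hf : Function.Surjective f) : IsFac R M X := by
  obtain ⟨m, ⟨e⟩⟩ := Finite.exists_equiv_fin ι
  exact ⟨m, f ∘ₗ (LinearEquiv.funCongrLeft R M e).toLinearMap,
    hf.comp (LinearEquiv.funCongrLeft R M e).surjective⟩

theorem IsFac.trans (h₁ : IsFac R M N) (h₂ : IsFac R N X) : IsFac R M X := by
  obtain ⟨m, f, hf⟩ := h₁
  obtain ⟨l, g, hg⟩ := h₂
  refine IsFac.of_fintype (ι := Fin l × Fin m)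
    (g ∘ₗ LinearMap.pi fun i => f ∘ₗ LinearMap.pi fun j => LinearMap.proj (i, j)) fun x => ?_
  obtain ⟨y, rfl⟩ := hg x
  choose w hw using fun i => hf (y i)
  exact ⟨fun ij => w ij.1 ij.2, congrArg g (funext fun i => hw i)⟩

theorem ExtRigid.retract (h : ExtRigid R M) (i : X →ₗ[R] M) (r : M →ₗ[R] X)
    (hri : ∀ x, r (i x) = x) : ExtRigid R X := by
  intro Y Z _ _ _ _ p hp hK g
  obtain ⟨s, hs⟩ := h Y Z p hp ((IsFac.of_surjective r fun x => ⟨i x, hri x⟩).trans hK) (g ∘ₗ r)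
  exact ⟨s ∘ₗ i, fun x => by simp [hs, hri]⟩

theorem ExtRigid.congr (h : ExtRigid R M) (e : M ≃ₗ[R] X) : ExtRigid R X :=
  h.retract e.symm.toLinearMap e.toLinearMap fun x => by simp

/-- A module is rigid as soon as every map from the first syzygy cover extends. -/
theorem ExtRigid.of_presentation [Module.Projective R P₀] [Module.Projective R P₁]
    (f : P₁ →ₗ[R] P₀) (g : P₀ →ₗ[R] M) (hg : Function.Surjective g)
    (hfg : LinearMap.range f = LinearMap.ker g)
    (H : ∀ h : P₁ →ₗ[R] M, ∃ u : P₀ →ₗ[R] M, ∀ x, u (f x) = h x) : ExtRigid R M := by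
  intro Y Z _ _ _ _ p hp hK γ
  have gf : ∀ x, g (f x) = 0 := fun x => by
    have : f x ∈ LinearMap.ker g := hfg ▸ LinearMap.mem_range_self f x
    exact this
  obtain ⟨t, ht⟩ := Module.projective_lifting_property p (γ ∘ₗ g) hp
  have ht' : ∀ x, p (t x) = γ (g x) := fun x => by
    rw [← LinearMap.comp_apply, ht]; rfl
  let c : P₁ →ₗ[R] LinearMap.ker p :=
    LinearMap.codRestrict _ (t ∘ₗ f) fun x => by simp [ht', gf]
  obtain ⟨m, q, hq⟩ := hK
  obtain ⟨d, hd⟩ := Module.projective_lifting_property q c hq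
  choose u hu using fun i => H (LinearMap.proj i ∘ₗ d)
  let v : P₀ →ₗ[R] Y := t - (LinearMap.ker p).subtype ∘ₗ q ∘ₗ LinearMap.pi u
  have hv : ∀ x, v (f x) = 0 := fun x => by
    have h1 : (LinearMap.pi u) (f x) = d x := funext fun i => hu i x
    have h2 : q (d x) = c x := by rw [← LinearMap.comp_apply, hd]
    simp only [v, LinearMap.sub_apply, LinearMap.comp_apply, h1, h2]
    simp [c]
  obtain ⟨s, hs⟩ := exists_factor_of_surjective g hg v fun x hx => by
    have : x ∈ LinearMap.range f := hfg ▸ hx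
    obtain ⟨y, rfl⟩ := this
    exact hv y
  refine ⟨s, fun x => ?_⟩
  obtain ⟨y, rfl⟩ := hg x
  rw [hs]
  simp [v, ht']

/-- For a rigid module, maps from the second term of a minimal presentation extend. -/
theorem ExtRigid.exists_extend (hM : ExtRigid R M) [IsArtinian R M] [Module.Projective R P₀]
    (f : P₁ →ₗ[R] P₀) (g : P₀ →ₗ[R] M) (hg : Function.Surjective g)
    (hfg : LinearMap.range f = LinearMap.ker g) (hmin : SuperfluousSubmodule (LinearMap.ker f))
    (h : P₁ →ₗ[R] M) : ∃ u : P₀ →ₗ[R] M, ∀ x, u (f x) = h x := by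
  have gf : ∀ x, g (f x) = 0 := fun x => by
    have : f x ∈ LinearMap.ker g := hfg ▸ LinearMap.mem_range_self f x
    exact this
  have key : ∀ h : P₁ →ₗ[R] M, ∃ u : P₀ →ₗ[R] M,
      ∀ x, ∃ q, f q = 0 ∧ h x - u (f x) = h q := by
    intro h
    let D : Submodule R (P₀ × M) := LinearMap.range (f.prod (-h))
    have hD : D ≤ LinearMap.ker (g ∘ₗ LinearMap.fst R P₀ M) := by
      rintro _ ⟨x, rfl⟩
      simp [gf]
    let p : ((P₀ × M) ⧸ D) →ₗ[R] M := D.liftQ _ hD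
    let ir : M →ₗ[R] (P₀ × M) ⧸ D := D.mkQ ∘ₗ LinearMap.inr R P₀ M
    let il : P₀ →ₗ[R] (P₀ × M) ⧸ D := D.mkQ ∘ₗ LinearMap.inl R P₀ M
    have hrel : ∀ x, il (f x) = ir (h x) := fun x => by
      refine (Submodule.Quotient.eq D).2 ⟨x, by simp⟩
    have hpl : ∀ x, p (il x) = g x := fun x => by simp [p, il]
    have hpr : ∀ x, p (ir x) = 0 := fun x => by simp [p, ir]
    have hp : Function.Surjective p := fun m => by
      obtain ⟨x, rfl⟩ := hg m
      exact ⟨il x, hpl x⟩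
    have hker : ∀ y, p y = 0 → ∃ m, ir m = y := by
      intro y hy
      obtain ⟨⟨a, b⟩, rfl⟩ := D.mkQ_surjective y
      have ha : a ∈ LinearMap.range f := by
        rw [hfg]; simpa [p] using hy
      obtain ⟨x, rfl⟩ := ha
      refine ⟨h x + b, ?_⟩
      rw [map_add, ← hrel]
      simp only [il, ir, LinearMap.comp_apply, ← map_add]
      simp
    let ir' : M →ₗ[R] LinearMap.ker p := LinearMap.codRestrict _ ir hpr
    have hir' : Function.Surjective ir' := by
      rintro ⟨y, hy⟩
      obtain ⟨m, hm⟩ := hker y hy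
      exact ⟨m, Subtype.ext hm⟩
    obtain ⟨s, hs⟩ := hM _ _ p hp (IsFac.of_surjective ir' hir') LinearMap.id
    let c : P₀ →ₗ[R] LinearMap.ker p := LinearMap.codRestrict _ (il - s ∘ₗ g) fun x => by
      simp [hpl, hs]
    obtain ⟨u, hu⟩ := Module.projective_lifting_property ir' c hir'
    have hu' : ∀ x, ir (u x) = il x - s (g x) := fun x => by
      exact congrArg Subtype.val (LinearMap.congr_fun hu x)
    refine ⟨u, fun x => ?_⟩
    have h1 : ir (u (f x)) = ir (h x) := by rw [hu', gf, map_zero, sub_zero, hrel]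
    obtain ⟨q, hq⟩ := (Submodule.Quotient.eq D).1 h1
    have hq1 : f q = 0 := by simpa using congrArg Prod.fst hq
    have hq2 : -h q = u (f x) - h x := by simpa using congrArg Prod.snd hq
    refine ⟨q, hq1, ?_⟩
    rw [← neg_inj, hq2, neg_sub]
  suffices ∀ (W : Submodule R M) (h : P₁ →ₗ[R] M), LinearMap.range h = W →
      ∃ u : P₀ →ₗ[R] M, ∀ x, u (f x) = h x from this _ h rfl
  intro W
  induction W using (wellFounded_lt (α := Submodule R M)).induction with
  | h W ih =>
  rintro h rfl
  obtain ⟨u, hu⟩ := key h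
  have hle : LinearMap.range (h - u ∘ₗ f) ≤ LinearMap.range h := by
    rintro _ ⟨x, rfl⟩
    obtain ⟨q, -, hq⟩ := hu x
    exact ⟨q, hq.symm⟩
  rcases hle.lt_or_eq with hlt | heq
  · obtain ⟨u', hu'⟩ := ih _ hlt _ rfl
    exact ⟨u' + u, fun x => by simp [hu']⟩
  · have htop : LinearMap.ker f ⊔ LinearMap.ker h = ⊤ := by
      rw [eq_top_iff]
      intro x _
      have : h x ∈ LinearMap.range (h - u ∘ₗ f) := heq ▸ LinearMap.mem_range_self h x
      obtain ⟨y, hy⟩ := this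
      obtain ⟨q, hq0, hq⟩ := hu y
      refine Submodule.mem_sup.2 ⟨q, hq0, x - q, ?_, by simp⟩
      rw [LinearMap.mem_ker, map_sub, ← hq, ← hy]
      simp
    have h0 : h = 0 := LinearMap.ker_eq_top.1 (hmin _ htop)
    exact ⟨0, fun x => by simp [h0]⟩

end FacRigid

section Cover

variable {R : Type} [Ring R]

/-- Finitely generated modules over an Artinian and Noetherian ring have projective covers. -/
theorem exists_projective_cover [IsArtinianRing R] [IsNoetherianRing R] (M : Type)
    [AddCommGroup M] [Module R M] [Module.Finite R M] :
    ∃ (P : Type) (_ : AddCommGroup P) (_ : Module R P) (g : P →ₗ[R] M),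
      Module.Projective R P ∧ Module.Finite R P ∧ Function.Surjective g ∧
      SuperfluousSubmodule (LinearMap.ker g) := by
  obtain ⟨m, G, hG⟩ := Module.Finite.exists_fin' R M
  let Good : Set (Submodule R (Fin m → R)) :=
    {Q | Module.Projective R Q ∧ Function.Surjective (G ∘ₗ Q.subtype)}
  have hne : Good.Nonempty := by
    refine ⟨⊤, Module.Projective.of_equiv (Submodule.topEquiv (R := R) (M := Fin m → R)).symm, ?_⟩
    intro x
    obtain ⟨y, rfl⟩ := hG x
    exact ⟨⟨y, trivial⟩, rfl⟩
  obtain ⟨Q, ⟨hQp, hQs⟩, hmin⟩ := IsArtinian.set_has_minimal Good hne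
  refine ⟨Q, inferInstance, inferInstance, G ∘ₗ Q.subtype, hQp, inferInstance, hQs, ?_⟩
  intro K hK
  have hKs : Function.Surjective ((G ∘ₗ Q.subtype) ∘ₗ K.subtype) := by
    intro x
    obtain ⟨y, rfl⟩ := hQs x
    have : y ∈ LinearMap.ker (G ∘ₗ Q.subtype) ⊔ K := hK ▸ trivial
    obtain ⟨a, ha, b, hb, rfl⟩ := Submodule.mem_sup.1 this
    refine ⟨⟨b, hb⟩, ?_⟩
    rw [map_add, LinearMap.mem_ker.1 ha, zero_add]
    rfl
  obtain ⟨s, hs⟩ := Module.projective_lifting_property _ (G ∘ₗ Q.subtype) hKs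
  let θ : Module.End R Q := K.subtype ∘ₗ s
  have hθ : ∀ x, G (θ x : Fin m → R) = G x := fun x => LinearMap.congr_fun hs x
  obtain ⟨j', hj, hj0⟩ := (θ.eventually_isCompl_ker_pow_range_pow.and
    (Filter.eventually_ge_atTop 1)).exists
  obtain ⟨j, hjj⟩ := Nat.exists_eq_add_of_le' hj0
  rw [hjj] at hj
  have hθj : ∀ i x, G ((θ ^ i) x : Fin m → R) = G x := by
    intro i
    induction i with
    | zero => intro x; simp
    | succ i ih => intro x; rw [pow_succ, Module.End.mul_apply, ih, hθ]
  let Q' := (LinearMap.range (θ ^ (j + 1))).map Q.subtype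
  have hQ' : Q' ∈ Good := by
    constructor
    · have h1 : Module.Projective R (LinearMap.range (θ ^ (j + 1))) :=
        Module.Projective.of_split (LinearMap.range (θ ^ (j + 1))).subtype
          ((LinearMap.range (θ ^ (j + 1))).projectionOnto _ hj.symm) (by
            ext x; simp)
      exact Module.Projective.of_equiv
        (Submodule.equivMapOfInjective Q.subtype Q.injective_subtype _)
    · intro x
      obtain ⟨y, rfl⟩ := hQs x
      exact ⟨⟨_, ⟨_, ⟨y, rfl⟩, rfl⟩⟩, hθj (j + 1) y⟩
  have hle : Q' ≤ Q := by
    rintro _ ⟨x, -, rfl⟩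
    exact x.2
  have heq : Q' = Q := by
    by_contra h
    exact hmin Q' hQ' (lt_of_le_of_ne hle h)
  rw [eq_top_iff]
  intro x _
  have : (x : Fin m → R) ∈ Q' := heq.symm.le x.2
  obtain ⟨z, ⟨w, hwz⟩, hw⟩ := this
  have hx : x = θ ((θ ^ j) w) := by
    rw [← Module.End.mul_apply, ← pow_succ']
    rw [hwz]
    exact Subtype.ext hw.symm
  rw [hx]
  exact (s _).2

end Cover

section TauRigid

theorem exists_dual_basis (R P : Type) [Ring R] [AddCommGroup P] [Module R P]
    [Module.Projective R P] [Module.Finite R P] :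
    ∃ (n : ℕ) (x : Fin n → P) (φ : Fin n → (P →ₗ[R] R)), ∀ p, ∑ i, φ i p • x i = p := by
  obtain ⟨n, f, g, -, -, hfg⟩ := Module.Finite.exists_comp_eq_id_of_projective R P
  refine ⟨n, fun i => f (Pi.single i 1), fun i => LinearMap.proj i ∘ₗ g, fun p => ?_⟩
  conv_rhs => rw [← LinearMap.id_apply (R := R) p, ← hfg, LinearMap.comp_apply,
    pi_eq_sum_univ' (g p), map_sum]
  refine Finset.sum_congr rfl fun i _ => ?_
  rw [map_smul]
  rfl

theorem SuperfluousSubmodule.finite {R P M : Type} [Ring R] [AddCommGroup P] [Module R P]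
    [AddCommGroup M] [Module R M] [Module.Finite R M] (g : P →ₗ[R] M)
    (hg : Function.Surjective g) (h : SuperfluousSubmodule (LinearMap.ker g)) :
    Module.Finite R P := by
  obtain ⟨m, G, hG⟩ := Module.Finite.exists_fin' R M
  obtain ⟨s, hs⟩ := Module.projective_lifting_property g G hg
  have : LinearMap.range s = ⊤ := h _ <| by
    rw [eq_top_iff]
    intro x _
    obtain ⟨y, hy⟩ := hG (g x)
    refine Submodule.mem_sup.2 ⟨x - s y, ?_, s y, ⟨y, rfl⟩, by simp⟩
    have := LinearMap.congr_fun hs y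
    rw [LinearMap.comp_apply] at this
    simp [this, hy]
  exact Module.Finite.of_surjective s (LinearMap.range_eq_top.1 this)

variable {k : Type} [Field k] {B : Type} [Ring B] [Algebra k B]

/-- Turn a functional with values in `Bᵐᵒᵖ` into one with values in the right module `B`. -/
def unopMap {P : Type} [AddCommGroup P] [Module Bᵐᵒᵖ P] (φ : P →ₗ[Bᵐᵒᵖ] Bᵐᵒᵖ) :
    P →ₗ[Bᵐᵒᵖ] B where
  toFun p := unop (φ p)
  map_add' x y := by simp
  map_smul' r p := by simp [MulOpposite.smul_eq_mul_unop]

/-- The map `p ↦ m·h(p)` from a projective module. -/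
def actHom {P M : Type} [AddCommGroup P] [Module Bᵐᵒᵖ P] [AddCommGroup M] [Module Bᵐᵒᵖ M]
    (m : M) (h : P →ₗ[Bᵐᵒᵖ] B) : P →ₗ[Bᵐᵒᵖ] M where
  toFun p := op (h p) • m
  map_add' x y := by simp [add_smul]
  map_smul' r p := by
    simp [MulOpposite.smul_eq_mul_unop, mul_smul]

theorem IsTauRigid.of_extRigid [Module.Finite k B] {M : ModuleCat.{0} Bᵐᵒᵖ}
    [Module.Finite Bᵐᵒᵖ M] (hM : ExtRigid Bᵐᵒᵖ M) : IsTauRigid k B M := by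
  have : IsArtinianRing Bᵐᵒᵖ := IsArtinianRing.of_finite k _
  have : IsNoetherianRing Bᵐᵒᵖ := IsNoetherianRing.of_finite k _
  intro P1 P0 f g ⟨hP1, hP0, hg, hfg, h0, h1⟩ β hb hv
  have : Module.Finite Bᵐᵒᵖ P0 := h0.finite g hg
  have : Module.Finite Bᵐᵒᵖ P1 := by
    refine SuperfluousSubmodule.finite f.rangeRestrict f.surjective_rangeRestrict ?_
    rwa [LinearMap.ker_rangeRestrict]
  obtain ⟨n, x, φ, hφ⟩ := exists_dual_basis Bᵐᵒᵖ P1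
  obtain ⟨l, y, ψ, hψ⟩ := exists_dual_basis Bᵐᵒᵖ P0
  ext m h
  obtain ⟨u, hu⟩ := hM.exists_extend f g hg hfg h1 (actHom m h)
  have e1 : ∀ h' : P1 →ₗ[Bᵐᵒᵖ] B, h' = ∑ i, leftMulHom B (h' (x i)) (unopMap (φ i)) := by
    intro h'
    ext p
    conv_lhs => rw [← hφ p, map_sum]
    simp [leftMulHom, unopMap, MulOpposite.smul_eq_mul_unop]
  have e2 : ∀ i, op (h (x i)) • m = ∑ j, op (unopMap (ψ j) (f (x i))) • u (y j) := by
    intro i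
    rw [show op (h (x i)) • m = actHom m h (x i) from rfl, ← hu]
    conv_lhs => rw [← hψ (f (x i)), map_sum]
    simp [unopMap]
  calc β m h = ∑ i, β (op (h (x i)) • m) (unopMap (φ i)) := by
        conv_lhs => rw [e1 h, map_sum]
        simp [hb]
    _ = ∑ j, ∑ i, β (u (y j)) (leftMulHom B (unopMap (ψ j) (f (x i))) (unopMap (φ i))) := by
        rw [Finset.sum_comm]
        refine Finset.sum_congr rfl fun i _ => ?_
        rw [e2, map_sum, LinearMap.sum_apply]
        simp [hb]
    _ = ∑ j, β (u (y j)) ((unopMap (ψ j)).comp f) := by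
        refine Finset.sum_congr rfl fun j _ => ?_
        conv_rhs => rw [e1 ((unopMap (ψ j)).comp f), map_sum]
        rfl
    _ = 0 := by simp [hv]

theorem IsTauRigid.extRigid [Module.Finite k B] {M : ModuleCat.{0} Bᵐᵒᵖ}
    [Module.Finite Bᵐᵒᵖ M] (hM : IsTauRigid k B M) : ExtRigid Bᵐᵒᵖ M := by
  have : IsArtinianRing Bᵐᵒᵖ := IsArtinianRing.of_finite k _
  have : IsNoetherianRing Bᵐᵒᵖ := IsNoetherianRing.of_finite k _
  obtain ⟨P0, _, _, g, hP0, _, hg, hg0⟩ := exists_projective_cover (R := Bᵐᵒᵖ) M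
  obtain ⟨P1, _, _, f', hP1, _, hf', hf0⟩ :=
    exists_projective_cover (R := Bᵐᵒᵖ) (LinearMap.ker g)
  let f : P1 →ₗ[Bᵐᵒᵖ] P0 := (LinearMap.ker g).subtype ∘ₗ f'
  have hfg : LinearMap.range f = LinearMap.ker g := by
    rw [LinearMap.range_comp, LinearMap.range_eq_top.2 hf', Submodule.map_top,
      Submodule.range_subtype]
  have hkf : LinearMap.ker f = LinearMap.ker f' :=
    LinearMap.ker_comp_of_ker_eq_bot _ (Submodule.ker_subtype _)
  refine ExtRigid.of_presentation f g hg hfg ?_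
  let : Module k M := Module.compHom M (algebraMap k Bᵐᵒᵖ)
  have hks : ∀ (c : k) (m : M), c • m = algebraMap k Bᵐᵒᵖ c • m := fun _ _ => rfl
  have : SMulCommClass Bᵐᵒᵖ k M := ⟨fun r c m => by
    rw [hks, hks, ← mul_smul, ← mul_smul, Algebra.commutes]⟩
  let W : Submodule k (P1 →ₗ[Bᵐᵒᵖ] M) :=
    { carrier := {h | ∃ u : P0 →ₗ[Bᵐᵒᵖ] M, ∀ x, u (f x) = h x}
      add_mem' := by
        rintro _ _ ⟨u, hu⟩ ⟨v, hv⟩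
        exact ⟨u + v, fun x => by simp [hu, hv]⟩
      zero_mem' := ⟨0, fun x => rfl⟩
      smul_mem' := by
        rintro c _ ⟨u, hu⟩
        exact ⟨c • u, fun x => by simp [hu]⟩ }
  by_contra! hcon
  obtain ⟨h0, hh0⟩ := hcon
  have hW : h0 ∉ W := by
    rintro ⟨u, hu⟩
    obtain ⟨x, hx⟩ := hh0 u
    exact hx (hu x)
  obtain ⟨lam, hlam, hker⟩ := Submodule.exists_le_ker_of_notMem hW
  let β : M →+ ((P1 →ₗ[Bᵐᵒᵖ] B) →ₗ[k] k) :=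
    { toFun := fun m =>
        { toFun := fun h => lam (actHom m h)
          map_add' := fun h h' => by
            rw [← map_add]
            congr 1
            ext p
            simp [actHom, add_smul]
          map_smul' := fun c h => by
            rw [RingHom.id_apply, ← map_smul]
            congr 1
            ext p
            rw [LinearMap.smul_apply, hks]
            simp only [actHom, LinearMap.coe_mk, AddHom.coe_mk, LinearMap.smul_apply,
              ← mul_smul, Algebra.smul_def]
            rw [Algebra.commutes]
            rfl }
      map_zero' := by
        ext h
        have : actHom (0 : M) h = 0 := by ext p; simp [actHom]
        simp [this]
      map_add' := fun m m' => by
        ext h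
        have : actHom (m + m') h = actHom m h + actHom m' h := by ext p; simp [actHom]
        simp [this] }
  have hβ : β = 0 := by
    refine hM (ModuleCat.of _ P1) (ModuleCat.of _ P0) f g
      ⟨hP1, hP0, hg, hfg, hg0, by rw [hkf]; exact hf0⟩ β ?_ ?_
    · intro m b h
      have : actHom (op b • m) h = actHom m (leftMulHom B b h) := by
        ext p
        simp [actHom, leftMulHom, mul_smul]
      exact congrArg lam this
    · intro m g0
      exact hker (show _ ∈ W from ⟨actHom m g0, fun x => rfl⟩)
  obtain ⟨n, x, φ, hφ⟩ := exists_dual_basis Bᵐᵒᵖ P1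
  apply hlam
  have : h0 = ∑ i, actHom (h0 (x i)) (unopMap (φ i)) := by
    ext p
    conv_lhs => rw [← hφ p, map_sum]
    simp [actHom, unopMap]
  rw [this, map_sum]
  refine Finset.sum_eq_zero fun i _ => ?_
  exact LinearMap.congr_fun (DFunLike.congr_fun hβ (h0 (x i))) (unopMap (φ i))

end TauRigid

section Reduction

variable {R S : Type} [Ring R] [Ring S] {φ : R →+* S} {z : R}

/-- `N` is the reduction of `M` modulo `z` along `φ`. -/
def Corr (φ : R →+* S) (z : R) (M N : Type) [AddCommGroup M] [Module R M] [AddCommGroup N]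
    [Module S N] : Prop :=
  ∃ π : M →ₛₗ[φ] N, Function.Surjective π ∧ ∀ m, π m = 0 → ∃ m', z • m' = m

variable {M N L X Y : Type} [AddCommGroup M] [Module R M] [AddCommGroup N] [Module S N]
  [AddCommGroup L] [Module S L] [AddCommGroup X] [Module R X] [AddCommGroup Y] [Module R Y]
  {M' N' X' Y' : Type} [AddCommGroup M'] [Module R M'] [AddCommGroup N'] [Module S N']
  [AddCommGroup X'] [Module S X'] [AddCommGroup Y'] [Module S Y']

theorem exists_factor_semilinear (hφ : Function.Surjective φ) (π : M →ₛₗ[φ] N)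
    (hπ : Function.Surjective π) (g : M →ₛₗ[φ] L) (h : ∀ x, π x = 0 → g x = 0) :
    ∃ g' : N →ₗ[S] L, ∀ x, g' (π x) = g x := by
  have key : ∀ x y, π x = π y → g x = g y := fun x y hxy => by
    rw [← sub_eq_zero, ← map_sub]
    exact h _ (by rw [map_sub, hxy, sub_self])
  have hs : ∀ x, g (Function.surjInv hπ (π x)) = g x := fun x =>
    key _ _ (Function.surjInv_eq hπ _)
  refine ⟨{ toFun := fun n => g (Function.surjInv hπ n), map_add' := ?_, map_smul' := ?_ }, hs⟩
  · intro a b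
    obtain ⟨a, rfl⟩ := hπ a
    obtain ⟨b, rfl⟩ := hπ b
    rw [← map_add, hs, hs, hs, map_add]
  · intro s a
    obtain ⟨a, rfl⟩ := hπ a
    obtain ⟨r, rfl⟩ := hφ s
    rw [← map_smulₛₗ, hs, hs, map_smulₛₗ, RingHom.id_apply]

theorem exists_descend (hφ : Function.Surjective φ) (h : ∀ r, φ r = 0 → ∀ x : X, r • x = 0) :
    ∃ _ : Module S X, ∀ (r : R) (x : X), φ r • x = r • x := by
  have key : ∀ (r : R) (x : X), Function.surjInv hφ (φ r) • x = r • x := fun r x => by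
    rw [← sub_eq_zero, ← sub_smul]
    exact h _ (by rw [map_sub, Function.surjInv_eq hφ, sub_self]) x
  let : SMul S X := ⟨fun s x => Function.surjInv hφ s • x⟩
  have hsm : ∀ (s : S) (x : X), s • x = Function.surjInv hφ s • x := fun _ _ => rfl
  refine ⟨{ one_smul := fun x => ?_, mul_smul := fun s t x => ?_,
            smul_zero := fun s => smul_zero (Function.surjInv hφ s),
            smul_add := fun s x y => smul_add (Function.surjInv hφ s) x y,
            add_smul := fun s t x => ?_, zero_smul := fun x => ?_ }, key⟩
  · obtain ⟨s, rfl⟩ := hφ s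
    obtain ⟨t, rfl⟩ := hφ t
    rw [hsm, hsm, hsm, ← map_mul, key, key, key, mul_smul]
  · rw [hsm, ← map_one φ, key, one_smul]
  · obtain ⟨s, rfl⟩ := hφ s
    obtain ⟨t, rfl⟩ := hφ t
    rw [hsm, hsm, hsm, ← map_add, key, key, key, add_smul]
  · rw [hsm, ← map_zero φ, key, zero_smul]

theorem Corr.congr (h : Corr φ z M N) (e : M ≃ₗ[R] M') (e' : N ≃ₗ[S] N') : Corr φ z M' N' := by
  obtain ⟨π, hπ, hk⟩ := h
  refine ⟨(e'.toLinearMap.comp π).comp e.symm.toLinearMap, ?_, ?_⟩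
  · exact e'.surjective.comp (hπ.comp e.symm.surjective)
  · intro m hm
    obtain ⟨m', hm'⟩ := hk (e.symm m) (by simpa using hm)
    exact ⟨e m', by rw [← map_smul, hm', e.apply_symm_apply]⟩

theorem Corr.pi {ι : Type} (h : Corr φ z M N) : Corr φ z (ι → M) (ι → N) := by
  obtain ⟨π, hπ, hk⟩ := h
  refine ⟨{ toFun := fun f i => π (f i), map_add' := ?_, map_smul' := ?_ }, ?_, ?_⟩
  · intro f g; ext i; simp
  · intro r f; ext i; simp
  · intro f
    choose g hg using fun i => hπ (f i)
    exact ⟨g, funext hg⟩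
  · intro f hf
    choose g hg using fun i => hk (f i) (congrFun hf i)
    exact ⟨g, funext hg⟩

theorem Corr.subsingleton_iff (hzz : z * z = 0) (h : Corr φ z M N) :
    Subsingleton M ↔ Subsingleton N := by
  obtain ⟨π, hπ, hk⟩ := h
  refine ⟨fun _ => hπ.subsingleton, fun _ => ⟨fun a b => ?_⟩⟩
  have : ∀ a : M, a = 0 := fun a => by
    obtain ⟨b, rfl⟩ := hk a (Subsingleton.elim _ _)
    obtain ⟨c, rfl⟩ := hk b (Subsingleton.elim _ _)
    rw [← mul_smul, hzz, zero_smul]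
  rw [this a, this b]

theorem Corr.exists_map (hφ : Function.Surjective φ) (hφz : φ z = 0) (h : Corr φ z M N)
    (g : M →ₛₗ[φ] L) : ∀ π : M →ₛₗ[φ] N, Function.Surjective π →
      (∀ m, π m = 0 → ∃ m', z • m' = m) → ∃ g' : N →ₗ[S] L, ∀ x, g' (π x) = g x := by
  intro π hπ hk
  refine exists_factor_semilinear hφ π hπ g fun x hx => ?_
  obtain ⟨y, rfl⟩ := hk x hx
  rw [map_smulₛₗ, hφz, zero_smul]

/-- Isomorphic modules have isomorphic reductions. -/
theorem Corr.equiv_of_equiv (hφ : Function.Surjective φ) (hφz : φ z = 0) (h : Corr φ z M N)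
    (h' : Corr φ z M' N') (θ : M ≃ₗ[R] M') : Nonempty (N ≃ₗ[S] N') := by
  obtain ⟨π, hπ, hk⟩ := id h
  obtain ⟨ρ, hρ, hl⟩ := id h'
  obtain ⟨a, ha⟩ := h.exists_map hφ hφz (ρ.comp θ.toLinearMap) π hπ hk
  obtain ⟨b, hb⟩ := h'.exists_map hφ hφz (π.comp θ.symm.toLinearMap) ρ hρ hl
  refine ⟨LinearEquiv.ofLinearMap a b ?_ ?_⟩
  · ext n
    obtain ⟨m, rfl⟩ := hρ n
    simp [hb, ha]
  · ext n
    obtain ⟨m, rfl⟩ := hπ n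
    simp [hb, ha]

theorem Corr.isFac (hφ : Function.Surjective φ) (hφz : φ z = 0) (h : Corr φ z M N)
    (h' : Corr φ z M' N') (H : IsFac R M M') : IsFac S N N' := by
  obtain ⟨m, f, hf⟩ := H
  obtain ⟨ρ, hρ, hl⟩ := id h'
  have h2 : Corr φ z (Fin m → M) (Fin m → N) := h.pi
  obtain ⟨π, hπ, hk⟩ := id h2
  obtain ⟨a, ha⟩ := h2.exists_map hφ hφz (ρ.comp f) π hπ hk
  refine ⟨m, a, fun y => ?_⟩
  obtain ⟨y, rfl⟩ := hρ y
  obtain ⟨x, rfl⟩ := hf y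
  exact ⟨π x, ha x⟩

/-- Splittings of a module induce splittings of its reduction. -/
theorem Corr.split (hφ : Function.Surjective φ) (hφz : φ z = 0) (h : Corr φ z M N)
    (θ : M ≃ₗ[R] (X × Y)) :
    ∃ (X' Y' : Submodule S N), Corr φ z X X' ∧ Corr φ z Y Y' ∧ Nonempty (N ≃ₗ[S] (X' × Y')) := by
  have : RingHomSurjective φ := ⟨hφ⟩
  obtain ⟨π, hπ, hk⟩ := h
  let a : X →ₛₗ[φ] N := (π.comp θ.symm.toLinearMap).comp (LinearMap.inl R X Y)
  let b : Y →ₛₗ[φ] N := (π.comp θ.symm.toLinearMap).comp (LinearMap.inr R X Y)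
  have hab : ∀ x y, a x + b y = π (θ.symm (x, y)) := fun x y => by
    simp only [a, b, LinearMap.comp_apply, ← map_add, LinearEquiv.coe_coe]
    simp
  have h0 : ∀ x y, a x + b y = 0 → (∃ x', z • x' = x) ∧ (∃ y', z • y' = y) := fun x y hxy => by
    rw [hab] at hxy
    obtain ⟨m, hm⟩ := hk _ hxy
    have : z • θ m = (x, y) := by rw [← map_smul, hm, θ.apply_symm_apply]
    exact ⟨⟨_, congrArg Prod.fst this⟩, ⟨_, congrArg Prod.snd this⟩⟩
  have hc : IsCompl (LinearMap.range a) (LinearMap.range b) := by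
    constructor
    · rw [Submodule.disjoint_def]
      rintro _ ⟨x, rfl⟩ ⟨y, hy⟩
      obtain ⟨x', rfl⟩ := (h0 x (-y) (by rw [map_neg, hy, add_neg_cancel])).1
      rw [map_smulₛₗ, hφz, zero_smul]
    · rw [codisjoint_iff, eq_top_iff]
      intro n _
      obtain ⟨m, rfl⟩ := hπ n
      refine Submodule.mem_sup.2 ⟨_, ⟨(θ m).1, rfl⟩, _, ⟨(θ m).2, rfl⟩, ?_⟩
      rw [hab]
      simp
  refine ⟨LinearMap.range a, LinearMap.range b, ?_, ?_,
    ⟨(Submodule.prodEquivOfIsCompl _ _ hc).symm⟩⟩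
  · refine ⟨a.rangeRestrict, a.surjective_rangeRestrict, fun x hx => ?_⟩
    exact (h0 x 0 (by simpa using congrArg Subtype.val hx)).1
  · refine ⟨b.rangeRestrict, b.surjective_rangeRestrict, fun x hx => ?_⟩
    exact (h0 0 x (by simpa using congrArg Subtype.val hx)).2

/-- Semilinear maps into a reduction of `Y` lift to `Y`. -/
def LiftsAlong (φ : R →+* S) (X Y Y' : Type) [AddCommGroup X] [Module R X] [AddCommGroup Y]
    [Module R Y] [AddCommGroup Y'] [Module S Y'] (ρ : Y →ₛₗ[φ] Y') : Prop :=
  ∀ g : X →ₛₗ[φ] Y', ∃ h : X →ₗ[R] Y, ∀ x, ρ (h x) = g x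

theorem Corr.range_idempotent {π : M →ₛₗ[φ] N} (hπ : Function.Surjective π)
    (hk : ∀ m, π m = 0 → ∃ m', z • m' = m) (e : Module.End R M) (he : ∀ m, e (e m) = e m)
    (i : X' →ₗ[S] N) (r : N →ₗ[S] X') (hri : ∀ x, r (i x) = x)
    (hcomp : ∀ m, π (e m) = i (r (π m))) : Corr φ z (LinearMap.range e) X' := by
  refine ⟨(r.comp π).comp (LinearMap.range e).subtype, fun x => ?_, ?_⟩
  · obtain ⟨m, hm⟩ := hπ (i x)
    refine ⟨⟨e m, m, rfl⟩, ?_⟩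
    simp [hcomp, hri, hm]
  · rintro ⟨_, m, rfl⟩ hm
    have h1 : π (e m) = 0 := by
      rw [← he, hcomp]
      have : r (π (e m)) = 0 := hm
      rw [this, map_zero]
    obtain ⟨m', hm'⟩ := hk _ h1
    refine ⟨⟨e m', m', rfl⟩, Subtype.ext ?_⟩
    show z • e m' = e m
    rw [← map_smul, hm', he]

theorem equiv_prod_range (e : Module.End R M) (he : ∀ m, e (e m) = e m) :
    Nonempty (M ≃ₗ[R] (LinearMap.range e × LinearMap.range (1 - e))) := by
  have hc : IsCompl (LinearMap.range e) (LinearMap.range (1 - e)) := by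
    constructor
    · rw [Submodule.disjoint_def]
      rintro _ ⟨x, rfl⟩ ⟨y, hy⟩
      rw [← he, ← hy]
      simp [he]
    · rw [codisjoint_iff, eq_top_iff]
      intro n _
      exact Submodule.mem_sup.2 ⟨_, ⟨n, rfl⟩, _, ⟨n, rfl⟩, by simp⟩
  exact ⟨(Submodule.prodEquivOfIsCompl _ _ hc).symm⟩

/-- Splittings of the reduction lift. -/
theorem Corr.exists_split (hzz : z * z = 0) {π : M →ₛₗ[φ] N} (hπ : Function.Surjective π)
    (hk : ∀ m, π m = 0 → ∃ m', z • m' = m) (hL : LiftsAlong φ M M N π)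
    (θ : N ≃ₗ[S] (X' × Y')) :
    ∃ X Y : Submodule R M, Corr φ z X X' ∧ Corr φ z Y Y' ∧ Nonempty (M ≃ₗ[R] (X × Y)) := by
  let iX : X' →ₗ[S] N := θ.symm.toLinearMap ∘ₗ LinearMap.inl S X' Y'
  let iY : Y' →ₗ[S] N := θ.symm.toLinearMap ∘ₗ LinearMap.inr S X' Y'
  let rX : N →ₗ[S] X' := LinearMap.fst S X' Y' ∘ₗ θ.toLinearMap
  let rY : N →ₗ[S] Y' := LinearMap.snd S X' Y' ∘ₗ θ.toLinearMap
  have hX : ∀ x, rX (iX x) = x := fun x => by simp [rX, iX]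
  have hY : ∀ x, rY (iY x) = x := fun x => by simp [rY, iY]
  have hsum : ∀ n, iX (rX n) + iY (rY n) = n := fun n => by
    simp only [iX, rX, iY, rY, LinearMap.comp_apply, LinearEquiv.coe_coe, ← map_add]
    simp
  obtain ⟨u, hu⟩ := hL ((iX ∘ₗ rX).comp π)
  have hu' : ∀ m, π (u m) = iX (rX (π m)) := hu
  have hw : ∀ m, ∃ m', z • m' = (u * u - u) m := fun m => hk _ (by
    simp [hu', hX])
  have hw2 : (u * u - u) * (u * u - u) = 0 := by
    ext m
    obtain ⟨m₁, h₁⟩ := hw m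
    obtain ⟨m₂, h₂⟩ := hw m₁
    rw [Module.End.mul_apply, ← h₁, map_smul, ← h₂, ← mul_smul, hzz, zero_smul]
    rfl
  let e : Module.End R M := 3 * (u * u) - 2 * (u * u * u)
  have hee : e * e - e = (u * u - u) * (u * u - u) * (4 * (u * u - u) - 3) := by
    simp only [e]
    noncomm_ring
  have he : ∀ m, e (e m) = e m := fun m => by
    rw [hw2, zero_mul, sub_eq_zero] at hee
    exact LinearMap.congr_fun hee m
  have hπe : ∀ m, π (e m) = iX (rX (π m)) := fun m => by
    have : e m = (u (u m) + u (u m) + u (u m)) - (u (u (u m)) + u (u (u m))) := by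
      have : e = (u * u + u * u + u * u) - (u * u * u + u * u * u) := by
        simp only [e]; noncomm_ring
      rw [this]; rfl
    rw [this]
    simp [hu', hX]
  refine ⟨LinearMap.range e, LinearMap.range (1 - e),
    Corr.range_idempotent hπ hk e he iX rX hX hπe,
    Corr.range_idempotent hπ hk (1 - e) (fun m => by simp [he]) iY rY hY fun m => ?_,
    equiv_prod_range e he⟩
  rw [LinearMap.sub_apply, map_sub, hπe, Module.End.one_apply, sub_eq_iff_eq_add', hsum]

theorem bijective_of_reduction_eq (hzz : z * z = 0) {π : M →ₛₗ[φ] N}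
    (hk : ∀ m, π m = 0 → ∃ m', z • m' = m) (u : Module.End R M) (hu : ∀ m, π (u m) = π m) :
    Function.Bijective u := by
  have key : ∀ m, ∃ y, z • y = m - u m := fun m => hk _ (by rw [map_sub, hu, sub_self])
  have key' : ∀ m, u (z • m) = z • m := fun m => by
    obtain ⟨y, hy⟩ := key m
    have : z • (m - u m) = 0 := by rw [← hy, ← mul_smul, hzz, zero_smul]
    rw [map_smul]
    rw [smul_sub, sub_eq_zero] at this
    exact this.symm
  constructor
  · rw [injective_iff_map_eq_zero]
    intro m hm
    obtain ⟨y, hy⟩ := key m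
    rw [hm, sub_zero] at hy
    rw [← hy, key', hy] at hm
    exact hm
  · intro m
    obtain ⟨y, hy⟩ := key m
    exact ⟨m + z • y, by rw [map_add, key', hy]; abel⟩

theorem Corr.equiv_of_equiv_reduction (hzz : z * z = 0)
    {π : M →ₛₗ[φ] N} (hk : ∀ m, π m = 0 → ∃ m', z • m' = m)
    {ρ : M' →ₛₗ[φ] N'} (hl : ∀ m, ρ m = 0 → ∃ m', z • m' = m)
    (hL : LiftsAlong φ M M' N' ρ) (hL' : LiftsAlong φ M' M N π)
    (θ : N ≃ₗ[S] N') : Nonempty (M ≃ₗ[R] M') := by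
  obtain ⟨h, hh⟩ := hL (θ.toLinearMap.comp π)
  obtain ⟨h', hh'⟩ := hL' (θ.symm.toLinearMap.comp ρ)
  have hb := bijective_of_reduction_eq hzz hk (h' ∘ₗ h) fun m => by simp [hh, hh']
  have hb' := bijective_of_reduction_eq hzz hl (h ∘ₗ h') fun m => by simp [hh, hh']
  refine ⟨LinearEquiv.ofBijective h ⟨?_, ?_⟩⟩
  · exact Function.Injective.of_comp (f := h') hb.1
  · exact Function.Surjective.of_comp (g := h') hb'.2

/-- Rigid modules lift semilinear maps into reductions lying in `Fac`. -/
theorem ExtRigid.liftsAlong (hz : ∀ r, z * r = r * z) (hzz : z * z = 0) (hφz : φ z = 0)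
    (hX : ExtRigid R X) (hXX : Corr φ z X X') {ρ : Y →ₛₗ[φ] Y'} (hρ : Function.Surjective ρ)
    (hl : ∀ m, ρ m = 0 → ∃ m', z • m' = m) (hfac : IsFac S X' Y') : LiftsAlong φ X Y Y' ρ := by
  intro g
  let : Module R Y' := Module.compHom Y' φ
  have hsm : ∀ (r : R) (y : Y'), r • y = φ r • y := fun _ _ => rfl
  let ρ' : Y →ₗ[R] Y' := { toFun := ρ, map_add' := map_add ρ, map_smul' := map_smulₛₗ ρ }
  let g' : X →ₗ[R] Y' := { toFun := g, map_add' := map_add g, map_smul' := map_smulₛₗ g }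
  let zz : Y →ₗ[R] LinearMap.ker ρ' :=
    { toFun := fun y => ⟨z • y, by
        show ρ (z • y) = 0
        rw [map_smulₛₗ, hφz, zero_smul]⟩
      map_add' := fun a b => Subtype.ext (smul_add _ _ _)
      map_smul' := fun r a => Subtype.ext (by
        show z • r • a = r • z • a
        rw [← mul_smul, hz, mul_smul]) }
  have hzz' : Function.Surjective zz := by
    rintro ⟨y, hy⟩
    obtain ⟨y', hy'⟩ := hl y hy
    exact ⟨y', Subtype.ext hy'⟩
  obtain ⟨ψ, hψ⟩ := exists_factor_of_surjective ρ' hρ zz fun x hx => by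
    obtain ⟨y', rfl⟩ := hl x hx
    refine Subtype.ext ?_
    show z • z • y' = 0
    rw [← mul_smul, hzz, zero_smul]
  have hψs : Function.Surjective ψ := fun y => by
    obtain ⟨x, rfl⟩ := hzz' y
    exact ⟨_, hψ x⟩
  obtain ⟨m, f, hf⟩ := hfac
  obtain ⟨σ, hσ, -⟩ : Corr φ z (Fin m → X) (Fin m → X') := hXX.pi
  let f' : (Fin m → X) →ₗ[R] Y' :=
    { toFun := fun x => f (σ x)
      map_add' := fun a b => by rw [map_add, map_add]
      map_smul' := fun r a => by rw [map_smulₛₗ, map_smul]; rfl }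
  exact hX _ _ ρ' hρ ⟨m, ψ ∘ₗ f', hψs.comp (hf.comp hσ)⟩ g'

/-- Membership in `Fac` is detected on reductions. -/
theorem Corr.isFac_of_reduction (hz : ∀ r, z * r = r * z) (hzz : z * z = 0) (hφz : φ z = 0)
    (hX : ExtRigid R X) (hXX : Corr φ z X X') (hYY : Corr φ z Y Y') (hfac : IsFac S X' Y') :
    IsFac R X Y := by
  obtain ⟨ρ, hρ, hl⟩ := hYY
  have hL := hX.liftsAlong hz hzz hφz hXX hρ hl hfac
  obtain ⟨m, f, hf⟩ := hfac
  obtain ⟨π, hπ, -⟩ := hXX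
  choose h hh using fun i : Fin m => hL ((f ∘ₗ LinearMap.single S _ i).comp π)
  let H : (Fin m → X) →ₗ[R] Y := ∑ i, h i ∘ₗ LinearMap.proj i
  have hH : ∀ x, ρ (H x) = f (fun i => π (x i)) := fun x => by
    have : (fun i => π (x i)) = ∑ i, Pi.single i (π (x i)) :=
      (Finset.univ_sum_single _).symm
    rw [this, map_sum]
    simp [H, hh]
  have key : ∀ y, ∃ x y', y = H x + z • y' := fun y => by
    obtain ⟨w, hw⟩ := hf (ρ y)
    choose x hx using fun i => hπ (w i)
    obtain ⟨y', hy'⟩ := hl (y - H x) (by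
      rw [map_sub, hH, ← hw, sub_eq_zero]
      congr 1
      exact (funext hx).symm)
    exact ⟨x, y', by rw [hy']; abel⟩
  refine ⟨m, H, fun y => ?_⟩
  obtain ⟨x, y', rfl⟩ := key y
  obtain ⟨x', y'', rfl⟩ := key y'
  exact ⟨x + z • x', by rw [map_add, map_smul, smul_add, ← mul_smul z z, hzz, zero_smul, add_zero]⟩

/-- Rigidity passes to reductions. -/
theorem ExtRigid.reduction (hφ : Function.Surjective φ) (hφz : φ z = 0) (hM : ExtRigid R M)
    (h : Corr φ z M N) : ExtRigid S N := by
  intro Y Z _ _ _ _ p hp hK g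
  obtain ⟨π, hπ, hk⟩ := id h
  let : Module R Y := Module.compHom Y φ
  let : Module R Z := Module.compHom Z φ
  let p' : Y →ₗ[R] Z := { toFun := p, map_add' := map_add p, map_smul' := fun r => map_smul p _ }
  let g' : M →ₗ[R] Z :=
    { toFun := fun m => g (π m)
      map_add' := fun a b => by rw [map_add, map_add]
      map_smul' := fun r a => by rw [map_smulₛₗ, map_smul]; rfl }
  obtain ⟨m, f, hf⟩ := hK
  obtain ⟨σ, hσ, -⟩ : Corr φ z (Fin m → M) (Fin m → N) := h.pi
  let f' : (Fin m → M) →ₗ[R] LinearMap.ker p' :=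
    { toFun := fun x => ⟨(f (σ x)).1, (f (σ x)).2⟩
      map_add' := fun a b => Subtype.ext (by rw [map_add, map_add]; rfl)
      map_smul' := fun r a => Subtype.ext (by rw [map_smulₛₗ, map_smul]; rfl) }
  have hf' : Function.Surjective f' := by
    rintro ⟨y, hy⟩
    obtain ⟨w, hw⟩ := hf ⟨y, hy⟩
    obtain ⟨x, rfl⟩ := hσ w
    exact ⟨x, Subtype.ext (congrArg Subtype.val hw)⟩
  obtain ⟨s, hs⟩ := hM Y Z p' hp ⟨m, f', hf'⟩ g'
  let s' : M →ₛₗ[φ] Y :=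
    { toFun := s, map_add' := map_add s, map_smul' := fun r a => map_smul s r a }
  obtain ⟨t, ht⟩ := h.exists_map hφ hφz s' π hπ hk
  refine ⟨t, fun n => ?_⟩
  obtain ⟨x, rfl⟩ := hπ n
  rw [ht]
  exact hs x

end Reduction

section Existence

variable {R S : Type} [Ring R] [Ring S] {φ : R →+* S} {z : R}
variable {M N L X Y : Type} [AddCommGroup M] [Module R M] [AddCommGroup N] [Module S N]
  [AddCommGroup X] [Module R X] [AddCommGroup Y] [Module R Y]
  {Y' : Type} [AddCommGroup Y'] [Module S Y']

theorem liftsAlong_of_zero {ρ : Y →ₛₗ[φ] Y'} (hρ : Function.Surjective ρ)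
    (hl : ∀ m, ρ m = 0 → ∃ m', (0 : R) • m' = m) : LiftsAlong φ X Y Y' ρ := by
  intro g
  have hinj : Function.Injective ρ := by
    rw [injective_iff_map_eq_zero]
    intro a ha
    obtain ⟨b, rfl⟩ := hl a ha
    exact zero_smul R b
  choose s hs using fun x => hρ (g x)
  refine ⟨{ toFun := s, map_add' := fun a b => hinj ?_, map_smul' := fun r a => hinj ?_ }, hs⟩
  · rw [hs, map_add, map_add, hs, hs]
  · rw [hs, map_smulₛₗ, map_smulₛₗ, RingHom.id_apply, hs]

theorem liftsAlong_of_projective [Module.Projective R X] {ρ : Y →ₛₗ[φ] Y'}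
    (hρ : Function.Surjective ρ) : LiftsAlong φ X Y Y' ρ := by
  intro g
  let : Module R Y' := Module.compHom Y' φ
  let ρ' : Y →ₗ[R] Y' := { toFun := ρ, map_add' := map_add ρ, map_smul' := map_smulₛₗ ρ }
  let g' : X →ₗ[R] Y' := { toFun := g, map_add' := map_add g, map_smul' := map_smulₛₗ g }
  obtain ⟨h, hh⟩ := Module.projective_lifting_property ρ' g' hρ
  exact ⟨h, fun x => LinearMap.congr_fun hh x⟩

/-- Every module has a reduction. -/
theorem exists_reduction (hφ : Function.Surjective φ) (hz : ∀ r, z * r = r * z)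
    (hker : ∀ r, φ r = 0 → ∃ c, r = z * c) (M : Type) [AddCommGroup M] [Module R M] :
    ∃ (N : Type) (_ : AddCommGroup N) (_ : Module S N), Corr φ z M N := by
  let zz : M →ₗ[R] M :=
    { toFun := fun m => z • m
      map_add' := smul_add z
      map_smul' := fun r m => by rw [← mul_smul, hz, mul_smul]; rfl }
  obtain ⟨inst, hinst⟩ := exists_descend (X := M ⧸ LinearMap.range zz) hφ fun r hr x => by
    obtain ⟨c, rfl⟩ := hker r hr
    obtain ⟨m, rfl⟩ := Submodule.mkQ_surjective _ x
    rw [← map_smul]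
    refine (Submodule.Quotient.mk_eq_zero _).2 ⟨c • m, ?_⟩
    exact (mul_smul z c m).symm
  refine ⟨_, _, inst, { toFun := (LinearMap.range zz).mkQ, map_add' := map_add _,
                        map_smul' := fun r m => ?_ }, ?_, ?_⟩
  · rw [hinst, map_smul]
  · exact Submodule.mkQ_surjective _
  · intro m hm
    exact (Submodule.Quotient.mk_eq_zero _).1 hm

theorem exists_projective_lift (hφ : Function.Surjective φ) (hzz : z * z = 0)
    (hker : ∀ r, φ r = 0 → ∃ c, r = z * c) (P : Type) [AddCommGroup P] [Module S P]
    [Module.Finite S P] [Module.Projective S P] :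
    ∃ (Q : Type) (_ : AddCommGroup Q) (_ : Module R Q), Module.Finite R Q ∧
      Module.Projective R Q ∧ Corr φ z Q P := by
  obtain ⟨n, f, g, -, -, hfg⟩ := Module.Finite.exists_comp_eq_id_of_projective S P
  have hfg' : ∀ x, f (g x) = x := fun x => LinearMap.congr_fun hfg x
  have hR : Corr φ z R S := ⟨{ toFun := φ, map_add' := map_add φ, map_smul' := map_mul φ }, hφ,
    fun r hr => by
      obtain ⟨c, rfl⟩ := hker r hr
      exact ⟨c, rfl⟩⟩
  obtain ⟨π, hπ, hk⟩ : Corr φ z (Fin n → R) (Fin n → S) := hR.pi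
  obtain ⟨θ⟩ := equiv_prod_range (g ∘ₗ f) fun m => by simp [hfg']
  obtain ⟨X, Y, hX, -, ⟨e⟩⟩ := Corr.exists_split hzz hπ hk (liftsAlong_of_projective hπ) θ
  have hPe : LinearMap.range (g ∘ₗ f) = LinearMap.range g := by
    rw [LinearMap.range_comp, LinearMap.range_eq_top.2 fun x => ⟨g x, hfg' x⟩, Submodule.map_top]
  have hginj : Function.Injective g := fun a b hab => by rw [← hfg' a, hab, hfg']
  have hXp : ∀ x, (LinearMap.fst R X Y ∘ₗ e.toLinearMap)
      ((e.symm.toLinearMap ∘ₗ LinearMap.inl R X Y) x) = x := fun x => by simp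
  refine ⟨X, inferInstance, inferInstance, ?_, ?_, hX.congr (LinearEquiv.refl R X)
    ((LinearEquiv.ofEq _ _ hPe).trans (LinearEquiv.ofInjective g hginj).symm)⟩
  · exact Module.Finite.of_surjective (LinearMap.fst R X Y ∘ₗ e.toLinearMap) fun x => ⟨_, hXp x⟩
  · exact Module.Projective.of_split (e.symm.toLinearMap ∘ₗ LinearMap.inl R X Y)
      (LinearMap.fst R X Y ∘ₗ e.toLinearMap) (LinearMap.ext hXp)

/-- Rigid modules lift along the reduction. -/
theorem ExtRigid.exists_lift [IsArtinianRing S] [IsNoetherianRing S]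
    (hφ : Function.Surjective φ) (hz : ∀ r, z * r = r * z) (hzz : z * z = 0) (hφz : φ z = 0)
    (hker : ∀ r, φ r = 0 → ∃ c, r = z * c) (N : Type) [AddCommGroup N] [Module S N]
    [Module.Finite S N] (hN : ExtRigid S N) :
    ∃ (M : Type) (_ : AddCommGroup M) (_ : Module R M), Module.Finite R M ∧
      ExtRigid R M ∧ Corr φ z M N := by
  obtain ⟨P0, _, _, g, hP0, _, hg, hg0⟩ := exists_projective_cover (R := S) N
  obtain ⟨P1, _, _, f', hP1, _, hf', hf0⟩ := exists_projective_cover (R := S) (LinearMap.ker g)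
  let f : P1 →ₗ[S] P0 := (LinearMap.ker g).subtype ∘ₗ f'
  have hfg : LinearMap.range f = LinearMap.ker g := by
    rw [LinearMap.range_comp, LinearMap.range_eq_top.2 hf', Submodule.map_top,
      Submodule.range_subtype]
  have hkf : LinearMap.ker f = LinearMap.ker f' :=
    LinearMap.ker_comp_of_ker_eq_bot _ (Submodule.ker_subtype _)
  have hext := hN.exists_extend f g hg hfg (by rw [hkf]; exact hf0)
  have gf : ∀ x, g (f x) = 0 := fun x => by
    have : f x ∈ LinearMap.ker g := hfg ▸ LinearMap.mem_range_self f x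
    exact this
  obtain ⟨Q0, _, _, _, _, hQ0⟩ := exists_projective_lift hφ hzz hker P0
  obtain ⟨Q1, _, _, _, _, hQ1⟩ := exists_projective_lift hφ hzz hker P1
  obtain ⟨π0, hπ0, hk0⟩ := id hQ0
  obtain ⟨π1, hπ1, hk1⟩ := id hQ1
  obtain ⟨F, hF⟩ := liftsAlong_of_projective (X := Q1) hπ0 (f.comp π1)
  have hF' : ∀ x, π0 (F x) = f (π1 x) := hF
  let M := Q0 ⧸ LinearMap.range F
  let q : Q0 →ₗ[R] M := (LinearMap.range F).mkQ
  have hq : Function.Surjective q := Submodule.mkQ_surjective _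
  have hqF : LinearMap.range F = LinearMap.ker q := (Submodule.ker_mkQ _).symm
  have hq0 : ∀ x, q x = 0 → ∃ y, F y = x := fun x hx => by
    have : x ∈ LinearMap.range F := hqF ▸ hx
    exact this
  let π : M →ₛₗ[φ] N := Submodule.liftQ _ (g.comp π0) (by
    rintro _ ⟨x, rfl⟩
    show g (π0 (F x)) = 0
    rw [hF', gf])
  have hπq : ∀ x, π (q x) = g (π0 x) := fun x => rfl
  have hπ : Function.Surjective π := fun n => by
    obtain ⟨p, rfl⟩ := hg n
    obtain ⟨x, rfl⟩ := hπ0 p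
    exact ⟨q x, hπq x⟩
  have hk : ∀ m, π m = 0 → ∃ m', z • m' = m := fun m hm => by
    obtain ⟨x, rfl⟩ := hq m
    rw [hπq] at hm
    have : π0 x ∈ LinearMap.range f := hfg ▸ hm
    obtain ⟨p, hp⟩ := this
    obtain ⟨y, rfl⟩ := hπ1 p
    obtain ⟨w, hw⟩ := hk0 (x - F y) (by rw [map_sub, hF', hp, sub_self])
    refine ⟨q w, ?_⟩
    rw [← map_smul, hw, map_sub]
    have : q (F y) = 0 := by
      have : F y ∈ LinearMap.ker q := hqF ▸ LinearMap.mem_range_self F y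
      exact this
    rw [this, sub_zero]
  refine ⟨M, inferInstance, inferInstance, inferInstance, ?_, π, hπ, hk⟩
  refine ExtRigid.of_presentation F q hq hqF ?_
  have step : ∀ h : Q1 →ₗ[R] M, ∃ u : Q0 →ₗ[R] M, ∀ x, ∃ m, z • m = h x - u (F x) := by
    intro h
    obtain ⟨h', hh'⟩ := hQ1.exists_map hφ hφz (π.comp h) π1 hπ1 hk1
    obtain ⟨v, hv⟩ := hext h'
    obtain ⟨u, hu⟩ := liftsAlong_of_projective (X := Q0) hπ (v.comp π0)
    refine ⟨u, fun x => hk _ ?_⟩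
    have e1 : π (u (F x)) = v (π0 (F x)) := hu _
    have e2 : h' (π1 x) = π (h x) := hh' x
    rw [map_sub, e1, hF', hv, e2, sub_self]
  intro h
  obtain ⟨u, hu⟩ := step h
  let zz : M →ₗ[R] M :=
    { toFun := fun m => z • m
      map_add' := smul_add z
      map_smul' := fun r m => by rw [← mul_smul, hz, mul_smul]; rfl }
  obtain ⟨h1, hh1⟩ := Module.projective_lifting_property zz.rangeRestrict
    (LinearMap.codRestrict (LinearMap.range zz) (h - u ∘ₗ F) fun x => hu x)
    zz.surjective_rangeRestrict
  have hh1' : ∀ x, z • h1 x = h x - u (F x) := fun x =>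
    congrArg Subtype.val (LinearMap.congr_fun hh1 x)
  obtain ⟨u1, hu1⟩ := step h1
  refine ⟨u + zz ∘ₗ u1, fun x => ?_⟩
  obtain ⟨m, hm⟩ := hu1 x
  have : z • h1 x = z • u1 (F x) := by
    rw [← sub_eq_zero, ← smul_sub, ← hm, ← mul_smul, hzz, zero_smul]
  show u (F x) + z • u1 (F x) = h x
  rw [← this, hh1']
  abel

/-- Rigidity over the quotient by an idempotent ideal gives rigidity. -/
theorem ExtRigid.of_idempotent (hφ : Function.Surjective φ) (e : R) (he : e * e = e)
    (hφe : φ e = 0)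
    (hker : ∀ (X : Type) [AddCommGroup X] [Module R X], (∀ x : X, e • x = 0) →
      ∀ r, φ r = 0 → ∀ x : X, r • x = 0) (hMN : Corr φ 0 M N) (hN : ExtRigid S N) :
    ExtRigid R M := by
  obtain ⟨π, hπ, hk⟩ := hMN
  have hinj : Function.Injective π := by
    rw [injective_iff_map_eq_zero]
    intro a ha
    obtain ⟨b, rfl⟩ := hk a ha
    exact zero_smul R b
  have heM : ∀ m : M, e • m = 0 := fun m => hinj (by
    rw [map_smulₛₗ, hφe, zero_smul, map_zero])
  intro Y Z _ _ _ _ p hp hK g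
  have hKe : ∀ y, p y = 0 → e • y = 0 := by
    obtain ⟨m, f, hf⟩ := hK
    intro y hy
    obtain ⟨x, hx⟩ := hf ⟨y, hy⟩
    have h0 : f (e • x) = 0 := by
      have : e • x = 0 := funext fun i => heM _
      rw [this, map_zero]
    rw [map_smul, hx] at h0
    exact congrArg Subtype.val h0
  let G := LinearMap.range g
  let Y0 := G.comap p
  have hGe : ∀ x : G, e • x = 0 := by
    rintro ⟨_, m, rfl⟩
    refine Subtype.ext ?_
    show e • g m = 0
    rw [← map_smul, heM, map_zero]
  have hYe : ∀ y : Y0, e • y = 0 := by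
    rintro ⟨y, hy⟩
    refine Subtype.ext ?_
    show e • y = 0
    have h1 : p (e • y) = 0 := by
      rw [map_smul]
      exact congrArg Subtype.val (hGe ⟨p y, hy⟩)
    have := hKe _ h1
    rwa [← mul_smul, he] at this
  obtain ⟨_, hiG⟩ := exists_descend hφ (hker G hGe)
  obtain ⟨_, hiY⟩ := exists_descend hφ (hker Y0 hYe)
  let p0 : Y0 →ₗ[S] G :=
    { toFun := fun y => ⟨p y.1, y.2⟩
      map_add' := fun a b => Subtype.ext (map_add p _ _)
      map_smul' := fun s a => by
        obtain ⟨r, rfl⟩ := hφ s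
        rw [hiY, RingHom.id_apply, hiG]
        exact Subtype.ext (map_smul p r a.1) }
  have hp0 : Function.Surjective p0 := by
    rintro ⟨x, hx⟩
    obtain ⟨y, rfl⟩ := hp x
    exact ⟨⟨y, hx⟩, rfl⟩
  let g0 : M →ₛₗ[φ] G :=
    { toFun := fun m => ⟨g m, m, rfl⟩
      map_add' := fun a b => Subtype.ext (map_add g _ _)
      map_smul' := fun r a => by
        rw [hiG]
        exact Subtype.ext (map_smul g r a) }
  obtain ⟨g1, hg1⟩ := exists_factor_semilinear hφ π hπ g0 fun x hx => by
    rw [hinj (hx.trans (map_zero π).symm), map_zero]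
  have hfac : IsFac S N (LinearMap.ker p0) := by
    obtain ⟨m, f, hf⟩ := hK
    have hpi : Corr φ 0 (Fin m → M) (Fin m → N) := Corr.pi ⟨π, hπ, hk⟩
    obtain ⟨σ, hσ, hσk⟩ := id hpi
    let f0 : (Fin m → M) →ₛₗ[φ] Y0 :=
      { toFun := fun x => ⟨(f x).1, by
          show p (f x).1 ∈ G
          rw [(f x).2]
          exact zero_mem _⟩
        map_add' := fun a b => Subtype.ext (by rw [map_add]; rfl)
        map_smul' := fun r a => by
          rw [hiY]
          exact Subtype.ext (by rw [map_smul]; rfl) }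
    obtain ⟨f1, hf1⟩ := hpi.exists_map hφ (map_zero φ) f0 σ hσ hσk
    refine ⟨m, LinearMap.codRestrict _ f1 fun x => ?_, ?_⟩
    · obtain ⟨x, rfl⟩ := hσ x
      rw [hf1]
      exact Subtype.ext (f x).2
    · rintro ⟨y, hy⟩
      obtain ⟨x, hx⟩ := hf ⟨y.1, congrArg Subtype.val hy⟩
      refine ⟨σ x, Subtype.ext ?_⟩
      show f1 (σ x) = y
      rw [hf1]
      have hx' : (f x).1 = y.1 := congrArg Subtype.val hx
      exact Subtype.ext hx'
  obtain ⟨s, hs⟩ := hN _ _ p0 hp0 hfac g1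
  refine ⟨{ toFun := fun m => (s (π m)).1, map_add' := fun a b => by rw [map_add, map_add]; rfl,
            map_smul' := fun r a => ?_ }, fun m => ?_⟩
  · rw [map_smulₛₗ, map_smul, hiY]
    rfl
  · have := (hs (π m)).trans (hg1 m)
    exact congrArg Subtype.val this

end Existence

section Counting

/-- There are exactly `n` isomorphism classes of modules satisfying `P`. -/
def CountIs (R : Type) [Ring R] (P : ModuleCat.{0} R → Prop) (n : ℕ) : Prop :=
  ∃ N : Fin n → ModuleCat.{0} R,
    (∀ i, P (N i)) ∧ (∀ i j, i ≠ j → IsEmpty ((N i) ≃ₗ[R] (N j))) ∧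
    (∀ L, P L → ∃ i, Nonempty (L ≃ₗ[R] N i))

theorem CountIs.transfer {R S : Type} [Ring R] [Ring S] {P : ModuleCat.{0} R → Prop}
    {Q : ModuleCat.{0} S → Prop} (T : ModuleCat.{0} R → ModuleCat.{0} S → Prop)
    (hT : ∀ X X' Y Y', T X X' → T Y Y' → (Nonempty (X ≃ₗ[R] Y) ↔ Nonempty (X' ≃ₗ[S] Y')))
    (h₁ : ∀ X, P X → ∃ X', Q X' ∧ T X X') (h₂ : ∀ X', Q X' → ∃ X, P X ∧ T X X') {n : ℕ}
    (h : CountIs R P n) : CountIs S Q n := by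
  obtain ⟨N, hN, hne, hex⟩ := h
  choose N' hN' hT' using fun i => h₁ _ (hN i)
  refine ⟨N', hN', fun i j hij => ?_, fun L hL => ?_⟩
  · rw [← not_nonempty_iff, ← hT _ _ _ _ (hT' i) (hT' j), not_nonempty_iff]
    exact hne i j hij
  · obtain ⟨X, hX, hXL⟩ := h₂ L hL
    obtain ⟨i, hi⟩ := hex X hX
    exact ⟨i, (hT _ _ _ _ hXL (hT' i)).1 hi⟩

end Counting

section SplitRel

/-- A correspondence between modules compatible with isomorphisms and direct sum
decompositions. -/
structure SplitRel {R S : Type} [Ring R] [Ring S]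
    (T : ModuleCat.{0} R → ModuleCat.{0} S → Prop) : Prop where
  equiv : ∀ X X' Y Y', T X X' → T Y Y' → (Nonempty (X ≃ₗ[R] Y) ↔ Nonempty (X' ≃ₗ[S] Y'))
  split : ∀ M N, T M N → ∀ X Y : ModuleCat.{0} R, Nonempty (M ≃ₗ[R] (X × Y)) →
    ∃ X' Y' : ModuleCat.{0} S, T X X' ∧ T Y Y' ∧ Nonempty (N ≃ₗ[S] (X' × Y'))
  split' : ∀ M N, T M N → ∀ X' Y' : ModuleCat.{0} S, Nonempty (N ≃ₗ[S] (X' × Y')) →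
    ∃ X Y : ModuleCat.{0} R, T X X' ∧ T Y Y' ∧ Nonempty (M ≃ₗ[R] (X × Y))
  subsingleton : ∀ M N, T M N → (Subsingleton M ↔ Subsingleton N)

theorem SplitRel.flip {R S : Type} [Ring R] [Ring S]
    {T : ModuleCat.{0} R → ModuleCat.{0} S → Prop} (h : SplitRel T) :
    SplitRel fun N M => T M N where
  equiv X X' Y Y' hX hY := (h.equiv _ _ _ _ hX hY).symm
  split M N hMN := h.split' N M hMN
  split' M N hMN := h.split N M hMN
  subsingleton M N hMN := (h.subsingleton N M hMN).symm

variable {B C : Type} [Ring B] [Ring C]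
  {T : ModuleCat.{0} Bᵐᵒᵖ → ModuleCat.{0} Cᵐᵒᵖ → Prop}
  {M : ModuleCat.{0} Bᵐᵒᵖ} {N : ModuleCat.{0} Cᵐᵒᵖ}

theorem SplitRel.isBasicMod (h : SplitRel T) (hMN : T M N) (hM : IsBasicMod B M) :
    IsBasicMod C N := by
  rintro L K ⟨θ⟩
  obtain ⟨X, Y, hX, hY, ⟨e⟩⟩ := h.split' M N hMN L (ModuleCat.of Cᵐᵒᵖ (L × K)) ⟨θ⟩
  obtain ⟨X₂, Z, hX₂, hZ, ⟨e₂⟩⟩ := h.split' Y _ hY L K ⟨LinearEquiv.refl _ _⟩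
  obtain ⟨e₃⟩ := (h.equiv _ _ _ _ hX₂ hX).2 ⟨LinearEquiv.refl _ _⟩
  rw [← h.subsingleton _ _ hX]
  have e₄ : Y ≃ₗ[Bᵐᵒᵖ] (X × Z) := e₂.trans (e₃.prodCongr (LinearEquiv.refl Bᵐᵒᵖ Z))
  exact hM X Z ⟨e.trans ((LinearEquiv.refl Bᵐᵒᵖ X).prodCongr e₄)⟩

theorem SplitRel.indecomposable (h : SplitRel T) (hMN : T M N) (hM : IndecomposableMod B M) :
    IndecomposableMod C N := by
  refine ⟨?_, fun L L' hL => ?_⟩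
  · rw [← not_subsingleton_iff_nontrivial, ← h.subsingleton _ _ hMN,
      not_subsingleton_iff_nontrivial]
    exact hM.1
  · obtain ⟨X, Y, hX, hY, e⟩ := h.split' M N hMN L L' hL
    rw [← h.subsingleton _ _ hX, ← h.subsingleton _ _ hY]
    exact hM.2 X Y e

theorem SplitRel.exists_isIndecSummand (h : SplitRel T) (hMN : T M N) {L : ModuleCat.{0} Bᵐᵒᵖ}
    (hL : IsIndecSummand B L M) : ∃ L', IsIndecSummand C L' N ∧ T L L' := by
  obtain ⟨hL, L₂, e⟩ := hL
  obtain ⟨X, Y, hX, hY, e'⟩ := h.split M N hMN L L₂ e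
  exact ⟨X, ⟨h.indecomposable hX hL, Y, e'⟩, hX⟩

theorem SplitRel.numIndecSummandsIs (h : SplitRel T) (hMN : T M N) {n : ℕ}
    (hM : NumIndecSummandsIs B M n) : NumIndecSummandsIs C N n :=
  CountIs.transfer (P := fun L => IsIndecSummand B L M) (Q := fun L => IsIndecSummand C L N) T
    h.equiv (fun _ hX => h.exists_isIndecSummand hMN hX)
    (fun _ hX => h.flip.exists_isIndecSummand (T := fun N M => T M N) hMN hX) hM

end SplitRel

section Transfer

variable {R S : Type} [Ring R] [Ring S] {φ : R →+* S} {z : R}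

theorem splitRel_zero (hφ : Function.Surjective φ) :
    SplitRel (fun (M : ModuleCat.{0} R) (N : ModuleCat.{0} S) => Corr φ 0 M N) where
  equiv X X' Y Y' hX hY := by
    refine ⟨fun ⟨θ⟩ => hX.equiv_of_equiv hφ (map_zero φ) hY θ, fun ⟨θ⟩ => ?_⟩
    obtain ⟨π, hπ, hk⟩ := hX
    obtain ⟨ρ, hρ, hl⟩ := hY
    exact Corr.equiv_of_equiv_reduction (mul_zero 0) hk hl (liftsAlong_of_zero hρ hl)
      (liftsAlong_of_zero hπ hk) θ
  split M N hMN X Y := fun ⟨θ⟩ => by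
    obtain ⟨X', Y', hX, hY, e⟩ := hMN.split hφ (map_zero φ) θ
    exact ⟨ModuleCat.of S X', ModuleCat.of S Y', hX, hY, e⟩
  split' M N hMN X Y := fun ⟨θ⟩ => by
    obtain ⟨π, hπ, hk⟩ := hMN
    obtain ⟨X', Y', hX, hY, e⟩ :=
      Corr.exists_split (mul_zero 0) hπ hk (liftsAlong_of_zero hπ hk) θ
    exact ⟨ModuleCat.of R X', ModuleCat.of R Y', hX, hY, e⟩
  subsingleton M N hMN := hMN.subsingleton_iff (mul_zero 0)

theorem splitRel_extRigid (hφ : Function.Surjective φ) (hz : ∀ r, z * r = r * z)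
    (hzz : z * z = 0) (hφz : φ z = 0) :
    SplitRel (fun (M : ModuleCat.{0} R) (N : ModuleCat.{0} S) =>
      ExtRigid R M ∧ Corr φ z M N) where
  equiv X X' Y Y' hX hY := by
    refine ⟨fun ⟨θ⟩ => hX.2.equiv_of_equiv hφ hφz hY.2 θ, fun ⟨θ⟩ => ?_⟩
    obtain ⟨hXr, hXX⟩ := hX
    obtain ⟨hYr, hYY⟩ := hY
    obtain ⟨π, hπ, hk⟩ := id hXX
    obtain ⟨ρ, hρ, hl⟩ := id hYY
    exact Corr.equiv_of_equiv_reduction hzz hk hl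
      (hXr.liftsAlong hz hzz hφz hXX hρ hl (IsFac.of_surjective θ.toLinearMap θ.surjective))
      (hYr.liftsAlong hz hzz hφz hYY hπ hk
        (IsFac.of_surjective θ.symm.toLinearMap θ.symm.surjective)) θ
  split M N hMN X Y := fun ⟨θ⟩ => by
    obtain ⟨X', Y', hX, hY, e⟩ := hMN.2.split hφ hφz θ
    refine ⟨ModuleCat.of S X', ModuleCat.of S Y', ⟨?_, hX⟩, ⟨?_, hY⟩, e⟩
    · exact hMN.1.retract (θ.symm.toLinearMap ∘ₗ LinearMap.inl R X Y)
        (LinearMap.fst R X Y ∘ₗ θ.toLinearMap) fun x => by simp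
    · exact hMN.1.retract (θ.symm.toLinearMap ∘ₗ LinearMap.inr R X Y)
        (LinearMap.snd R X Y ∘ₗ θ.toLinearMap) fun x => by simp
  split' M N hMN X Y := fun ⟨θ⟩ => by
    obtain ⟨hM, hMN⟩ := hMN
    obtain ⟨π, hπ, hk⟩ := id hMN
    obtain ⟨X', Y', hX, hY, ⟨e⟩⟩ := Corr.exists_split hzz hπ hk
      (hM.liftsAlong hz hzz hφz hMN hπ hk (IsFac.of_surjective LinearMap.id fun x => ⟨x, rfl⟩)) θ
    refine ⟨ModuleCat.of R X', ModuleCat.of R Y', ⟨?_, hX⟩, ⟨?_, hY⟩, ⟨e⟩⟩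
    · exact hM.retract (e.symm.toLinearMap ∘ₗ LinearMap.inl R X' Y')
        (LinearMap.fst R X' Y' ∘ₗ e.toLinearMap) fun x => by simp
    · exact hM.retract (e.symm.toLinearMap ∘ₗ LinearMap.inr R X' Y')
        (LinearMap.snd R X' Y' ∘ₗ e.toLinearMap) fun x => by simp
  subsingleton M N hMN := hMN.2.subsingleton_iff hzz

theorem Corr.finite {M N : Type} [AddCommGroup M] [Module R M] [AddCommGroup N] [Module S N]
    (hφ : Function.Surjective φ) (hz : ∀ r, z * r = r * z) (hzz : z * z = 0)
    [hN : Module.Finite S N] (h : Corr φ z M N) : Module.Finite R M := by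
  have : RingHomSurjective φ := ⟨hφ⟩
  obtain ⟨π, hπ, hk⟩ := h
  obtain ⟨s, hs⟩ := hN.fg_top
  classical
  let t : Finset M := s.image (Function.surjInv hπ)
  have ht : (Submodule.span R (t : Set M)).map π = ⊤ := by
    rw [Submodule.map_span, ← hs]
    congr 1
    simp only [t, Finset.coe_image, ← Set.image_comp]
    convert Set.image_id _
    ext n
    exact Function.surjInv_eq hπ n
  refine ⟨t, ?_⟩
  rw [eq_top_iff]
  have key : ∀ m : M, ∃ w ∈ Submodule.span R (t : Set M), ∃ m', z • m' = m - w := fun m => by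
    have : π m ∈ (Submodule.span R (t : Set M)).map π := ht ▸ Submodule.mem_top
    obtain ⟨w, hw, hwm⟩ := this
    exact ⟨w, hw, hk _ (by rw [map_sub, hwm, sub_self])⟩
  intro m _
  obtain ⟨w, hw, m', hm'⟩ := key m
  obtain ⟨w', hw', m'', hm''⟩ := key m'
  have : m = w + z • w' := by
    have : z • m' = z • w' := by
      rw [← sub_eq_zero, ← smul_sub, ← hm'', ← mul_smul, hzz, zero_smul]
    rw [← this, hm']; abel
  rw [this]
  exact add_mem hw (Submodule.smul_mem _ _ hw')

theorem Corr.isSimpleModule_iff {M N : Type} [AddCommGroup M] [Module R M] [AddCommGroup N]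
    [Module S N] (hφ : Function.Surjective φ) (h : Corr φ 0 M N) :
    IsSimpleModule R M ↔ IsSimpleModule S N := by
  have : RingHomSurjective φ := ⟨hφ⟩
  obtain ⟨π, hπ, hk⟩ := h
  refine LinearMap.isSimpleModule_iff_of_bijective π ⟨?_, hπ⟩
  rw [injective_iff_map_eq_zero]
  intro a ha
  obtain ⟨b, rfl⟩ := hk a ha
  exact zero_smul R b

/-- Modules over the quotient ring versus modules killed by the kernel. -/
theorem countIs_iff (hφ : Function.Surjective φ) {P : ModuleCat.{0} R → Prop}
    {Q : ModuleCat.{0} S → Prop} (hP : ∀ X, P X → ∀ r, φ r = 0 → ∀ x : X, r • x = 0)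
    (hPQ : ∀ (X : ModuleCat.{0} R) (X' : ModuleCat.{0} S), Corr φ 0 X X' → (P X ↔ Q X')) (n : ℕ) :
    CountIs R P n ↔ CountIs S Q n := by
  have h₁ : ∀ X, P X → ∃ X', Q X' ∧ Corr φ 0 X X' := fun X hX => by
    obtain ⟨inst, hi⟩ := exists_descend (X := X) hφ (hP X hX)
    have hc : Corr φ 0 X (ModuleCat.of S X) :=
      ⟨{ toFun := fun x => x, map_add' := fun _ _ => rfl,
         map_smul' := fun r x => (hi r x).symm }, fun x => ⟨x, rfl⟩,
        fun m hm => ⟨0, by rw [zero_smul]; exact hm.symm⟩⟩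
    exact ⟨_, (hPQ _ _ hc).1 hX, hc⟩
  have h₂ : ∀ X', Q X' → ∃ X, P X ∧ Corr φ 0 X X' := fun X' hX' => by
    let : Module R X' := Module.compHom X' φ
    have hc : Corr φ 0 (ModuleCat.of R X') X' :=
      ⟨{ toFun := fun x => x, map_add' := fun _ _ => rfl,
         map_smul' := fun r x => rfl }, fun x => ⟨x, rfl⟩,
        fun m hm => ⟨0, by rw [zero_smul]; exact hm.symm⟩⟩
    exact ⟨_, (hPQ _ _ hc).2 hX', hc⟩
  refine ⟨CountIs.transfer _ (splitRel_zero hφ).equiv h₁ h₂,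
    CountIs.transfer _ (splitRel_zero hφ).flip.equiv h₂ h₁⟩

end Transfer

section SupportCharacterization

variable {k : Type} [Field k] {A : Type} [Ring A] [Algebra k A]

theorem IdemQuot.mk_surjective (e : A) : Function.Surjective (IdemQuot.mk A e) :=
  RingCon.mk'_surjective _

theorem IdemQuot.mk_eq_zero_iff (e r : A) :
    IdemQuot.mk A e r = 0 ↔ r ∈ TwoSidedIdeal.span {e} := by
  rw [TwoSidedIdeal.mem_iff, ← RingCon.eq]
  rfl

theorem op_smul_eq_zero_of_mem_span {X : Type} [AddCommGroup X] [Module Aᵐᵒᵖ X] {e : A}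
    (h : ∀ x : X, op e • x = 0) {r : A} (hr : r ∈ TwoSidedIdeal.span {e}) (x : X) :
    op r • x = 0 := by
  let I : TwoSidedIdeal A := TwoSidedIdeal.mk' {r | ∀ x : X, op r • x = 0} (by simp)
    (fun {a b} ha hb x => by rw [MulOpposite.op_add, add_smul, ha, hb, add_zero])
    (fun {a} ha x => by rw [MulOpposite.op_neg, neg_smul, ha, neg_zero])
    (fun {a b} hb x => by rw [op_mul, mul_smul, hb])
    (fun {a b} ha x => by rw [op_mul, mul_smul, ha, smul_zero])
  have hle : TwoSidedIdeal.span {e} ≤ I := by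
    rw [TwoSidedIdeal.span_le]
    rintro _ rfl
    simpa [I, TwoSidedIdeal.mem_mk'] using h
  have := hle hr
  rw [TwoSidedIdeal.mem_mk'] at this
  exact this x

theorem IdemQuot.smul_eq_zero {e : A} {X : Type} [AddCommGroup X] [Module Aᵐᵒᵖ X]
    (h : ∀ x : X, op e • x = 0) (r : Aᵐᵒᵖ) (hr : RingHom.op (IdemQuot.mk A e) r = 0) (x : X) :
    r • x = 0 := by
  have h0 : IdemQuot.mk A e (unop r) = 0 := op_injective hr
  exact op_smul_eq_zero_of_mem_span h ((IdemQuot.mk_eq_zero_iff e _).1 h0) x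

theorem IdemQuot.op_mk_surjective (e : A) :
    Function.Surjective (RingHom.op (IdemQuot.mk A e)) := fun y => by
  obtain ⟨x, hx⟩ := IdemQuot.mk_surjective e (unop y)
  exact ⟨op x, unop_injective hx⟩

theorem IdemQuot.op_mk_self (e : A) : RingHom.op (IdemQuot.mk A e) (op e) = 0 := by
  have : IdemQuot.mk A e e = 0 :=
    (IdemQuot.mk_eq_zero_iff e e).2 (TwoSidedIdeal.subset_span rfl)
  exact unop_injective this

instance IdemQuot.finite [Module.Finite k A] (e : A) : Module.Finite k (IdemQuot A e) :=
  Module.Finite.of_surjective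
    ({ toFun := IdemQuot.mk A e, map_add' := map_add _,
       map_smul' := fun c a => by
        rw [Algebra.smul_def, map_mul, RingHom.id_apply, Algebra.smul_def]; rfl } :
      A →ₗ[k] IdemQuot A e) (IdemQuot.mk_surjective e)

theorem exists_corr_zero {R S : Type} [Ring R] [Ring S] {φ : R →+* S}
    (hφ : Function.Surjective φ) (X : Type) [AddCommGroup X] [Module R X]
    (h : ∀ r, φ r = 0 → ∀ x : X, r • x = 0) :
    ∃ X' : ModuleCat.{0} S, Corr φ 0 X X' := by
  obtain ⟨inst, hi⟩ := exists_descend (X := X) hφ h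
  have hc : Corr φ 0 X (ModuleCat.of S X) :=
      ⟨{ toFun := fun x => x, map_add' := fun _ _ => rfl,
         map_smul' := fun r x => (hi r x).symm }, fun x => ⟨x, rfl⟩,
        fun m hm => ⟨0, by rw [zero_smul]; exact hm.symm⟩⟩
  exact ⟨_, hc⟩

theorem Corr.smul_eq_zero {R S : Type} [Ring R] [Ring S] {φ : R →+* S} {M N : Type}
    [AddCommGroup M] [Module R M] [AddCommGroup N] [Module S N] (h : Corr φ 0 M N) {r : R}
    (hr : φ r = 0) (m : M) : r • m = 0 := by
  obtain ⟨π, hπ, hk⟩ := h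
  obtain ⟨m', hm'⟩ := hk (r • m) (by rw [map_smulₛₗ, hr, zero_smul])
  rw [← hm', zero_smul]

theorem isTauTiltingMod_iff [Module.Finite k A] (e : A) (he : IsIdempotentElem e)
    {M : ModuleCat.{0} Aᵐᵒᵖ} {N : ModuleCat.{0} (IdemQuot A e)ᵐᵒᵖ}
    (h : Corr (RingHom.op (IdemQuot.mk A e)) 0 M N) :
    IsTauTiltingMod k (IdemQuot A e) N ↔ Module.Finite Aᵐᵒᵖ M ∧ ExtRigid Aᵐᵒᵖ M ∧
      ∃ n, NumIndecSummandsIs A M n ∧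
        CountIs Aᵐᵒᵖ (fun X => IsSimpleModule Aᵐᵒᵖ X ∧ ∀ x : X, op e • x = 0) n := by
  have hφ := IdemQuot.op_mk_surjective e
  have hcount : ∀ n, CountIs Aᵐᵒᵖ (fun X => IsSimpleModule Aᵐᵒᵖ X ∧ ∀ x : X, op e • x = 0) n ↔
      RankK0Is (IdemQuot A e) n := fun n =>
    countIs_iff hφ (Q := fun X => IsSimpleModule (IdemQuot A e)ᵐᵒᵖ X)
      (fun X hX r hr x => IdemQuot.smul_eq_zero hX.2 r hr x)
      (fun X X' hXX => by
        rw [hXX.isSimpleModule_iff hφ, and_iff_left]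
        exact fun x => hXX.smul_eq_zero (IdemQuot.op_mk_self e) x) n
  have hnum : ∀ n, NumIndecSummandsIs A M n ↔ NumIndecSummandsIs (IdemQuot A e) N n := fun n =>
    ⟨(splitRel_zero hφ).numIndecSummandsIs h,
      (splitRel_zero hφ).flip.numIndecSummandsIs
        (T := fun N M => Corr (RingHom.op (IdemQuot.mk A e)) 0 M N) h⟩
  constructor
  · rintro ⟨hf, hr, n, hn, hn'⟩
    refine ⟨h.finite hφ (by simp) (by simp), ?_, n, (hnum n).2 hn, (hcount n).2 hn'⟩
    refine ExtRigid.of_idempotent hφ (op e) ?_ (IdemQuot.op_mk_self e) ?_ h hr.extRigid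
    · rw [← op_mul, he.eq]
    · intro X _ _ hX r hr x
      exact IdemQuot.smul_eq_zero hX r hr x
  · rintro ⟨hf, hr, n, hn, hn'⟩
    have hfN : Module.Finite (IdemQuot A e)ᵐᵒᵖ N := by
      have : RingHomSurjective (RingHom.op (IdemQuot.mk A e)) := ⟨hφ⟩
      obtain ⟨π, hπ, -⟩ := h
      exact Module.Finite.of_surjective π hπ
    exact ⟨hfN, IsTauRigid.of_extRigid (hr.reduction hφ (map_zero _) h), n, (hnum n).1 hn,
      (hcount n).1 hn'⟩

/-- Support τ-tilting modules described over the algebra itself. -/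
theorem isSupportTauTilting_iff [Module.Finite k A] (M : ModuleCat.{0} Aᵐᵒᵖ) :
    IsSupportTauTilting k A M ↔ ∃ e : A, IsIdempotentElem e ∧ (∀ m : M, op e • m = 0) ∧
      Module.Finite Aᵐᵒᵖ M ∧ ExtRigid Aᵐᵒᵖ M ∧ ∃ n, NumIndecSummandsIs A M n ∧
        CountIs Aᵐᵒᵖ (fun X => IsSimpleModule Aᵐᵒᵖ X ∧ ∀ x : X, op e • x = 0) n := by
  constructor
  · rintro ⟨e, he, N, hN, θ⟩
    have hc : Corr (RingHom.op (IdemQuot.mk A e)) 0 M N := by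
      let : Module Aᵐᵒᵖ N := Module.compHom N (RingHom.op (IdemQuot.mk A e))
      obtain ⟨θ⟩ := θ
      exact ⟨{ toFun := θ, map_add' := map_add θ, map_smul' := fun r x => map_smul θ r x },
        θ.surjective, fun m hm => ⟨0, by rw [zero_smul]; exact (θ.map_eq_zero_iff.1 hm).symm⟩⟩
    exact ⟨e, he, fun m => hc.smul_eq_zero (IdemQuot.op_mk_self e) m,
      (isTauTiltingMod_iff e he hc).1 hN⟩
  · rintro ⟨e, he, hM, h⟩
    obtain ⟨N, hN⟩ := exists_corr_zero (IdemQuot.op_mk_surjective e) M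
      (fun r hr x => IdemQuot.smul_eq_zero hM r hr x)
    refine ⟨e, he, N, (isTauTiltingMod_iff e he hN).2 h, ?_⟩
    obtain ⟨π, hπ, hk⟩ := hN
    let : Module Aᵐᵒᵖ N := Module.compHom N (RingHom.op (IdemQuot.mk A e))
    refine ⟨LinearEquiv.ofBijective
      ({ toFun := π, map_add' := map_add π, map_smul' := fun r x => map_smulₛₗ π r x } :
        M →ₗ[Aᵐᵒᵖ] N) ⟨?_, hπ⟩⟩
    rw [injective_iff_map_eq_zero]
    intro a ha
    obtain ⟨b, rfl⟩ := hk a ha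
    exact zero_smul _ b

end SupportCharacterization

section CentralReduction

/-- `φ` is the quotient map by the ideal generated by the central square-zero element `z`. -/
structure CentralReduction {R S : Type} [Ring R] [Ring S] (φ : R →+* S) (z : R) : Prop where
  surjective : Function.Surjective φ
  comm : ∀ r, z * r = r * z
  sq : z * z = 0
  map_eq_zero : φ z = 0
  ker : ∀ r, φ r = 0 → ∃ c, r = z * c

theorem CentralReduction.op {R S : Type} [Ring R] [Ring S] {φ : R →+* S} {z : R}
    (h : CentralReduction φ z) : CentralReduction (RingHom.op φ) (op z) where
  surjective y := by
    obtain ⟨x, hx⟩ := h.surjective (unop y)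
    exact ⟨MulOpposite.op x, unop_injective hx⟩
  comm r := unop_injective (h.comm (unop r)).symm
  sq := unop_injective h.sq
  map_eq_zero := unop_injective h.map_eq_zero
  ker r hr := by
    obtain ⟨c, hc⟩ := h.ker (unop r) (op_injective hr)
    exact ⟨MulOpposite.op c, unop_injective (by rw [hc, h.comm]; rfl)⟩

theorem IsSimpleModule.smul_eq_zero_of_sq {R X : Type} [Ring R] [AddCommGroup X] [Module R X]
    [IsSimpleModule R X] {z : R} (hz : ∀ r, z * r = r * z) (hzz : z * z = 0) (x : X) :
    z • x = 0 := by
  let f : X →ₗ[R] X :=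
    { toFun := fun m => z • m
      map_add' := smul_add z
      map_smul' := fun r m => by rw [← mul_smul, hz, mul_smul]; rfl }
  rcases LinearMap.bijective_or_eq_zero f with h | h
  · have : f (f x) = f 0 := by
      rw [map_zero]
      change z • z • x = 0
      rw [← mul_smul, hzz, zero_smul]
    exact h.1 this
  · exact congrArg (fun g : X →ₗ[R] X => g x) h

variable {k : Type} [Field k] {A C : Type} [Ring A] [Algebra k A] [Ring C] [Algebra k C]
  [Module.Finite k A] [Module.Finite k C] {φ : A →+* C} {z : A}

theorem CentralReduction.countIs_iff (h : CentralReduction φ z) (e : A) (n : ℕ) :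
    CountIs Aᵐᵒᵖ (fun X => IsSimpleModule Aᵐᵒᵖ X ∧ ∀ x : X, MulOpposite.op e • x = 0) n ↔
    CountIs Cᵐᵒᵖ (fun X => IsSimpleModule Cᵐᵒᵖ X ∧ ∀ x : X, MulOpposite.op (φ e) • x = 0) n := by
  refine _root_.countIs_iff h.op.surjective (fun X hX r hr x => ?_) (fun X X' hXX => ?_) n
  · obtain ⟨c, rfl⟩ := h.op.ker r hr
    have := hX.1
    rw [mul_smul]
    exact IsSimpleModule.smul_eq_zero_of_sq h.op.comm h.op.sq _
  · rw [hXX.isSimpleModule_iff h.op.surjective]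
    refine and_congr_right fun _ => ?_
    obtain ⟨π, hπ, hk⟩ := hXX
    constructor
    · intro H x
      obtain ⟨y, rfl⟩ := hπ x
      have := map_smulₛₗ π (MulOpposite.op e) y
      rw [H, map_zero] at this
      exact this.symm
    · intro H x
      obtain ⟨y, hy⟩ := hk (MulOpposite.op e • x) (by rw [map_smulₛₗ]; exact H _)
      rw [← hy, zero_smul]

/-- Basic support τ-tilting modules. -/
def IsBasicSTT (k : Type) [Field k] (B : Type) [Ring B] [Algebra k B]
    (M : ModuleCat.{0} Bᵐᵒᵖ) : Prop :=
  IsSupportTauTilting k B M ∧ IsBasicMod B M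

theorem IsBasicSTT.finite {M : ModuleCat.{0} Aᵐᵒᵖ} (hM : IsBasicSTT k A M) :
    Module.Finite Aᵐᵒᵖ M := by
  obtain ⟨e, -, -, hf, -⟩ := (isSupportTauTilting_iff M).1 hM.1
  exact hf

theorem IsBasicSTT.extRigid {M : ModuleCat.{0} Aᵐᵒᵖ} (hM : IsBasicSTT k A M) :
    ExtRigid Aᵐᵒᵖ M := by
  obtain ⟨e, -, -, -, hr, -⟩ := (isSupportTauTilting_iff M).1 hM.1
  exact hr

theorem IsBasicSTT.reduction (h : CentralReduction φ z) {M : ModuleCat.{0} Aᵐᵒᵖ}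
    {N : ModuleCat.{0} Cᵐᵒᵖ} (hMN : Corr (RingHom.op φ) (op z) M N) (hM : IsBasicSTT k A M) :
    IsBasicSTT k C N := by
  obtain ⟨e, he, hMe, hf, hr, n, hn, hn'⟩ := (isSupportTauTilting_iff M).1 hM.1
  have hS := splitRel_extRigid h.op.surjective h.op.comm h.op.sq h.op.map_eq_zero
  refine ⟨(isSupportTauTilting_iff N).2 ⟨φ e, he.map φ, ?_, ?_, ?_, n,
    hS.numIndecSummandsIs ⟨hr, hMN⟩ hn, (h.countIs_iff e n).1 hn'⟩, hS.isBasicMod ⟨hr, hMN⟩ hM.2⟩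
  · intro x
    obtain ⟨π, hπ, -⟩ := hMN
    obtain ⟨y, rfl⟩ := hπ x
    have := map_smulₛₗ π (MulOpposite.op e) y
    rw [hMe, map_zero] at this
    exact this.symm
  · have : RingHomSurjective (RingHom.op φ) := ⟨h.op.surjective⟩
    obtain ⟨π, hπ, -⟩ := hMN
    exact Module.Finite.of_surjective π hπ
  · exact hr.reduction h.op.surjective h.op.map_eq_zero hMN

theorem IsBasicSTT.exists_reduction (h : CentralReduction φ z) {M : ModuleCat.{0} Aᵐᵒᵖ}
    (hM : IsBasicSTT k A M) :
    ∃ N : ModuleCat.{0} Cᵐᵒᵖ, Corr (RingHom.op φ) (op z) M N ∧ IsBasicSTT k C N := by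
  obtain ⟨N, _, _, hN⟩ := _root_.exists_reduction h.op.surjective h.op.comm h.op.ker M
  have hN' : Corr (RingHom.op φ) (MulOpposite.op z) M (ModuleCat.of Cᵐᵒᵖ N) := hN
  exact ⟨_, hN', hM.reduction h hN'⟩

theorem CentralReduction.exists_idempotent (h : CentralReduction φ z) {f : C}
    (hf : IsIdempotentElem f) : ∃ e : A, IsIdempotentElem e ∧ φ e = f := by
  have hnil : ∀ x ∈ RingHom.ker φ, IsNilpotent x := fun x hx => by
    obtain ⟨c, rfl⟩ := h.ker x hx
    refine ⟨2, ?_⟩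
    rw [pow_two, mul_assoc, ← mul_assoc c, ← h.comm c, ← mul_assoc, ← mul_assoc, h.sq, zero_mul,
      zero_mul]
  exact exists_isIdempotentElem_eq_of_ker_isNilpotent φ hnil f
    (h.surjective f) hf

theorem IsBasicSTT.exists_lift (h : CentralReduction φ z) {N : ModuleCat.{0} Cᵐᵒᵖ}
    (hN : IsBasicSTT k C N) :
    ∃ M : ModuleCat.{0} Aᵐᵒᵖ, Corr (RingHom.op φ) (op z) M N ∧ IsBasicSTT k A M := by
  have : IsArtinianRing Cᵐᵒᵖ := IsArtinianRing.of_finite k _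
  have : IsNoetherianRing Cᵐᵒᵖ := IsNoetherianRing.of_finite k _
  obtain ⟨f, hf, hNf, hfin, hr, n, hn, hn'⟩ := (isSupportTauTilting_iff N).1 hN.1
  obtain ⟨M, _, _, hMfin, hMr, hMN⟩ := hr.exists_lift h.op.surjective h.op.comm h.op.sq
    h.op.map_eq_zero h.op.ker N
  have hMN' : Corr (RingHom.op φ) (MulOpposite.op z) (ModuleCat.of Aᵐᵒᵖ M) N := hMN
  have hS := (splitRel_extRigid h.op.surjective h.op.comm h.op.sq h.op.map_eq_zero).flip
  obtain ⟨e, he, rfl⟩ := h.exists_idempotent hf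
  refine ⟨ModuleCat.of Aᵐᵒᵖ M, hMN', (isSupportTauTilting_iff _).2 ⟨e, he, ?_, hMfin, hMr, n,
    hS.numIndecSummandsIs (T := fun N M => ExtRigid Aᵐᵒᵖ M ∧ Corr (RingHom.op φ)
      (MulOpposite.op z) M N) ⟨hMr, hMN'⟩ hn, (h.countIs_iff e n).2 hn'⟩,
    hS.isBasicMod (T := fun N M => ExtRigid Aᵐᵒᵖ M ∧ Corr (RingHom.op φ)
      (MulOpposite.op z) M N) ⟨hMr, hMN'⟩ hN.2⟩
  obtain ⟨π, hπ, hk⟩ := hMN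
  have key : ∀ m : M, ∃ m', MulOpposite.op z • m' = MulOpposite.op e • m := fun m =>
    hk _ (by rw [map_smulₛₗ]; exact hNf _)
  intro m
  change MulOpposite.op e • (m : M) = 0
  obtain ⟨m', hm'⟩ := key m
  obtain ⟨m'', hm''⟩ := key m'
  have hee : MulOpposite.op e * MulOpposite.op e = MulOpposite.op e := by
    rw [← op_mul, he.eq]
  rw [← hee, mul_smul, ← hm', ← mul_smul, ← h.op.comm, mul_smul, ← hm'', ← mul_smul, h.op.sq,
    zero_smul]

theorem facLE_iff_isFac {B : Type} [Ring B] (M N : ModuleCat.{0} Bᵐᵒᵖ) :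
    FacLE B M N ↔ IsFac Bᵐᵒᵖ N M := by
  constructor
  · intro h
    exact h M ⟨1, LinearMap.proj 0, fun m => ⟨fun _ => m, rfl⟩⟩
  · intro h X hX
    exact h.trans hX

theorem IsBasicSTT.facLE_iff (h : CentralReduction φ z) {M M' : ModuleCat.{0} Aᵐᵒᵖ}
    {N N' : ModuleCat.{0} Cᵐᵒᵖ} (hM' : IsBasicSTT k A M')
    (hMN : Corr (RingHom.op φ) (op z) M N) (hMN' : Corr (RingHom.op φ) (op z) M' N') :
    FacLE A M M' ↔ FacLE C N N' := by
  rw [facLE_iff_isFac, facLE_iff_isFac]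
  exact ⟨hMN'.isFac h.op.surjective h.op.map_eq_zero hMN,
    Corr.isFac_of_reduction h.op.comm h.op.sq h.op.map_eq_zero hM'.extRigid hMN' hMN⟩

theorem IsBasicSTT.equiv_iff (h : CentralReduction φ z) {M M' : ModuleCat.{0} Aᵐᵒᵖ}
    {N N' : ModuleCat.{0} Cᵐᵒᵖ} (hM : IsBasicSTT k A M) (hM' : IsBasicSTT k A M')
    (hMN : Corr (RingHom.op φ) (op z) M N) (hMN' : Corr (RingHom.op φ) (op z) M' N') :
    Nonempty (M ≃ₗ[Aᵐᵒᵖ] M') ↔ Nonempty (N ≃ₗ[Cᵐᵒᵖ] N') :=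
  (splitRel_extRigid h.op.surjective h.op.comm h.op.sq h.op.map_eq_zero).equiv _ _ _ _
    ⟨hM.extRigid, hMN⟩ ⟨hM'.extRigid, hMN'⟩

theorem TauTiltingFinite.of_reduction (h : CentralReduction φ z) (hC : TauTiltingFinite k C) :
    TauTiltingFinite k A := by
  classical
  obtain ⟨n, R, hR⟩ := hC
  let L : Fin n → ModuleCat.{0} Aᵐᵒᵖ := fun i =>
    if hi : ∃ M, IsBasicSTT k A M ∧ Corr (RingHom.op φ) (MulOpposite.op z) M (R i) then hi.choose
    else ModuleCat.of Aᵐᵒᵖ PUnit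
  refine ⟨n, L, fun M hM hM' => ?_⟩
  have hMb : IsBasicSTT k A M := ⟨hM, hM'⟩
  obtain ⟨N, hMN, hN⟩ := hMb.exists_reduction h
  obtain ⟨i, ⟨θ⟩⟩ := hR N hN.1 hN.2
  have hi : ∃ M, IsBasicSTT k A M ∧ Corr (RingHom.op φ) (MulOpposite.op z) M (R i) :=
    ⟨M, hMb, hMN.congr (LinearEquiv.refl _ _) θ⟩
  have hL : L i = hi.choose := dif_pos hi
  refine ⟨i, ?_⟩
  rw [hL]
  exact (hMb.equiv_iff h hi.choose_spec.1 hMN hi.choose_spec.2).2 ⟨θ⟩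

/-- Two algebras with a common central reduction have isomorphic posets of basic support
τ-tilting modules. -/
theorem exists_isBasicSTT_correspondence {A' : Type} [Ring A'] [Algebra k A']
    [Module.Finite k A'] {φ' : A' →+* C} {z' : A'} (h : CentralReduction φ z)
    (h' : CentralReduction φ' z') :
    ∃ R : ModuleCat.{0} Aᵐᵒᵖ → ModuleCat.{0} A'ᵐᵒᵖ → Prop,
      (∀ M N, R M N → IsBasicSTT k A M ∧ IsBasicSTT k A' N) ∧
      (∀ M, IsBasicSTT k A M → ∃ N, R M N) ∧ (∀ N, IsBasicSTT k A' N → ∃ M, R M N) ∧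
      (∀ M M' N N', R M N → R M' N' →
        ((Nonempty (M ≃ₗ[Aᵐᵒᵖ] M') ↔ Nonempty (N ≃ₗ[A'ᵐᵒᵖ] N')) ∧
         (FacLE A M M' ↔ FacLE A' N N'))) := by
  refine ⟨fun M N => IsBasicSTT k A M ∧ IsBasicSTT k A' N ∧ ∃ L : ModuleCat.{0} Cᵐᵒᵖ,
    Corr (RingHom.op φ) (MulOpposite.op z) M L ∧ Corr (RingHom.op φ') (MulOpposite.op z') N L,
    fun M N hR => ⟨hR.1, hR.2.1⟩, fun M hM => ?_, fun N hN => ?_, ?_⟩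
  · obtain ⟨L, hML, hL⟩ := hM.exists_reduction h
    obtain ⟨N, hNL, hN⟩ := hL.exists_lift h'
    exact ⟨N, hM, hN, L, hML, hNL⟩
  · obtain ⟨L, hNL, hL⟩ := hN.exists_reduction h'
    obtain ⟨M, hML, hM⟩ := hL.exists_lift h
    exact ⟨M, hM, hN, L, hML, hNL⟩
  · rintro M M' N N' ⟨hM, hN, L, hML, hNL⟩ ⟨hM', hN', L', hML', hNL'⟩
    exact ⟨(hM.equiv_iff h hM' hML hML').trans (hN.equiv_iff h' hN' hNL hNL').symm,
      (hM'.facLE_iff h hML hML').trans (hN'.facLE_iff h' hNL hNL').symm⟩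

end CentralReduction

section FiniteSummands

variable {R : Type} [Ring R] {D : Type} (F : D → ModuleCat.{0} R)

/-- The direct sum of the modules indexed by a list. -/
def listSum : List D → ModuleCat.{0} R
  | [] => ModuleCat.of R PUnit
  | d :: l => ModuleCat.of R (F d × listSum l)

/-- Swapping the first two factors of a triple product. -/
def prodLeftComm (X Y Z : Type) [AddCommGroup X] [AddCommGroup Y] [AddCommGroup Z] [Module R X]
    [Module R Y] [Module R Z] : (X × Y × Z) ≃ₗ[R] (Y × X × Z) :=
  (LinearEquiv.prodAssoc R X Y Z).symm.trans
    (((LinearEquiv.prodComm R X Y).prodCongr (LinearEquiv.refl R Z)).trans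
      (LinearEquiv.prodAssoc R Y X Z))

theorem exists_listSum_equiv_of_mem {d : D} {l : List D} (h : d ∈ l) :
    ∃ K : ModuleCat.{0} R, Nonempty (listSum F l ≃ₗ[R] (F d × K)) := by
  induction l with
  | nil => simp at h
  | cons c l ih =>
    rcases List.mem_cons.1 h with rfl | h
    · exact ⟨listSum F l, ⟨LinearEquiv.refl R (F d × listSum F l)⟩⟩
    · obtain ⟨K, ⟨θ⟩⟩ := ih h
      have e₁ : (F c × listSum F l) ≃ₗ[R] (F c × (F d × K)) :=
        (LinearEquiv.refl R (F c)).prodCongr θ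
      exact ⟨ModuleCat.of R (F c × K), ⟨e₁.trans (prodLeftComm (F c) (F d) K)⟩⟩

variable {B : Type} [Ring B]

theorem IsBasicMod.of_prod {M X Y : ModuleCat.{0} Bᵐᵒᵖ} (hM : IsBasicMod B M)
    (θ : M ≃ₗ[Bᵐᵒᵖ] (X × Y)) : IsBasicMod B Y := by
  rintro L K ⟨e⟩
  have e₁ : (X × Y) ≃ₗ[Bᵐᵒᵖ] (X × (L × (L × K))) := (LinearEquiv.refl Bᵐᵒᵖ X).prodCongr e
  have e₂ : (L × (X × (L × K))) ≃ₗ[Bᵐᵒᵖ] (L × (L × (X × K))) :=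
    (LinearEquiv.refl Bᵐᵒᵖ L).prodCongr (prodLeftComm X L K)
  exact hM L (ModuleCat.of Bᵐᵒᵖ (X × K))
    ⟨((θ.trans e₁).trans (prodLeftComm X L (L × K))).trans e₂⟩

theorem exists_nodup_listSum_equiv [IsArtinianRing Bᵐᵒᵖ] [IsNoetherianRing Bᵐᵒᵖ]
    (F : D → ModuleCat.{0} Bᵐᵒᵖ)
    (hF : ∀ M : ModuleCat.{0} Bᵐᵒᵖ, Module.Finite Bᵐᵒᵖ M → Nontrivial M →
      ∃ d, Nontrivial (F d) ∧ ∃ L : ModuleCat.{0} Bᵐᵒᵖ, Nonempty (M ≃ₗ[Bᵐᵒᵖ] (F d × L)))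
    (N : ℕ) : ∀ M : ModuleCat.{0} Bᵐᵒᵖ, Module.Finite Bᵐᵒᵖ M → IsBasicMod B M →
      Module.length Bᵐᵒᵖ M ≤ N → ∃ l : List D, l.Nodup ∧ Nonempty (M ≃ₗ[Bᵐᵒᵖ] listSum F l) := by
  induction N with
  | zero =>
    intro M _ _ h
    have : Subsingleton M := Module.length_eq_zero_iff.1 (by simpa using h)
    exact ⟨[], List.nodup_nil, ⟨LinearEquiv.ofSubsingleton M PUnit⟩⟩
  | succ N ih =>
    intro M hfin hM h
    rcases subsingleton_or_nontrivial M with hs | hs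
    · exact ⟨[], List.nodup_nil, ⟨LinearEquiv.ofSubsingleton M PUnit⟩⟩
    obtain ⟨d, hd, L, ⟨θ⟩⟩ := hF M hfin hs
    have hL : Module.Finite Bᵐᵒᵖ L := Module.Finite.of_surjective
      (LinearMap.snd Bᵐᵒᵖ (F d) L ∘ₗ θ.toLinearMap)
      (Prod.snd_surjective.comp θ.surjective)
    have hlen : Module.length Bᵐᵒᵖ L ≤ N := by
      rw [θ.length_eq, Module.length_prod] at h
      have h1 : 1 ≤ Module.length Bᵐᵒᵖ (F d) := Order.one_le_iff_pos.2 Module.length_pos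
      have h2 : 1 + Module.length Bᵐᵒᵖ L ≤ 1 + (N : ℕ∞) := by
        refine (add_le_add_left h1 _).trans (h.trans ?_)
        push_cast
        rw [add_comm]
      exact (ENat.add_le_add_iff_left (by simp)).1 h2
    obtain ⟨l, hl, ⟨e⟩⟩ := ih L hL (hM.of_prod θ) hlen
    refine ⟨d :: l, List.nodup_cons.2 ⟨fun hdl => ?_, hl⟩,
      ⟨θ.trans ((LinearEquiv.refl Bᵐᵒᵖ (F d)).prodCongr e)⟩⟩
    obtain ⟨K, ⟨e'⟩⟩ := exists_listSum_equiv_of_mem F hdl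
    have := hM (F d) K ⟨θ.trans ((LinearEquiv.refl Bᵐᵒᵖ (F d)).prodCongr (e.trans e'))⟩
    exact not_subsingleton_iff_nontrivial.2 hd this

theorem tauTiltingFinite_of_summands {k : Type} [Field k] [Algebra k B] [Module.Finite k B]
    [Finite D] (F : D → ModuleCat.{0} Bᵐᵒᵖ)
    (hF : ∀ M : ModuleCat.{0} Bᵐᵒᵖ, Module.Finite Bᵐᵒᵖ M → Nontrivial M →
      ∃ d, Nontrivial (F d) ∧ ∃ L : ModuleCat.{0} Bᵐᵒᵖ, Nonempty (M ≃ₗ[Bᵐᵒᵖ] (F d × L))) :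
    TauTiltingFinite k B := by
  classical
  have : IsArtinianRing Bᵐᵒᵖ := IsArtinianRing.of_finite k _
  have : IsNoetherianRing Bᵐᵒᵖ := IsNoetherianRing.of_finite k _
  have := Fintype.ofFinite D
  let e := Fintype.equivFin {l : List D // l.Nodup}
  refine ⟨_, fun i => listSum F (e.symm i).1, fun M hM hM' => ?_⟩
  have hfin : Module.Finite Bᵐᵒᵖ M := IsBasicSTT.finite (k := k) ⟨hM, hM'⟩
  obtain ⟨N, hN⟩ := ENat.ne_top_iff_exists.1 (Module.length_ne_top (R := Bᵐᵒᵖ) (M := M))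
  obtain ⟨l, hl, hθ⟩ := exists_nodup_listSum_equiv F hF N M hfin hM' hN.ge
  exact ⟨e ⟨l, hl⟩, by beta_reduce; rwa [Equiv.symm_apply_apply]⟩

end FiniteSummands

section Monomial

/-- The combinatorial structure of a module with a basis permuted (up to zero) by generators
indexed by `G`. -/
def MonomialData (G : Type) (n : ℕ) : Type := Σ d : Fin (n + 1), G → Fin d → Option (Fin d)

instance (G : Type) [Finite G] (n : ℕ) : Finite (MonomialData G n) :=
  inferInstanceAs (Finite (Σ d : Fin (n + 1), G → Fin d → Option (Fin d)))

variable {k : Type} [Field k] {B : Type} [Ring B] [Algebra k B] {G : Type} {n : ℕ}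

/-- The module `X` has a basis on which the generators `g` act as prescribed by `x`. -/
def IsMonomial (k : Type) [Field k] {B : Type} [Ring B] [Algebra k B] {G : Type} {n : ℕ}
    (g : G → B) (x : MonomialData G n) (X : ModuleCat.{0} Bᵐᵒᵖ) : Prop :=
  ∃ (_ : Module k X) (_ : IsScalarTower k Bᵐᵒᵖ X) (v : Module.Basis (Fin x.1) k X),
    ∀ γ i, op (g γ) • v i = (x.2 γ i).elim 0 v

theorem map_op_smul_of_adjoin_eq_top {g : G → B} (hg : Algebra.adjoin k (Set.range g) = ⊤)
    {X Y : Type} [AddCommGroup X] [AddCommGroup Y] [Module k X] [Module k Y] [Module Bᵐᵒᵖ X]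
    [Module Bᵐᵒᵖ Y] [IsScalarTower k Bᵐᵒᵖ X] [IsScalarTower k Bᵐᵒᵖ Y] (f : X →ₗ[k] Y)
    (hf : ∀ γ x, f (op (g γ) • x) = op (g γ) • f x) (b : B) (x : X) :
    f (op b • x) = op b • f x := by
  have hb : b ∈ Algebra.adjoin k (Set.range g) := hg ▸ Algebra.mem_top
  induction hb using Algebra.adjoin_induction generalizing x with
  | mem b hb => obtain ⟨γ, rfl⟩ := hb; exact hf γ x
  | algebraMap c =>
    have h : op (algebraMap k B c) = c • (1 : Bᵐᵒᵖ) := by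
      rw [← Algebra.algebraMap_eq_smul_one]; rfl
    rw [h, smul_assoc, smul_assoc, one_smul, one_smul, map_smul]
  | add b c _ _ hb hc => simp only [MulOpposite.op_add, add_smul, map_add, hb, hc]
  | mul b c _ _ hb hc => simp only [MulOpposite.op_mul, mul_smul, hb, hc]

theorem IsMonomial.equiv {g : G → B} (hg : Algebra.adjoin k (Set.range g) = ⊤)
    {s : MonomialData G n} {X Y : ModuleCat.{0} Bᵐᵒᵖ} (hX : IsMonomial k g s X)
    (hY : IsMonomial k g s Y) : Nonempty (X ≃ₗ[Bᵐᵒᵖ] Y) := by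
  obtain ⟨_, _, v, hv⟩ := hX
  obtain ⟨_, _, w, hw⟩ := hY
  let φ : X ≃ₗ[k] Y := v.equiv w (Equiv.refl _)
  have hφ : ∀ i, φ (v i) = w i := fun i => by simp [φ]
  have key : ∀ γ x, φ (op (g γ) • x) = op (g γ) • φ x := by
    intro γ x
    have : φ.toLinearMap ∘ₗ Algebra.lsmul k k X (op (g γ)) =
        Algebra.lsmul k k Y (op (g γ)) ∘ₗ φ.toLinearMap := by
      refine v.ext fun i => ?_
      simp only [LinearMap.comp_apply, LinearEquiv.coe_coe, Algebra.lsmul_coe, hv, hφ, hw]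
      cases s.2 γ i with
      | none => exact map_zero φ
      | some j => exact hφ j
    exact LinearMap.congr_fun this x
  exact ⟨{ φ with
    map_smul' := fun b x => map_op_smul_of_adjoin_eq_top hg φ.toLinearMap key (unop b) x }⟩

/-- A module endomorphism that restricts injectively to the span of a family permuted (up to
zero) by the generators, and has image in that span, splits off a monomial summand. -/
theorem exists_isMonomial_summand {g : G → B} (hg : Algebra.adjoin k (Set.range g) = ⊤)
    (M : ModuleCat.{0} Bᵐᵒᵖ) [Module k M] [IsScalarTower k Bᵐᵒᵖ M]
    {ι : Type} [Fintype ι] (hι : Fintype.card ι ≤ n) [Nonempty ι] (v : ι → M) (r : M →ₗ[k] M)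
    (hr : ∀ γ x, r (op (g γ) • x) = op (g γ) • r x)
    (hspan : ∀ x, r x ∈ Submodule.span k (Set.range v)) (hli : LinearIndependent k fun i => r (v i))
    (hv : ∀ γ i, op (g γ) • v i = 0 ∨ ∃ j, op (g γ) • v i = v j) :
    ∃ (s : MonomialData G n) (X L : ModuleCat.{0} Bᵐᵒᵖ), IsMonomial k g s X ∧ Nontrivial X ∧
      Nonempty (M ≃ₗ[Bᵐᵒᵖ] (X × L)) := by
  classical
  let r' : M →ₗ[Bᵐᵒᵖ] M :=
    { toFun := r, map_add' := map_add r
      map_smul' := fun b x => map_op_smul_of_adjoin_eq_top hg r hr (unop b) x }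
  have hliv : LinearIndependent k v := LinearIndependent.of_comp r hli
  let S := Submodule.span k (Set.range v)
  have : FiniteDimensional k S := FiniteDimensional.span_of_finite k (Set.finite_range v)
  have hinj : ∀ x ∈ S, r x = 0 → x = 0 := by
    intro x hx h0
    obtain ⟨c, rfl⟩ := (Submodule.mem_span_range_iff_exists_fun k).1 hx
    simp only [map_sum, map_smul] at h0
    have := Fintype.linearIndependent_iff.1 hli c h0
    simp [this]
  let rS : S →ₗ[k] S := (r ∘ₗ S.subtype).codRestrict S fun x => hspan _
  have hrS : Function.Surjective rS := by
    rw [← LinearMap.injective_iff_surjective, injective_iff_map_eq_zero]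
    rintro ⟨x, hx⟩ h0
    exact Subtype.ext (hinj x hx (congrArg Subtype.val h0))
  have hsurj : ∀ y ∈ S, ∃ x ∈ S, r x = y := fun y hy => by
    obtain ⟨x, hx⟩ := hrS ⟨y, hy⟩
    exact ⟨x.1, x.2, congrArg Subtype.val hx⟩
  have hcompl : IsCompl (LinearMap.range r') (LinearMap.ker r') := by
    refine ⟨Submodule.disjoint_def.2 ?_, codisjoint_iff.2 (eq_top_iff.2 fun x _ => ?_)⟩
    · rintro _ ⟨x, rfl⟩ h0
      exact hinj _ (hspan x) h0
    · obtain ⟨y, hy, hyx⟩ := hsurj (r x) (hspan x)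
      obtain ⟨y', -, rfl⟩ := hsurj y hy
      refine Submodule.mem_sup.2 ⟨r y', ⟨y', rfl⟩, x - r y', ?_, by abel⟩
      change r (x - r y') = 0
      rw [map_sub, hyx, sub_self]
  have hvS : ∀ i, v i ∈ S := fun i => Submodule.subset_span ⟨i, rfl⟩
  have hvr : ∀ i, v i ∈ LinearMap.range r' := fun i => by
    obtain ⟨x, -, hx⟩ := hsurj _ (hvS i)
    exact ⟨x, hx⟩
  let X : ModuleCat.{0} Bᵐᵒᵖ := ModuleCat.of Bᵐᵒᵖ (LinearMap.range r')
  let e := Fintype.equivFin ι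
  let : Module k X := inferInstanceAs (Module k (LinearMap.range r'))
  have : IsScalarTower k Bᵐᵒᵖ X := inferInstanceAs (IsScalarTower k Bᵐᵒᵖ (LinearMap.range r'))
  let inc : X →ₗ[k] M := ((LinearMap.range r').subtype.restrictScalars k)
  have hinc : Function.Injective inc := Subtype.val_injective
  let w : Fin (Fintype.card ι) → X := fun i => ⟨v (e.symm i), hvr _⟩
  have hw : ∀ i, inc (w i) = v (e.symm i) := fun i => rfl
  have hwli : LinearIndependent k w := by
    refine LinearIndependent.of_comp inc ?_
    exact hliv.comp e.symm e.symm.injective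
  have hwspan : ⊤ ≤ Submodule.span k (Set.range w) := by
    rintro ⟨x, hx⟩ -
    have hxS : x ∈ S := by
      obtain ⟨y, rfl⟩ := hx
      exact hspan y
    obtain ⟨c, hc⟩ := (Submodule.mem_span_range_iff_exists_fun k).1 hxS
    refine (Submodule.mem_span_range_iff_exists_fun k).2 ⟨fun i => c (e.symm i), hinc ?_⟩
    rw [map_sum]
    simp only [map_smul, hw]
    rw [e.symm.sum_comp fun i => c i • v i, hc]
    rfl
  let D : MonomialData G n := ⟨⟨Fintype.card ι, by omega⟩, fun γ i =>
    if h : ∃ j, op (g γ) • v (e.symm i) = v j then some (e h.choose) else none⟩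
  refine ⟨D, X, ModuleCat.of Bᵐᵒᵖ (LinearMap.ker r'), ⟨inferInstance, inferInstance,
    Module.Basis.mk hwli hwspan, fun γ i => ?_⟩, ?_,
    ⟨(Submodule.prodEquivOfIsCompl _ _ hcompl).symm⟩⟩
  · simp only [Module.Basis.mk_apply]
    apply hinc
    have h1 : inc (op (g γ) • w i) = op (g γ) • v (e.symm i) := rfl
    rw [h1]
    simp only [D]
    by_cases h : ∃ j, op (g γ) • v (e.symm i) = v j
    · rw [dif_pos h]
      have h2 := h.choose_spec
      simp only [Option.elim]
      rw [Module.Basis.mk_apply, hw, Equiv.symm_apply_apply]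
      exact h2
    · rw [dif_neg h]
      simpa [Option.elim] using (hv γ (e.symm i)).resolve_right h
  · obtain ⟨i⟩ := ‹Nonempty ι›
    exact ⟨w (e i), 0, hwli.ne_zero _⟩

theorem tauTiltingFinite_of_monomial [Finite G] [Module.Finite k B] {g : G → B}
    (hg : Algebra.adjoin k (Set.range g) = ⊤)
    (h : ∀ M : ModuleCat.{0} Bᵐᵒᵖ, Module.Finite Bᵐᵒᵖ M → Nontrivial M →
      ∃ (s : MonomialData G n) (X L : ModuleCat.{0} Bᵐᵒᵖ), IsMonomial k g s X ∧ Nontrivial X ∧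
        Nonempty (M ≃ₗ[Bᵐᵒᵖ] (X × L))) : TauTiltingFinite k B := by
  classical
  let F : MonomialData G n → ModuleCat.{0} Bᵐᵒᵖ := fun s =>
    if hs : ∃ X, IsMonomial k g s X then hs.choose else ModuleCat.of Bᵐᵒᵖ PUnit
  refine tauTiltingFinite_of_summands F fun M hM hM' => ?_
  obtain ⟨s, X, L, hX, hX', ⟨θ⟩⟩ := h M hM hM'
  have hs : ∃ X, IsMonomial k g s X := ⟨X, hX⟩
  have hF : F s = hs.choose := dif_pos hs
  obtain ⟨e⟩ : Nonempty (X ≃ₗ[Bᵐᵒᵖ] F s) := by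
    rw [hF]
    exact hX.equiv hg hs.choose_spec
  exact ⟨s, e.symm.toEquiv.nontrivial, L,
    ⟨θ.trans (e.prodCongr (LinearEquiv.refl Bᵐᵒᵖ L))⟩⟩

end Monomial

section ChainMap

variable {k V : Type} [Field k] [AddCommGroup V] [Module k V]

/-- The endomorphism `w ↦ ∑ t < m, ξ (b ^ (m - 1 - t) w) • b ^ t u`. -/
def chainMap (b : Module.End k V) (m : ℕ) (ξ : Module.Dual k V) (u : V) : Module.End k V :=
  ∑ t ∈ Finset.range m, (ξ ∘ₗ (b ^ (m - 1 - t))).smulRight ((b ^ t) u)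

variable {b : Module.End k V} {m : ℕ} {ξ : Module.Dual k V} {u : V}

theorem chainMap_apply (w : V) : chainMap b m ξ u w =
    ∑ t ∈ Finset.range m, ξ ((b ^ (m - 1 - t)) w) • (b ^ t) u := by
  simp [chainMap]

theorem chainMap_comm_apply (hu : (b ^ m) u = 0) (hξ : ∀ w, ξ ((b ^ m) w) = 0) (w : V) :
    chainMap b m ξ u (b w) = b (chainMap b m ξ u w) := by
  rw [chainMap_apply, chainMap_apply, map_sum]
  cases m with
  | zero => simp
  | succ m =>
    rw [Finset.sum_range_succ', Finset.sum_range_succ]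
    have h0 : ξ ((b ^ (m + 1 - 1 - 0)) (b w)) = 0 := by
      rw [← hξ w, pow_succ, Module.End.mul_apply]; simp
    have h1 : b ((b ^ m) u) = 0 := by
      rw [← hu, pow_succ', Module.End.mul_apply]
    rw [h0, zero_smul, add_zero, map_smul, h1, smul_zero, add_zero]
    refine Finset.sum_congr rfl fun t ht => ?_
    rw [Finset.mem_range] at ht
    rw [map_smul, ← Module.End.mul_apply, ← Module.End.mul_apply, ← pow_succ, ← pow_succ',
      show m + 1 - 1 - (t + 1) + 1 = m + 1 - 1 - t by omega]

theorem chainMap_apply_of_apply_eq_zero (hm : 0 < m) {w : V} (hw : b w = 0) :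
    chainMap b m ξ u w = ξ w • (b ^ (m - 1)) u := by
  obtain ⟨m, rfl⟩ := Nat.exists_eq_succ_of_ne_zero hm.ne'
  rw [chainMap_apply, Finset.sum_range_succ, Finset.sum_eq_zero, zero_add]
  · simp
  · intro t ht
    rw [Finset.mem_range] at ht
    rw [show m.succ - 1 - t = (m - t - 1) + 1 by omega, pow_succ, Module.End.mul_apply, hw]
    simp

theorem pow_apply_eq_zero_of_le {t s : ℕ} (h : t ≤ s) {w : V} (hw : (b ^ t) w = 0) :
    (b ^ s) w = 0 := by
  obtain ⟨d, rfl⟩ := Nat.exists_eq_add_of_le h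
  rw [add_comm, pow_add, Module.End.mul_apply, hw, map_zero]

/-- Applying a power of `b` to a combination of a chain isolates one coefficient. -/
theorem pow_apply_chain_sum (hu : (b ^ m) u = 0) (c : ℕ → k) {j : ℕ}
    (hc : ∀ t, t + j + 1 < m → c t = 0) (hc' : ∀ t, m ≤ t → c t = 0) :
    (b ^ j) (∑ t ∈ Finset.range m, c t • (b ^ t) u) =
      (if j < m then c (m - 1 - j) else 0) • (b ^ (m - 1)) u := by
  simp_rw [map_sum, map_smul, ← Module.End.mul_apply, ← pow_add]
  split_ifs with hj
  · rw [Finset.sum_eq_single (m - 1 - j)]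
    · rw [show j + (m - 1 - j) = m - 1 by omega]
    · intro t ht htj
      rw [Finset.mem_range] at ht
      rcases lt_or_ge (t + j + 1) m with h | h
      · rw [hc t h, zero_smul]
      · rw [pow_apply_eq_zero_of_le (by omega) hu, smul_zero]
    · intro h
      rw [hc' _ (by rw [Finset.mem_range] at h; omega), zero_smul]
  · rw [zero_smul]
    refine Finset.sum_eq_zero fun t ht => ?_
    rw [pow_apply_eq_zero_of_le (by omega) hu, smul_zero]

theorem chain_pair_coeff_eq_zero {m' : ℕ} {η η' : Module.Dual k V} {u' : V}
    (hm : 0 < m) (hu : (b ^ m) u = 0) (hu' : (b ^ m') u' = 0)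
    (hη : ∀ w, η ((b ^ m) w) = 0) (hη' : ∀ w, η' ((b ^ m') w) = 0)
    (h1 : η ((b ^ (m - 1)) u) = 1) (h2 : 0 < m' → η ((b ^ (m' - 1)) u') = 0)
    (h3 : 0 < m' → η' ((b ^ (m' - 1)) u') = 1)
    (c d : ℕ → k) (hc : ∀ t, m ≤ t → c t = 0) (hd : ∀ t, m' ≤ t → d t = 0)
    (h : (chainMap b m η u + chainMap b m' η' u')
      (∑ t ∈ Finset.range m, c t • (b ^ t) u + ∑ t ∈ Finset.range m', d t • (b ^ t) u') = 0) :
    (∀ t, c t = 0) ∧ ∀ t, d t = 0 := by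
  set r := chainMap b m η u + chainMap b m' η' u' with hr
  set x := ∑ t ∈ Finset.range m, c t • (b ^ t) u + ∑ t ∈ Finset.range m', d t • (b ^ t) u'
  have hrb : ∀ j w, r ((b ^ j) w) = (b ^ j) (r w) := by
    intro j
    induction j with
    | zero => simp
    | succ j ih =>
      intro w
      rw [pow_succ, Module.End.mul_apply, ih, Module.End.mul_apply, hr, LinearMap.add_apply,
        chainMap_comm_apply hu hη, chainMap_comm_apply hu' hη', ← map_add, LinearMap.add_apply]
  have key : ∀ j, (∀ t, t + j + 1 < m → c t = 0) ∧ (∀ t, t + j + 1 < m' → d t = 0) →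
      (j < m → c (m - 1 - j) = 0) ∧ (j < m' → d (m' - 1 - j) = 0) := by
    rintro j ⟨hcj, hdj⟩
    set C := if j < m then c (m - 1 - j) else 0 with hC
    set D := if j < m' then d (m' - 1 - j) else 0 with hD
    have hbx : (b ^ j) x = C • (b ^ (m - 1)) u + D • (b ^ (m' - 1)) u' := by
      rw [map_add, pow_apply_chain_sum hu c hcj hc, pow_apply_chain_sum hu' d hdj hd]
    have hrx : r ((b ^ j) x) = 0 := by rw [hrb, h, map_zero]
    have hb1 : b ((b ^ (m - 1)) u) = 0 := by
      rw [← Module.End.mul_apply, ← pow_succ', Nat.sub_add_cancel hm, hu]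
    suffices C = 0 ∧ D = 0 by
      refine ⟨fun hj => ?_, fun hj => ?_⟩
      · rw [← this.1, hC, if_pos hj]
      · rw [← this.2, hD, if_pos hj]
    rcases Nat.eq_zero_or_pos m' with rfl | hm'
    · have hD0 : D = 0 := by simp [hD]
      rw [hbx, hD0, zero_smul, add_zero, hr, LinearMap.add_apply,
        chainMap_apply_of_apply_eq_zero hm (by rw [map_smul, hb1, smul_zero]), map_smul, h1] at hrx
      have : C • (b ^ (m - 1)) u = 0 := by simpa [chainMap] using hrx
      refine ⟨?_, hD0⟩
      simpa [h1] using congrArg η this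
    · have hb2 : b ((b ^ (m' - 1)) u') = 0 := by
        rw [← Module.End.mul_apply, ← pow_succ', Nat.sub_add_cancel hm', hu']
      have hbw : b ((b ^ j) x) = 0 := by
        rw [hbx, map_add, map_smul, map_smul, hb1, hb2, smul_zero, smul_zero, add_zero]
      rw [hr, LinearMap.add_apply, chainMap_apply_of_apply_eq_zero hm hbw,
        chainMap_apply_of_apply_eq_zero hm' hbw, hbx] at hrx
      have hC0 : C = 0 := by simpa [h1, h2 hm'] using congrArg η hrx
      refine ⟨hC0, ?_⟩
      simpa [hC0, h2 hm', h3 hm'] using congrArg η' hrx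
  have all : ∀ i j, m + m' ≤ i + j →
      (∀ t, t + j < m → c t = 0) ∧ (∀ t, t + j < m' → d t = 0) := by
    intro i
    induction i with
    | zero => exact fun j hj => ⟨fun t ht => by omega, fun t ht => by omega⟩
    | succ i ih =>
      intro j hj
      have h1 := ih (j + 1) (by omega)
      have h2 := key j ⟨fun t ht => h1.1 t (by omega), fun t ht => h1.2 t (by omega)⟩
      refine ⟨fun t ht => ?_, fun t ht => ?_⟩
      · by_cases hlt : t + (j + 1) < m
        · exact h1.1 t hlt
        · rw [show t = m - 1 - j by omega]; exact h2.1 (by omega)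
      · by_cases hlt : t + (j + 1) < m'
        · exact h1.2 t hlt
        · rw [show t = m' - 1 - j by omega]; exact h2.2 (by omega)
  have := all (m + m') 0 (by omega)
  refine ⟨fun t => ?_, fun t => ?_⟩
  · by_cases ht : t < m
    · exact this.1 t ht
    · exact hc t (by omega)
  · by_cases ht : t < m'
    · exact this.2 t ht
    · exact hd t (by omega)

end ChainMap

section GradedShift

variable {k V : Type} [Field k] [AddCommGroup V] [Module k V] {n : ℕ} [NeZero n]

/-- A complete family of orthogonal idempotents indexed by `ZMod n` together with an
endomorphism of degree one. -/
structure GradedShift (e : ZMod n → Module.End k V) (b : Module.End k V) : Prop where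
  orth : ∀ i j, e i * e j = if i = j then e i else 0
  sum_eq_one : ∑ i, e i = 1
  shift : ∀ i, b * e i = e (i + 1) * b

namespace GradedShift

variable {e : ZMod n → Module.End k V} {b : Module.End k V} (h : GradedShift e b)
include h

theorem pow_shift (t : ℕ) (i : ZMod n) : b ^ t * e i = e (i + t) * b ^ t := by
  induction t with
  | zero => simp
  | succ t ih =>
    rw [pow_succ', mul_assoc, ih, ← mul_assoc, h.shift, mul_assoc]
    push_cast
    rw [add_assoc]

theorem pow_apply (t : ℕ) (i : ZMod n) (w : V) : (b ^ t) (e i w) = e (i + t) ((b ^ t) w) := by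
  rw [← Module.End.mul_apply, h.pow_shift, Module.End.mul_apply]

theorem apply_apply (i j : ZMod n) (w : V) : e i (e j w) = if i = j then e j w else 0 := by
  rw [← Module.End.mul_apply, h.orth]
  split_ifs with hij
  · rw [hij]
  · rfl

theorem apply_pow {u : V} {s : ZMod n} (hu : e s u = u) (t : ℕ) (i : ZMod n) :
    e i ((b ^ t) u) = if i = s + t then (b ^ t) u else 0 := by
  nth_rw 1 [← hu]
  rw [h.pow_apply, h.apply_apply]
  split_ifs
  · rw [← h.pow_apply, hu]
  · rfl

theorem dual_pow {ξ : Module.Dual k V} {s : ZMod n} (hξ : ∀ w, ξ (e s w) = ξ w) (t : ℕ)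
    (i : ZMod n) (w : V) : ξ ((b ^ t) (e i w)) = if i + t = s then ξ ((b ^ t) w) else 0 := by
  rw [h.pow_apply, ← hξ, h.apply_apply]
  split_ifs with hs hs' hs'
  · rw [hs', hξ]
  · exact absurd hs.symm hs'
  · exact absurd hs'.symm hs
  · exact map_zero _

theorem dual_apply_pow {ξ : Module.Dual k V} {s : ZMod n} (hξ : ∀ w, ξ (e s w) = ξ w) {u : V}
    {s' : ZMod n} (hu : e s' u = u) (t : ℕ) (hs : s' + t ≠ s) : ξ ((b ^ t) u) = 0 := by
  rw [← hu, h.dual_pow hξ, if_neg hs]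

theorem chainMap_comm_idem {m : ℕ} {ξ : Module.Dual k V} {u : V} {s : ZMod n} (hu : e s u = u)
    (hξ : ∀ w, ξ (e (s + (m - 1 : ℕ)) w) = ξ w) (i : ZMod n) (w : V) :
    chainMap b m ξ u (e i w) = e i (chainMap b m ξ u w) := by
  rw [chainMap_apply, chainMap_apply, map_sum]
  refine Finset.sum_congr rfl fun t ht => ?_
  rw [Finset.mem_range] at ht
  rw [map_smul, h.apply_pow hu, h.dual_pow hξ]
  have : s + ((m - 1 : ℕ) : ZMod n) = (s + t) + ((m - 1 - t : ℕ) : ZMod n) := by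
    rw [add_assoc, ← Nat.cast_add, show t + (m - 1 - t) = m - 1 by omega]
  simp only [this, add_left_inj]
  split_ifs <;> simp

theorem exists_splitting {a : Module.End k V} {m m' : ℕ} {η η' : Module.Dual k V} {u u' : V}
    {s s' : ZMod n} (hm : 0 < m) (hs : e s u = u) (hs' : e s' u' = u')
    (hu : (b ^ m) u = 0) (hu' : (b ^ m') u' = 0)
    (hηs : ∀ w, η (e (s + (m - 1 : ℕ)) w) = η w)
    (hηs' : ∀ w, η' (e (s' + (m' - 1 : ℕ)) w) = η' w)
    (hη : ∀ w, η ((b ^ m) w) = 0) (hη' : ∀ w, η' ((b ^ m') w) = 0)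
    (h1 : η ((b ^ (m - 1)) u) = 1) (h2 : 0 < m' → η ((b ^ (m' - 1)) u') = 0)
    (h3 : 0 < m' → η' ((b ^ (m' - 1)) u') = 1)
    (har : ∀ w, (chainMap b m η u + chainMap b m' η' u') (a w) =
      a ((chainMap b m η u + chainMap b m' η' u') w))
    (hav : ∀ t < m, a ((b ^ t) u) = 0 ∨ ∃ t' < m', a ((b ^ t) u) = (b ^ t') u')
    (hav' : ∀ t < m', a ((b ^ t) u') = 0) :
    ∃ (v : Fin m ⊕ Fin m' → V) (r : Module.End k V),
      (∀ i x, r (e i x) = e i (r x)) ∧ (∀ x, r (b x) = b (r x)) ∧ (∀ x, r (a x) = a (r x)) ∧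
      (∀ x, r x ∈ Submodule.span k (Set.range v)) ∧ LinearIndependent k (fun l => r (v l)) ∧
      (∀ i l, e i (v l) = 0 ∨ ∃ l', e i (v l) = v l') ∧
      (∀ l, a (v l) = 0 ∨ ∃ l', a (v l) = v l') ∧
      (∀ l, b (v l) = 0 ∨ ∃ l', b (v l) = v l') := by
  refine ⟨Sum.elim (fun t => (b ^ t.1) u) (fun t => (b ^ t.1) u'),
    chainMap b m η u + chainMap b m' η' u', fun i x => ?_, fun x => ?_, har, fun x => ?_, ?_,
    ?_, ?_, ?_⟩
  · rw [LinearMap.add_apply, h.chainMap_comm_idem hs hηs, h.chainMap_comm_idem hs' hηs',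
      LinearMap.add_apply, map_add]
  · rw [LinearMap.add_apply, chainMap_comm_apply hu hη, chainMap_comm_apply hu' hη',
      LinearMap.add_apply, map_add]
  · rw [LinearMap.add_apply, chainMap_apply, chainMap_apply]
    refine add_mem (Submodule.sum_mem _ fun t ht => Submodule.smul_mem _ _ ?_)
      (Submodule.sum_mem _ fun t ht => Submodule.smul_mem _ _ ?_)
    · exact Submodule.subset_span ⟨Sum.inl ⟨t, Finset.mem_range.1 ht⟩, rfl⟩
    · exact Submodule.subset_span ⟨Sum.inr ⟨t, Finset.mem_range.1 ht⟩, rfl⟩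
  · rw [Fintype.linearIndependent_iff]
    intro g hg
    let c : ℕ → k := fun t => if ht : t < m then g (Sum.inl ⟨t, ht⟩) else 0
    let d : ℕ → k := fun t => if ht : t < m' then g (Sum.inr ⟨t, ht⟩) else 0
    have hcd := chain_pair_coeff_eq_zero hm hu hu' hη hη' h1 h2 h3 c d
      (fun t ht => dif_neg (by omega)) (fun t ht => dif_neg (by omega)) (by
        rw [← hg]
        simp_rw [← map_smul, ← map_sum, Fintype.sum_sum_type, Finset.sum_range]
        simp [c, d])
    rintro (t | t)
    · simpa [c] using hcd.1 t
    · simpa [d] using hcd.2 t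
  · rintro i (t | t)
    · rw [Sum.elim_inl, h.apply_pow hs]
      split_ifs
      exacts [Or.inr ⟨Sum.inl t, rfl⟩, Or.inl rfl]
    · rw [Sum.elim_inr, h.apply_pow hs']
      split_ifs
      exacts [Or.inr ⟨Sum.inr t, rfl⟩, Or.inl rfl]
  · rintro (t | t)
    · rcases hav t t.2 with h0 | ⟨t', ht', h0⟩
      exacts [Or.inl h0, Or.inr ⟨Sum.inr ⟨t', ht'⟩, h0⟩]
    · exact Or.inl (hav' t t.2)
  · rintro (t | t)
    · rw [Sum.elim_inl, ← Module.End.mul_apply, ← pow_succ']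
      rcases Nat.lt_or_ge (t + 1) m with ht | ht
      · exact Or.inr ⟨Sum.inl ⟨t + 1, ht⟩, rfl⟩
      · exact Or.inl (pow_apply_eq_zero_of_le ht hu)
    · rw [Sum.elim_inr, ← Module.End.mul_apply, ← pow_succ']
      rcases Nat.lt_or_ge (t + 1) m' with ht | ht
      · exact Or.inr ⟨Sum.inr ⟨t + 1, ht⟩, rfl⟩
      · exact Or.inl (pow_apply_eq_zero_of_le ht hu')

end GradedShift
end GradedShift

section GluedCycles

theorem ZMod.natCast_inj_of_lt {n i j : ℕ} (hi : i < n) (hj : j < n)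
    (h : (i : ZMod n) = (j : ZMod n)) : i = j := by
  rwa [ZMod.natCast_eq_natCast_iff', Nat.mod_eq_of_lt hi, Nat.mod_eq_of_lt hj] at h

theorem LinearMap.exists_dual_comp_eq {k V W : Type} [Field k] [AddCommGroup V] [Module k V]
    [AddCommGroup W] [Module k W] (f : V →ₗ[k] W) (ζ : Module.Dual k V)
    (h : ∀ x, f x = 0 → ζ x = 0) : ∃ η : Module.Dual k W, ∀ x, η (f x) = ζ x := by
  have : ζ ∈ LinearMap.range f.dualMap := by
    rw [LinearMap.range_dualMap_eq_dualAnnihilator_ker, Submodule.mem_dualAnnihilator]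
    exact fun x hx => h x hx
  obtain ⟨η, rfl⟩ := this
  exact ⟨η, fun x => rfl⟩

theorem Submodule.exists_dual_apply_eq_one {k V : Type} [Field k] [AddCommGroup V] [Module k V]
    (W : Submodule k V) {y : V} (hy : y ∉ W) :
    ∃ ξ : Module.Dual k V, ξ y = 1 ∧ ∀ w ∈ W, ξ w = 0 := by
  obtain ⟨f, hf, hW⟩ := Submodule.exists_le_ker_of_notMem hy
  refine ⟨(f y)⁻¹ • f, by simp [hf], fun w hw => ?_⟩
  rw [LinearMap.smul_apply, show f w = 0 from hW hw, smul_zero]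

variable {k V : Type} [Field k] [AddCommGroup V] [Module k V] {n : ℕ} [NeZero n]

/-- The operators by which the vertices, the loop and the sum of the cycle arrows of `Δ(1,n)`
act on a module on which the square of the loop and the full cycle vanish. -/
structure GluedCycles (e : ZMod n → Module.End k V) (a b : Module.End k V) : Prop
    extends GradedShift e b where
  idem_mul : e 0 * a = a
  mul_idem : a * e 0 = a
  loop_sq : a * a = 0
  pow_eq_zero : b ^ n = 0
  shift_idem_shift : b * e 0 * b = 0

namespace GluedCycles

variable {e : ZMod n → Module.End k V} {a b : Module.End k V} (h : GluedCycles e a b)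
include h

theorem pow_lt {p : ℕ} {u : V} (hu : (b ^ p) u ≠ 0) : p < n := by
  by_contra hp
  exact hu (pow_apply_eq_zero_of_le (not_lt.1 hp) (by rw [h.pow_eq_zero]; rfl))

theorem shift_shift {x : V} (hx : e 0 (b x) = b x) : b (b x) = 0 := by
  rw [← hx, ← Module.End.mul_apply, ← Module.End.mul_apply, h.shift_idem_shift]
  rfl

theorem apply_chain_end {p : ℕ} {u : V} (hu : e (-(p : ZMod n)) u = u) :
    e 0 ((b ^ p) u) = (b ^ p) u := by
  rw [h.apply_pow hu, if_pos (by simp)]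

theorem shift_chain_end {p : ℕ} {u : V} (hu : e (-(p : ZMod n)) u = u) (hp : 0 < p) :
    b ((b ^ p) u) = 0 := by
  have h0 := h.apply_chain_end hu
  obtain ⟨p, rfl⟩ := Nat.exists_eq_succ_of_ne_zero hp.ne'
  rw [Nat.succ_eq_add_one, pow_succ', Module.End.mul_apply] at h0 ⊢
  exact h.shift_shift h0

theorem exists_splitting_of_loop_eq_zero [Nontrivial V] (ha : a = 0) :
    ∃ (m m' : ℕ) (v : Fin m ⊕ Fin m' → V) (r : Module.End k V), m + m' ≤ 2 * n ∧ 0 < m ∧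
      (∀ i x, r (e i x) = e i (r x)) ∧ (∀ x, r (b x) = b (r x)) ∧ (∀ x, r (a x) = a (r x)) ∧
      (∀ x, r x ∈ Submodule.span k (Set.range v)) ∧ LinearIndependent k (fun l => r (v l)) ∧
      (∀ i l, e i (v l) = 0 ∨ ∃ l', e i (v l) = v l') ∧
      (∀ l, a (v l) = 0 ∨ ∃ l', a (v l) = v l') ∧
      (∀ l, b (v l) = 0 ∨ ∃ l', b (v l) = v l') := by
  classical
  subst ha
  have hex : ∃ L, b ^ L = 0 := ⟨n, h.pow_eq_zero⟩
  set L := Nat.find hex with hL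
  have hbL : b ^ L = 0 := Nat.find_spec hex
  have hLn : L ≤ n := Nat.find_min' hex h.pow_eq_zero
  have hLpos : 0 < L := by
    rw [Nat.pos_iff_ne_zero]
    intro h0
    rw [h0, pow_zero] at hbL
    exact one_ne_zero hbL
  have hne : b ^ (L - 1) ≠ 0 := Nat.find_min hex (by omega)
  obtain ⟨i, w, hw⟩ : ∃ i w, (b ^ (L - 1)) (e i w) ≠ 0 := by
    by_contra! hall
    refine hne ?_
    rw [← mul_one (b ^ (L - 1)), ← h.sum_eq_one, Finset.mul_sum]
    exact Finset.sum_eq_zero fun i _ => LinearMap.ext fun w => hall i w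
  obtain ⟨φ, hφ, -⟩ := (⊥ : Submodule k V).exists_dual_apply_eq_one (by simpa using hw)
  have hs : e i (e i w) = e i w := by rw [h.apply_apply, if_pos rfl]
  obtain ⟨v, r, H⟩ := h.toGradedShift.exists_splitting (a := 0) (m := L) (m' := 0)
    (η := φ ∘ₗ e (i + (L - 1 : ℕ))) (η' := 0) (u := e i w) (u' := 0) (s := i) (s' := 0) hLpos
    hs (map_zero _) (by rw [hbL]; rfl) (map_zero _)
    (fun w => by rw [LinearMap.comp_apply, h.apply_apply, if_pos rfl]; rfl)
    (fun w => rfl) (fun w => by rw [hbL]; simp) (fun w => rfl)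
    (by rw [LinearMap.comp_apply, h.apply_pow hs, if_pos rfl, hφ])
    (fun h0 => by omega) (fun h0 => by omega) (fun w => by simp) (fun t _ => Or.inl rfl)
    (fun t _ => rfl)
  exact ⟨L, 0, v, r, by omega, hLpos, H.1, H.2.1, H.2.2.1, H.2.2.2⟩

theorem exists_minimal_chain_end (ha : a ≠ 0) : ∃ (q p : ℕ) (u : V), 0 < q ∧ p + q ≤ n ∧
    e (-(p : ZMod n)) u = u ∧ (b ^ q) ((b ^ p) u) = 0 ∧ a ((b ^ p) u) ≠ 0 ∧
    (∀ x, e 0 x = x → (b ^ (q - 1)) x = 0 → a x = 0) ∧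
    (∀ w, a ((b ^ (p + 1)) w) = 0) := by
  classical
  obtain ⟨x0, hx0⟩ : ∃ x, a x ≠ 0 := by
    by_contra! h0
    exact ha (LinearMap.ext h0)
  have hae : ∀ x, a (e 0 x) = a x := fun x => by rw [← Module.End.mul_apply, h.mul_idem]
  have hex : ∃ q, ∃ x, e 0 x = x ∧ (b ^ q) x = 0 ∧ a x ≠ 0 :=
    ⟨n, e 0 x0, by rw [h.apply_apply, if_pos rfl], by rw [h.pow_eq_zero]; rfl, by rwa [hae]⟩
  set q := Nat.find hex with hq
  obtain ⟨x, hx, hbx, hax⟩ := Nat.find_spec hex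
  have hqn : q ≤ n := Nat.find_min' hex
    ⟨e 0 x0, by rw [h.apply_apply, if_pos rfl], by rw [h.pow_eq_zero]; rfl, by rwa [hae]⟩
  have hqpos : 0 < q := by
    rw [Nat.pos_iff_ne_zero]
    intro h0
    rw [← hq, h0] at hbx
    exact hax (by rw [show x = 0 from hbx, map_zero])
  let P : ℕ → Prop := fun p => ∃ u, e (-(p : ZMod n)) u = u ∧ (b ^ q) ((b ^ p) u) = 0 ∧
    a ((b ^ p) u) ≠ 0
  have hP0 : P 0 := ⟨x, by simpa using hx, hbx, hax⟩
  have hPlt : ∀ p, P p → p < n := by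
    rintro p ⟨u, -, -, hu⟩
    exact h.pow_lt (p := p) (u := u) fun h0 => hu (by rw [h0, map_zero])
  obtain ⟨u, hu, hbu, hau⟩ : P (Nat.findGreatest P n) :=
    Nat.findGreatest_spec (Nat.zero_le n) hP0
  have hmax : ¬ P (Nat.findGreatest P n + 1) := fun hP =>
    Nat.findGreatest_is_greatest (Nat.lt_succ_self _) (hPlt _ hP).le hP
  set p := Nat.findGreatest P n
  refine ⟨q, p, u, hqpos, ?_, hu, hbu, hau, fun y hy hby => ?_, fun w => ?_⟩
  · rcases Nat.eq_zero_or_pos p with hp | hp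
    · omega
    · have : q ≤ 1 := Nat.find_min' hex
        ⟨(b ^ p) u, h.apply_chain_end hu, by rw [pow_one, h.shift_chain_end hu hp], hau⟩
      have := hPlt p ⟨u, hu, hbu, hau⟩
      omega
  · by_contra hay
    exact Nat.find_min hex (show q - 1 < q by omega) ⟨y, hy, hby, hay⟩
  · by_contra hw
    have hs : e (-((p + 1 : ℕ) : ZMod n)) (e (-((p + 1 : ℕ) : ZMod n)) w) =
      e (-((p + 1 : ℕ) : ZMod n)) w := by rw [h.apply_apply, if_pos rfl]
    refine hmax ⟨e (-((p + 1 : ℕ) : ZMod n)) w, hs, ?_, ?_⟩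
    · exact pow_apply_eq_zero_of_le (t := 1) hqpos
        (by rw [pow_one, h.shift_chain_end hs p.succ_pos])
    · rwa [h.pow_apply, neg_add_cancel, hae]

theorem exists_maximal_chain_start {y : V} (hy : e 0 y = y) (hy0 : y ≠ 0) :
    ∃ (q p : ℕ) (u : V) (η : Module.Dual k V), 0 < q ∧ p + q ≤ n ∧
      e (-(p : ZMod n)) u = u ∧ (b ^ p) u = y ∧ (b ^ q) y = 0 ∧
      (∀ w, η (e ((q - 1 : ℕ) : ZMod n) w) = η w) ∧ (∀ w, η ((b ^ (p + q)) w) = 0) ∧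
      η ((b ^ (q - 1)) y) = 1 := by
  classical
  have hex : ∃ q, (b ^ q) y = 0 := ⟨n, by rw [h.pow_eq_zero]; rfl⟩
  set q := Nat.find hex with hq
  have hbq : (b ^ q) y = 0 := Nat.find_spec hex
  have hqn : q ≤ n := Nat.find_min' hex (by rw [h.pow_eq_zero]; rfl)
  have hqpos : 0 < q := by
    rw [Nat.pos_iff_ne_zero]
    intro h0
    rw [h0] at hbq
    exact hy0 hbq
  have hne : (b ^ (q - 1)) y ≠ 0 := Nat.find_min hex (by omega)
  let P : ℕ → Prop := fun p => ∃ u, e (-(p : ZMod n)) u = u ∧ (b ^ p) u = y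
  have hP0 : P 0 := ⟨y, by simpa using hy, rfl⟩
  have hPlt : ∀ p, P p → p < n := by
    rintro p ⟨u, -, hu⟩
    exact h.pow_lt (p := p) (u := u) (by rwa [hu])
  obtain ⟨u, hu, hbu⟩ : P (Nat.findGreatest P n) :=
    Nat.findGreatest_spec (Nat.zero_le n) hP0
  have hmax : ¬ P (Nat.findGreatest P n + 1) := fun hP =>
    Nat.findGreatest_is_greatest (Nat.lt_succ_self _) (hPlt _ hP).le hP
  set p := Nat.findGreatest P n
  have hpq : 0 < p → q = 1 := by
    intro hp
    have : q ≤ 1 := Nat.find_min' hex (by rw [pow_one, ← hbu, h.shift_chain_end hu hp])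
    omega
  have hs : e ((q - 1 : ℕ) : ZMod n) ((b ^ (q - 1)) y) = (b ^ (q - 1)) y := by
    rw [h.apply_pow hy, if_pos (by simp)]
  have hmem : (b ^ (q - 1)) y ∉ LinearMap.range (b ^ (p + q)) := by
    rintro ⟨w, hw⟩
    set w' := e (-((p + 1 : ℕ) : ZMod n)) w with hw'
    have hw's : e (-((p + 1 : ℕ) : ZMod n)) w' = w' := by rw [hw', h.apply_apply, if_pos rfl]
    have hbw : (b ^ (p + q)) w' = (b ^ (q - 1)) y := by
      rw [hw', h.pow_apply, hw]
      convert hs using 3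
      rw [show p + q = (p + 1) + (q - 1) by omega, Nat.cast_add (p + 1), Nat.cast_add p,
        Nat.cast_one, neg_add_cancel_left]
    rcases Nat.eq_zero_or_pos (q - 1) with h1 | h1
    · rw [h1, show p + q = p + 1 by omega] at hbw
      exact hmax ⟨w', hw's, hbw⟩
    · have hp : p = 0 := by
        by_contra hp
        have := hpq (Nat.pos_of_ne_zero hp)
        omega
      refine hne ?_
      rw [← hbw]
      refine pow_apply_eq_zero_of_le (t := 1 + (p + 1)) (by omega) ?_
      rw [pow_add, Module.End.mul_apply, pow_one, h.shift_chain_end hw's p.succ_pos]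
  obtain ⟨φ, hφ, hφ0⟩ := Submodule.exists_dual_apply_eq_one _ hmem
  refine ⟨q, p, u, φ ∘ₗ e ((q - 1 : ℕ) : ZMod n), hqpos, ?_, hu, hbu, hbq, fun w => ?_,
    fun w => ?_, ?_⟩
  · rcases Nat.eq_zero_or_pos p with hp | hp
    · omega
    · have := hpq hp
      have := hPlt p ⟨u, hu, hbu⟩
      omega
  · rw [LinearMap.comp_apply, h.apply_apply, if_pos rfl, LinearMap.comp_apply]
  · have := h.pow_apply (p + q) (((q - 1 : ℕ) : ZMod n) - ((p + q : ℕ) : ZMod n)) w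
    rw [sub_add_cancel] at this
    rw [LinearMap.comp_apply, ← this]
    exact hφ0 _ ⟨_, rfl⟩
  · rw [LinearMap.comp_apply, hs, hφ]

theorem exists_splitting_of_loop_ne_zero (ha : a ≠ 0) :
    ∃ (m m' : ℕ) (v : Fin m ⊕ Fin m' → V) (r : Module.End k V), m + m' ≤ 2 * n ∧ 0 < m ∧
      (∀ i x, r (e i x) = e i (r x)) ∧ (∀ x, r (b x) = b (r x)) ∧ (∀ x, r (a x) = a (r x)) ∧
      (∀ x, r x ∈ Submodule.span k (Set.range v)) ∧ LinearIndependent k (fun l => r (v l)) ∧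
      (∀ i l, e i (v l) = 0 ∨ ∃ l', e i (v l) = v l') ∧
      (∀ l, a (v l) = 0 ∨ ∃ l', a (v l) = v l') ∧
      (∀ l, b (v l) = 0 ∨ ∃ l', b (v l) = v l') := by
  obtain ⟨q, p, u, hq, hpq, hu, hbx, hax, hmin, hmax⟩ := h.exists_minimal_chain_end ha
  have hae : ∀ x, a (e 0 x) = a x := fun x => by rw [← Module.End.mul_apply, h.mul_idem]
  have hea : ∀ x, e 0 (a x) = a x := fun x => by rw [← Module.End.mul_apply, h.idem_mul]
  have haa : ∀ x, a (a x) = 0 := fun x => by rw [← Module.End.mul_apply, h.loop_sq]; rfl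
  obtain ⟨q', p', u', η', hq', hpq', hu', hbu', hby, hη's, hη'0, hη'1⟩ :=
    h.exists_maximal_chain_start (hea ((b ^ p) u)) hax
  obtain ⟨η₀, hη₀⟩ := LinearMap.exists_dual_comp_eq ((b ^ (q - 1)) ∘ₗ e 0)
    (η' ∘ₗ (b ^ (q' - 1)) ∘ₗ a) (fun x hx => by
      have := hmin (e 0 x) (by rw [h.apply_apply, if_pos rfl]) hx
      rw [hae] at this
      simp [this])
  set η : Module.Dual k V := η₀ ∘ₗ e ((q - 1 : ℕ) : ZMod n) with hη
  have hηs : ∀ w, η (e ((q - 1 : ℕ) : ZMod n) w) = η w := fun w => by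
    rw [hη, LinearMap.comp_apply, h.apply_apply, if_pos rfl, LinearMap.comp_apply]
  have hηw : ∀ w, η ((b ^ (q - 1)) w) = η' ((b ^ (q' - 1)) (a w)) := fun w => by
    have := hη₀ w
    rw [LinearMap.comp_apply, h.pow_apply, zero_add] at this
    exact this
  have hp : p < n := by omega
  have hp' : p' < n := by omega
  -- only one vector of each chain sits at the vertex `0`
  have hzero : ∀ {p q : ℕ} {u : V}, p + q ≤ n → 0 < q → e (-(p : ZMod n)) u = u →
      ∀ t < p + q, t ≠ p → a ((b ^ t) u) = 0 := by
    intro p q u hpq hq hu t ht htp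
    rw [← hae, h.apply_pow hu, if_neg, map_zero]
    intro h0
    refine htp (ZMod.natCast_inj_of_lt (n := n) (by omega) (by omega) ?_)
    rw [eq_comm, neg_add_eq_zero] at h0
    exact h0.symm
  have hzero' : ∀ {p q : ℕ} {ξ : Module.Dual k V}, p + q ≤ n → 0 < q →
      (∀ w, ξ (e ((q - 1 : ℕ) : ZMod n) w) = ξ w) →
      ∀ t < p + q, t ≠ p → ∀ w, ξ ((b ^ (p + q - 1 - t)) (a w)) = 0 := by
    intro p q ξ hpq hq hξ t ht htp w
    refine h.dual_apply_pow hξ (hea w) _ fun h0 => htp ?_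
    rw [zero_add] at h0
    have := ZMod.natCast_inj_of_lt (n := n) (by omega) (by omega) h0
    omega
  have hcast : ∀ {p q : ℕ}, 0 < q →
      -(p : ZMod n) + ((p + q - 1 : ℕ) : ZMod n) = ((q - 1 : ℕ) : ZMod n) := by
    intro p q hq
    rw [show p + q - 1 = p + (q - 1) by omega, Nat.cast_add, neg_add_cancel_left]
  have hlast : ∀ {p q : ℕ} {u : V}, 0 < q →
      (b ^ (p + q - 1)) u = (b ^ (q - 1)) ((b ^ p) u) := by
    intro p q u hq
    rw [← Module.End.mul_apply, ← pow_add, show p + q - 1 = q - 1 + p by omega]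
  have hleft : ∀ w, a (chainMap b (p + q) η u w) =
      η ((b ^ (q - 1)) w) • a ((b ^ p) u) := by
    intro w
    rw [chainMap_apply, map_sum, Finset.sum_eq_single p]
    · rw [map_smul, show p + q - 1 - p = q - 1 by omega]
    · intro t ht htp
      rw [map_smul, hzero hpq hq hu t (Finset.mem_range.1 ht) htp, smul_zero]
    · intro h0
      rw [Finset.mem_range] at h0
      omega
  have hleft' : ∀ w, a (chainMap b (p' + q') η' u' w) = 0 := by
    intro w
    rw [chainMap_apply, map_sum]
    refine Finset.sum_eq_zero fun t ht => ?_
    rw [map_smul]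
    by_cases htp : t = p'
    · rw [htp, hbu', haa, smul_zero]
    · rw [hzero hpq' hq' hu' t (Finset.mem_range.1 ht) htp, smul_zero]
  have hright : ∀ w, chainMap b (p + q) η u (a w) = 0 := by
    intro w
    rw [chainMap_apply]
    refine Finset.sum_eq_zero fun t ht => ?_
    by_cases htp : t = p
    · rw [htp, show p + q - 1 - p = q - 1 by omega, hηw, haa, map_zero, map_zero, zero_smul]
    · rw [hzero' hpq hq hηs t (Finset.mem_range.1 ht) htp, zero_smul]
  have hright' : ∀ w, chainMap b (p' + q') η' u' (a w) =
      η ((b ^ (q - 1)) w) • a ((b ^ p) u) := by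
    intro w
    rw [chainMap_apply, Finset.sum_eq_single p']
    · rw [show p' + q' - 1 - p' = q' - 1 by omega, hbu', hηw]
    · intro t ht htp
      rw [hzero' hpq' hq' hη's t (Finset.mem_range.1 ht) htp, zero_smul]
    · intro h0
      rw [Finset.mem_range] at h0
      omega
  obtain ⟨v, r, H⟩ := h.toGradedShift.exists_splitting (a := a) (m := p + q) (m' := p' + q')
    (η := η) (η' := η') (by omega) hu hu'
    (by rw [add_comm, pow_add, Module.End.mul_apply, hbx])
    (by rw [add_comm, pow_add, Module.End.mul_apply, hbu', hby])
    (fun w => by rw [hcast hq, hηs]) (fun w => by rw [hcast hq', hη's])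
    (fun w => by
      rw [show p + q = q - 1 + (p + 1) by omega, pow_add, Module.End.mul_apply, hηw, hmax,
        map_zero, map_zero])
    hη'0 (by rw [hlast hq, hηw, hη'1])
    (fun _ => by
      rw [hlast hq', hbu']
      by_cases hqq : q' = q
      · rw [hqq, hηw, haa, map_zero, map_zero]
      · refine h.dual_apply_pow hηs (hea _) _ fun h0 => hqq ?_
        rw [zero_add] at h0
        have := ZMod.natCast_inj_of_lt (n := n) (by omega) (by omega) h0
        omega)
    (fun _ => by rw [hlast hq', hbu', hη'1])
    (fun w => by
      rw [LinearMap.add_apply, LinearMap.add_apply, map_add, hleft, hleft', hright, hright',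
        zero_add, add_zero])
    (fun t ht => by
      by_cases htp : t = p
      · exact Or.inr ⟨p', by omega, by rw [htp, hbu']⟩
      · exact Or.inl (hzero hpq hq hu t ht htp))
    (fun t ht => by
      by_cases htp : t = p'
      · rw [htp, hbu', haa]
      · exact hzero hpq' hq' hu' t ht htp)
  exact ⟨p + q, p' + q', v, r, by omega, by omega, H⟩

theorem exists_splitting [Nontrivial V] :
    ∃ (m m' : ℕ) (v : Fin m ⊕ Fin m' → V) (r : Module.End k V), m + m' ≤ 2 * n ∧ 0 < m ∧
      (∀ i x, r (e i x) = e i (r x)) ∧ (∀ x, r (b x) = b (r x)) ∧ (∀ x, r (a x) = a (r x)) ∧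
      (∀ x, r x ∈ Submodule.span k (Set.range v)) ∧ LinearIndependent k (fun l => r (v l)) ∧
      (∀ i l, e i (v l) = 0 ∨ ∃ l', e i (v l) = v l') ∧
      (∀ l, a (v l) = 0 ∨ ∃ l', a (v l) = v l') ∧
      (∀ l, b (v l) = 0 ∨ ∃ l', b (v l) = v l') := by
  by_cases ha : a = 0
  · exact h.exists_splitting_of_loop_eq_zero ha
  · exact h.exists_splitting_of_loop_ne_zero ha

end GluedCycles
end GluedCycles

section BoundQuiver

variable {k : Type} [Field k] {V E : Type} [Fintype V] [DecidableEq V] (s t : E → V)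
  (extra extra' : FreeAlgebra k (V ⊕ E) → FreeAlgebra k (V ⊕ E) → Prop)

/-- The projection from the free algebra on vertices and arrows to a bound quiver algebra. -/
def boundQuiverMk : FreeAlgebra k (V ⊕ E) →ₐ[k] BoundQuiverAlg k s t extra :=
  RingQuot.mkAlgHom k (quivRel k s t extra)

theorem boundQuiverMk_surjective : Function.Surjective (boundQuiverMk s t extra) :=
  RingQuot.mkAlgHom_surjective k (quivRel k s t extra)

variable {s t extra extra'}

theorem boundQuiverMk_rel {x y : FreeAlgebra k (V ⊕ E)} (h : quivRel k s t extra x y) :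
    boundQuiverMk s t extra x = boundQuiverMk s t extra y :=
  RingQuot.mkAlgHom_rel k h

theorem boundQuiverMk_extra {x y : FreeAlgebra k (V ⊕ E)} (h : extra x y) :
    boundQuiverMk s t extra x = boundQuiverMk s t extra y :=
  boundQuiverMk_rel (Or.inr (Or.inr (Or.inr (Or.inr h))))

theorem adjoin_range_boundQuiverMk :
    Algebra.adjoin k (Set.range fun x => boundQuiverMk s t extra (FreeAlgebra.ι k x)) = ⊤ := by
  rw [show (fun x => boundQuiverMk s t extra (FreeAlgebra.ι k x)) =
    boundQuiverMk s t extra ∘ FreeAlgebra.ι k from rfl, Set.range_comp, ← AlgHom.map_adjoin,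
    FreeAlgebra.adjoin_range_ι, Algebra.map_top, AlgHom.range_eq_top]
  exact boundQuiverMk_surjective s t extra

theorem exists_boundQuiver_lift {T : Type} [Ring T] (f : FreeAlgebra k (V ⊕ E) →+* T)
    (hf : ∀ x y, quivRel k s t extra x y → f x = f y) :
    ∃ F : BoundQuiverAlg k s t extra →+* T, ∀ x, F (boundQuiverMk s t extra x) = f x := by
  refine ⟨RingQuot.lift ⟨f, fun x y h => hf x y h⟩, fun x => ?_⟩
  change RingQuot.lift _ (RingQuot.mkAlgHom k (quivRel k s t extra) x) = f x
  rw [← AlgHom.coe_toRingHom, RingQuot.mkAlgHom_coe, RingQuot.lift_mkRingHom_apply]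

theorem exists_boundQuiver_liftAlgHom {T : Type} [Ring T] [Algebra k T]
    (f : FreeAlgebra k (V ⊕ E) →ₐ[k] T) (hf : ∀ x y, quivRel k s t extra x y → f x = f y) :
    ∃ F : BoundQuiverAlg k s t extra →ₐ[k] T, ∀ x, F (boundQuiverMk s t extra x) = f x :=
  ⟨RingQuot.liftAlgHom k ⟨f, fun x y h => hf x y h⟩, fun x =>
    RingQuot.liftAlgHom_mkAlgHom_apply k f (fun x y h => hf x y h) x⟩

/-- Adding relations that hold modulo a central square-zero element, which itself becomes zero,
amounts to factoring out that element. -/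
theorem exists_centralReduction_boundQuiver (ζ : FreeAlgebra k (V ⊕ E))
    (hc : ∀ r, boundQuiverMk s t extra ζ * r = r * boundQuiverMk s t extra ζ)
    (hsq : boundQuiverMk s t extra ζ * boundQuiverMk s t extra ζ = 0)
    (hz : boundQuiverMk s t extra' ζ = 0)
    (h1 : ∀ x y, extra x y → boundQuiverMk s t extra' x = boundQuiverMk s t extra' y)
    (h2 : ∀ x y, extra' x y → ∃ c, boundQuiverMk s t extra x - boundQuiverMk s t extra y =
      boundQuiverMk s t extra ζ * c) :
    ∃ φ : BoundQuiverAlg k s t extra →ₐ[k] BoundQuiverAlg k s t extra',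
      CentralReduction φ.toRingHom (boundQuiverMk s t extra ζ) := by
  set z := boundQuiverMk s t extra ζ with hzdef
  obtain ⟨φ, hφ⟩ := exists_boundQuiver_liftAlgHom (extra := extra) (boundQuiverMk s t extra')
    (fun x y h => by
      rcases h with h | h | h | h | h
      · exact boundQuiverMk_rel (Or.inl h)
      · exact boundQuiverMk_rel (Or.inr (Or.inl h))
      · exact boundQuiverMk_rel (Or.inr (Or.inr (Or.inl h)))
      · exact boundQuiverMk_rel (Or.inr (Or.inr (Or.inr (Or.inl h))))
      · exact h1 x y h)
  let I : Ideal (BoundQuiverAlg k s t extra) :=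
    { carrier := {r | ∃ c, r = z * c}
      zero_mem' := ⟨0, by rw [mul_zero]⟩
      add_mem' := by
        rintro _ _ ⟨c, rfl⟩ ⟨d, rfl⟩
        exact ⟨c + d, by rw [mul_add]⟩
      smul_mem' := by
        rintro a _ ⟨c, rfl⟩
        exact ⟨a * c, by rw [smul_eq_mul, ← mul_assoc, ← hc, mul_assoc]⟩ }
  have hI : I.IsTwoSided := ⟨by
    rintro _ b ⟨c, rfl⟩
    exact ⟨c * b, by rw [mul_assoc]⟩⟩
  obtain ⟨ψ, hψ⟩ := exists_boundQuiver_lift (s := s) (t := t) (extra := extra')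
    ((Ideal.Quotient.mk I).comp (boundQuiverMk s t extra).toRingHom) (fun x y h => by
      have hrel : ∀ h : quivRel k s t extra x y,
          (Ideal.Quotient.mk I).comp (boundQuiverMk s t extra).toRingHom x =
          (Ideal.Quotient.mk I).comp (boundQuiverMk s t extra).toRingHom y := fun h =>
        congrArg (Ideal.Quotient.mk I) (boundQuiverMk_rel h)
      rcases h with h | h | h | h | h
      · exact hrel (Or.inl h)
      · exact hrel (Or.inr (Or.inl h))
      · exact hrel (Or.inr (Or.inr (Or.inl h)))
      · exact hrel (Or.inr (Or.inr (Or.inr (Or.inl h))))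
      · exact Ideal.Quotient.eq.2 (h2 x y h))
  refine ⟨φ, fun y => ?_, hc, hsq, (hφ ζ).trans hz, fun r hr => ?_⟩
  · obtain ⟨x, rfl⟩ := boundQuiverMk_surjective s t extra' y
    exact ⟨_, hφ x⟩
  · obtain ⟨x, rfl⟩ := boundQuiverMk_surjective s t extra r
    have : boundQuiverMk s t extra' x = 0 := (hφ x).symm.trans hr
    have h0 : Ideal.Quotient.mk I (boundQuiverMk s t extra x) = 0 := by
      rw [← map_zero ψ, ← this, hψ]
      rfl
    exact Ideal.Quotient.eq_zero_iff_mem.1 h0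

end BoundQuiver

theorem Module.Finite.of_centralReduction {k A C : Type} [Field k] [Ring A] [Algebra k A] [Ring C]
    [Algebra k C] [Module.Finite k C] {φ : A →ₐ[k] C} {z : A}
    (h : CentralReduction φ.toRingHom z) : Module.Finite k A := by
  let K := LinearMap.ker φ.toLinearMap
  have e := φ.toLinearMap.quotKerEquivOfSurjective h.surjective
  have h1 : Module.Finite k (A ⧸ K) := Module.Finite.equiv e.symm
  have hle : K ≤ LinearMap.ker (LinearMap.mulLeft k z) := by
    intro x hx
    obtain ⟨c, rfl⟩ := h.ker x hx
    rw [LinearMap.mem_ker, LinearMap.mulLeft_apply, ← mul_assoc, h.sq, zero_mul]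
  have hK : LinearMap.range (K.liftQ (LinearMap.mulLeft k z) hle) = K := by
    rw [Submodule.range_liftQ]
    ext x
    constructor
    · rintro ⟨c, rfl⟩
      change φ (z * c) = 0
      rw [map_mul, show φ z = 0 from h.map_eq_zero, zero_mul]
    · intro hx
      obtain ⟨c, rfl⟩ := h.ker x hx
      exact ⟨c, rfl⟩
  have h2 : Module.Finite k K := by
    rw [← hK]
    infer_instance
  exact Module.Finite.of_submodule_quotient K

section CycleSystem

variable {R : Type} [Ring R] {n : ℕ} [NeZero n]

/-- The relations among the idempotents, the loop `a` and the sum `b` of the cycle arrows that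
hold in every quotient of the path algebra of `Δ(1,n)` in which `β_n β_1` vanishes. -/
structure CycleSystem (E : ZMod n → R) (a b : R) : Prop where
  orth : ∀ i j, E i * E j = if i = j then E i else 0
  sum_eq_one : ∑ i, E i = 1
  idem_mul : E 0 * a = a
  mul_idem : a * E 0 = a
  shift : ∀ i, E i * b = b * E (i + 1)
  shift_idem_shift : b * E 0 * b = 0

namespace CycleSystem

variable {E : ZMod n → R} {a b : R} (h : CycleSystem E a b)
include h

theorem mul_pow (i : ZMod n) (t : ℕ) : E i * b ^ t = b ^ t * E (i + t) := by
  induction t generalizing i with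
  | zero => simp
  | succ t ih =>
    rw [pow_succ', ← mul_assoc, h.shift, mul_assoc, ih, ← mul_assoc]
    push_cast
    rw [add_assoc, add_comm 1]

theorem mul_pow_card (i : ZMod n) : E i * b ^ n = b ^ n * E i := by
  rw [h.mul_pow, ZMod.natCast_self, add_zero]

theorem cycle_mul_shift : E 0 * b ^ n * b = 0 := by
  obtain ⟨m, hm⟩ : ∃ m, b ^ n = b ^ m * b :=
    ⟨n - 1, by rw [← pow_succ, Nat.sub_add_cancel NeZero.one_le]⟩
  rw [h.mul_pow_card, hm, mul_assoc, mul_assoc, ← mul_assoc b, h.shift_idem_shift, mul_zero]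

theorem shift_mul_cycle : b * (E 0 * b ^ n) = 0 := by
  obtain ⟨m, hm⟩ : ∃ m, b ^ n = b * b ^ m :=
    ⟨n - 1, by rw [← pow_succ', Nat.sub_add_cancel NeZero.one_le]⟩
  rw [hm, ← mul_assoc, ← mul_assoc, h.shift_idem_shift, zero_mul]

theorem cycle_mul_idem (i : ZMod n) : E 0 * b ^ n * E i = E i * (E 0 * b ^ n) := by
  rw [h.mul_pow_card, mul_assoc, h.orth, ← h.mul_pow_card, ← mul_assoc, h.orth]
  by_cases hi : i = 0
  · rw [hi, if_pos rfl, h.mul_pow_card]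
  · rw [if_neg (Ne.symm hi), if_neg hi, mul_zero, zero_mul]

theorem cycle_sq : E 0 * b ^ n * (E 0 * b ^ n) = 0 := by
  obtain ⟨m, hm⟩ : ∃ m, b ^ n = b * b ^ m :=
    ⟨n - 1, by rw [← pow_succ', Nat.sub_add_cancel NeZero.one_le]⟩
  have h0 : E 0 * b ^ n * b ^ n = 0 := by
    calc E 0 * b ^ n * b ^ n = E 0 * b ^ n * b * b ^ m := by rw [mul_assoc _ b, ← hm]
      _ = 0 := by rw [h.cycle_mul_shift, zero_mul]
  rw [← mul_assoc, h.cycle_mul_idem, mul_assoc, h0, mul_zero]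

theorem pow_card_eq_zero (hz : E 0 * b ^ n = 0) : b ^ n = 0 := by
  rw [← one_mul (b ^ n), ← h.sum_eq_one, Finset.sum_mul]
  refine Finset.sum_eq_zero fun j _ => ?_
  by_cases hj : j = 0
  · rw [hj, hz]
  · have h0 : 0 < (-j).val := by
      rw [Nat.pos_iff_ne_zero]
      intro h0
      rw [ZMod.val_eq_zero, neg_eq_zero] at h0
      exact hj h0
    obtain ⟨c, hc⟩ := Nat.exists_eq_succ_of_ne_zero h0.ne'
    obtain ⟨d, hd⟩ := Nat.exists_eq_add_of_lt (ZMod.val_lt (-j))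
    have hn : b ^ n = b ^ ((-j).val) * (b * b ^ d) := by
      rw [← pow_succ', ← pow_add]
      congr 1
    rw [hn, ← mul_assoc, h.mul_pow, ZMod.natCast_zmod_val, add_neg_cancel, hc,
      Nat.succ_eq_add_one, pow_succ, mul_assoc, mul_assoc, ← mul_assoc (E 0), ← mul_assoc b,
      ← mul_assoc b, h.shift_idem_shift, zero_mul, mul_zero]

variable {k : Type} [Field k] [Algebra k R]

theorem finite (ha : a * a = 0) (hz : E 0 * b ^ n = 0) {G : Type} {g : G → R}
    (hadj : Algebra.adjoin k (Set.range g) = ⊤)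
    (hg : ∀ γ, (∃ j, g γ = E j) ∨ g γ = a ∨ ∃ j, g γ = E j * b) : Module.Finite k R := by
  have hb := h.pow_card_eq_zero hz
  let T : Set R := Set.range (fun x : ZMod n × Fin n => E x.1 * b ^ x.2.1) ∪
    Set.range (fun x : ZMod n × Fin n × Fin n => E x.1 * b ^ x.2.1.1 * a * b ^ x.2.2.1)
  let S := Submodule.span k T
  have hn : 0 < n := Nat.pos_of_ne_zero (NeZero.ne n)
  have hm1 : ∀ i t, E i * b ^ t ∈ S := by
    intro i t
    by_cases ht : t < n
    · exact Submodule.subset_span (Or.inl ⟨(i, ⟨t, ht⟩), rfl⟩)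
    · rw [pow_eq_zero_of_le (not_lt.1 ht) hb, mul_zero]
      exact zero_mem _
  have hm2 : ∀ i s t, E i * b ^ s * a * b ^ t ∈ S := by
    intro i s t
    by_cases hs : s < n
    · by_cases ht : t < n
      · exact Submodule.subset_span (Or.inr ⟨(i, ⟨s, hs⟩, ⟨t, ht⟩), rfl⟩)
      · rw [pow_eq_zero_of_le (not_lt.1 ht) hb, mul_zero]
        exact zero_mem _
    · rw [pow_eq_zero_of_le (not_lt.1 hs) hb, mul_zero, zero_mul, zero_mul]
      exact zero_mem _
  have hT : ∀ y, (∀ x ∈ T, x * y ∈ S) → ∀ x ∈ S, x * y ∈ S := fun y hy x hx => by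
    have : S ≤ S.comap (LinearMap.mulRight k y) := Submodule.span_le.2 hy
    exact this hx
  have hpE : ∀ (t : ℕ) j, b ^ t * E j = E (j - t) * b ^ t := fun t j => by
    rw [h.mul_pow, sub_add_cancel]
  have hE : ∀ j, ∀ x ∈ S, x * E j ∈ S := by
    intro j
    refine hT _ ?_
    rintro _ (⟨⟨i, t⟩, rfl⟩ | ⟨⟨i, s, t⟩, rfl⟩)
    · dsimp only
      rw [mul_assoc, hpE, ← mul_assoc, h.orth]
      split_ifs
      · exact hm1 _ _
      · rw [zero_mul]; exact zero_mem _
    · dsimp only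
      rw [mul_assoc, hpE, ← mul_assoc, mul_assoc _ a, ← h.mul_idem, mul_assoc a, h.orth]
      split_ifs
      · rw [h.mul_idem]; exact hm2 _ _ _
      · rw [mul_zero, mul_zero, zero_mul]; exact zero_mem _
  have hB : ∀ x ∈ S, x * b ∈ S := by
    refine hT _ ?_
    rintro _ (⟨⟨i, t⟩, rfl⟩ | ⟨⟨i, s, t⟩, rfl⟩)
    · dsimp only
      rw [mul_assoc, ← pow_succ]
      exact hm1 _ _
    · dsimp only
      rw [mul_assoc, ← pow_succ]
      exact hm2 _ _ _
  have hA : ∀ x ∈ S, x * a ∈ S := by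
    refine hT _ ?_
    rintro _ (⟨⟨i, t⟩, rfl⟩ | ⟨⟨i, s, t⟩, rfl⟩)
    · simpa using hm2 i t 0
    · dsimp only
      have : a * b ^ t.1 * a = 0 := by
        have h0 : a * b ^ t.1 * a = a * (E 0 * E (0 - t.1)) * b ^ t.1 * a := by
          rw [← mul_assoc a, h.mul_idem, mul_assoc a (E _), ← hpE, ← mul_assoc a, mul_assoc _ (E 0),
            h.idem_mul]
        rw [h0, h.orth]
        split_ifs with ht
        · have : (t : ℕ) = 0 := by
            refine ZMod.natCast_inj_of_lt t.2 hn ?_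
            rw [zero_sub, eq_comm, neg_eq_zero] at ht
            rw [ht, Nat.cast_zero]
          rw [this, pow_zero, mul_one, h.mul_idem, ha]
        · rw [mul_zero, zero_mul, zero_mul]
      rw [mul_assoc _ a, mul_assoc _ _ a, this, mul_zero]
      exact zero_mem _
  have h1 : (1 : R) ∈ S := by
    rw [← h.sum_eq_one]
    exact Submodule.sum_mem _ fun i _ => by simpa using hm1 i 0
  have htop : S = ⊤ := by
    rw [eq_top_iff]
    rintro x -
    have hx : x ∈ Algebra.adjoin k (Set.range g) := by rw [hadj]; trivial
    suffices ∀ y ∈ S, y * x ∈ S by simpa using this 1 h1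
    induction hx using Algebra.adjoin_induction with
    | mem x hx =>
      obtain ⟨γ, rfl⟩ := hx
      rcases hg γ with ⟨j, hj⟩ | hj | ⟨j, hj⟩
      · rw [hj]; exact hE j
      · rw [hj]; exact hA
      · rw [hj]
        exact fun y hy => by rw [← mul_assoc]; exact hB _ (hE _ _ hy)
    | algebraMap r =>
      intro y hy
      rw [← Algebra.commutes, ← Algebra.smul_def]
      exact S.smul_mem r hy
    | add x y _ _ hx hy =>
      intro w hw
      rw [mul_add]
      exact add_mem (hx w hw) (hy w hw)
    | mul x y _ _ hx hy =>
      intro w hw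
      rw [← mul_assoc]
      exact hy _ (hx w hw)
  refine Module.finite_def.2 ?_
  rw [← htop]
  exact Submodule.fg_span ((Set.finite_range _).union (Set.finite_range _))

theorem gluedCycles (ha : a * a = 0) (hz : E 0 * b ^ n = 0) {M : Type} [AddCommGroup M]
    [Module k M] (ρ : Rᵐᵒᵖ →ₐ[k] Module.End k M) :
    GluedCycles (fun i => ρ (op (E i))) (ρ (op a)) (ρ (op b)) where
  orth i j := by
    rw [← map_mul, ← op_mul, h.orth]
    split_ifs with h1 h2 h2
    · rw [h1]
    · exact absurd h1.symm h2
    · exact absurd h2.symm h1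
    · exact map_zero ρ
  sum_eq_one := by rw [← map_sum, ← Finset.op_sum, h.sum_eq_one, op_one, map_one]
  shift i := by rw [← map_mul, ← op_mul, h.shift, op_mul, map_mul]
  idem_mul := by rw [← map_mul, ← op_mul, h.mul_idem]
  mul_idem := by rw [← map_mul, ← op_mul, h.idem_mul]
  loop_sq := by rw [← map_mul, ← op_mul, ha, MulOpposite.op_zero, map_zero]
  pow_eq_zero := by rw [← map_pow, ← op_pow, h.pow_card_eq_zero hz, MulOpposite.op_zero, map_zero]
  shift_idem_shift := by
    rw [← map_mul, ← map_mul, ← op_mul, ← op_mul, ← mul_assoc, h.shift_idem_shift, MulOpposite.op_zero,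
      map_zero]

theorem tauTiltingFinite (ha : a * a = 0) (hz : E 0 * b ^ n = 0) {G : Type} [Finite G]
    {g : G → R} (hadj : Algebra.adjoin k (Set.range g) = ⊤)
    (hg : ∀ γ, (∃ j, g γ = E j) ∨ g γ = a ∨ ∃ j, g γ = E j * b) : TauTiltingFinite k R := by
  have := h.finite ha hz hadj hg
  refine tauTiltingFinite_of_monomial (n := 2 * n) hadj fun M hM hM' => ?_
  let : Module k M := Module.compHom M (algebraMap k Rᵐᵒᵖ)
  have : IsScalarTower k Rᵐᵒᵖ M := ⟨fun c x m => by
    rw [Algebra.smul_def, mul_smul]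
    rfl⟩
  obtain ⟨m, m', v, r, hmn, hm, hre, hrb, hra, hspan, hli, hve, hva, hvb⟩ :=
    (h.gluedCycles ha hz (Algebra.lsmul k k M)).exists_splitting
  have : Nonempty (Fin m) := ⟨⟨0, hm⟩⟩
  refine exists_isMonomial_summand hadj M (ι := Fin m ⊕ Fin m') (by simpa using hmn) v r
    (fun γ x => ?_) hspan hli (fun γ l => ?_)
  · rcases hg γ with ⟨j, hj⟩ | hj | ⟨j, hj⟩
    · rw [hj]; exact hre j x
    · rw [hj]; exact hra x
    · rw [hj, op_mul, mul_smul, mul_smul]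
      exact (hrb _).trans (congrArg (fun y => op b • y) (hre j x))
  · rcases hg γ with ⟨j, hj⟩ | hj | ⟨j, hj⟩
    · rw [hj]; exact hve j l
    · rw [hj]; exact hva l
    · rw [hj, op_mul, mul_smul]
      rcases hve j l with h0 | ⟨l', h0⟩
      · left
        rw [show op (E j) • v l = 0 from h0, smul_zero]
      · rw [show op (E j) • v l = v l' from h0]
        exact hvb l'

end CycleSystem
end CycleSystem

section CycleAlgebras

variable {k : Type} [Field k] {n : ℕ} [NeZero n]

theorem arrWord_append {V E : Type} (l l' : List E) :
    arrWord k (V := V) (l ++ l') = arrWord k l * arrWord k l' := by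
  simp [arrWord]

theorem arrWord_singleton {V E : Type} (x : E) :
    arrWord k (V := V) [x] = FreeAlgebra.ι k (Sum.inr x) := by
  simp [arrWord]

theorem bw_succ (p st len : ℕ) :
    bw p n st (len + 1) = bw p n st len ++ bw p n (st + len) 1 := by
  unfold bw
  rw [List.range_succ]
  exact List.map_append

theorem cycVR_injective (p q : ℕ) : Function.Injective (cycVR p q) := by
  have hpos : cycVR p q 0 = none := dif_pos rfl
  have hneg : ∀ {i : ZMod q} (hi : i ≠ 0), cycVR p q i = some (Sum.inr ⟨i, hi⟩) :=
    fun hi => dif_neg hi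
  intro i j h
  by_cases hi : i = 0 <;> by_cases hj : j = 0
  · rw [hi, hj]
  · subst hi
    exact absurd (hpos.symm.trans (h.trans (hneg hj))) (Option.some_ne_none _).symm
  · subst hj
    exact absurd ((hneg hi).symm.trans (h.trans hpos)) (Option.some_ne_none _)
  · exact congrArg Subtype.val
      (Sum.inr.inj (Option.some.inj ((hneg hi).symm.trans (h.trans (hneg hj)))))

theorem cycVR_surjective (q : ℕ) : Function.Surjective (cycVR 1 q) := by
  rintro (_ | ⟨i, hi⟩ | ⟨j, hj⟩)
  · exact ⟨0, dif_pos rfl⟩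
  · exact absurd (Subsingleton.elim i 0) hi
  · exact ⟨j, dif_neg hj⟩

theorem cycVL_eq (i : ZMod 1) : cycVL 1 n i = cycVR 1 n 0 :=
  (dif_pos (Subsingleton.elim i 0) : cycVL 1 n i = none).trans
    (dif_pos rfl : cycVR 1 n 0 = none).symm

variable (extra : FreeAlgebra k (CycV 1 n ⊕ CycE 1 n) → FreeAlgebra k (CycV 1 n ⊕ CycE 1 n) → Prop)

/-- The projection onto a quotient of the path algebra of `Δ(1,n)`. -/
abbrev cycMk : FreeAlgebra k (CycV 1 n ⊕ CycE 1 n) →ₐ[k]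
    BoundQuiverAlg k (cycSrc 1 n) (cycTgt 1 n) extra :=
  boundQuiverMk (cycSrc 1 n) (cycTgt 1 n) extra

/-- The idempotent at the `j`-th vertex of the cycle. -/
def cycIdem (j : ZMod n) : BoundQuiverAlg k (cycSrc 1 n) (cycTgt 1 n) extra :=
  cycMk extra (FreeAlgebra.ι k (Sum.inl (cycVR 1 n j)))

/-- The loop. -/
def cycLoop : BoundQuiverAlg k (cycSrc 1 n) (cycTgt 1 n) extra :=
  cycMk extra (FreeAlgebra.ι k (Sum.inr (Sum.inl 0)))

/-- The `j`-th arrow of the cycle. -/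
def cycArrow (j : ZMod n) : BoundQuiverAlg k (cycSrc 1 n) (cycTgt 1 n) extra :=
  cycMk extra (FreeAlgebra.ι k (Sum.inr (Sum.inr j)))

/-- The sum of the arrows of the cycle. -/
def cycShift : BoundQuiverAlg k (cycSrc 1 n) (cycTgt 1 n) extra := ∑ j, cycArrow extra j

theorem cycIdem_mul_cycIdem (i j : ZMod n) : cycIdem extra i * cycIdem extra j =
    if i = j then cycIdem extra i else 0 := by
  have := boundQuiverMk_rel (s := cycSrc 1 n) (t := cycTgt 1 n) (extra := extra)
    (Or.inl ⟨cycVR 1 n i, cycVR 1 n j, rfl, rfl⟩)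
  rw [map_mul] at this
  refine this.trans ?_
  by_cases h : i = j
  · rw [if_pos h, if_pos (congrArg _ h)]; rfl
  · rw [if_neg h, if_neg fun h' => h (cycVR_injective 1 n h'), map_zero]

theorem sum_cycIdem : ∑ j, cycIdem extra j = 1 := by
  have := boundQuiverMk_rel (s := cycSrc 1 n) (t := cycTgt 1 n) (extra := extra)
    (Or.inr (Or.inl ⟨rfl, rfl⟩))
  rw [map_sum, map_one] at this
  rw [← this]
  exact Function.Bijective.sum_comp ⟨cycVR_injective 1 n, cycVR_surjective n⟩
    (fun v => cycMk extra (FreeAlgebra.ι k (Sum.inl v)))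

theorem cycIdem_mul_cycLoop : cycIdem extra 0 * cycLoop extra = cycLoop extra := by
  have := boundQuiverMk_rel (s := cycSrc 1 n) (t := cycTgt 1 n) (extra := extra)
    (Or.inr (Or.inr (Or.inl ⟨Sum.inl 0, rfl, rfl⟩)))
  rw [map_mul] at this
  rwa [cycSrc, cycVL_eq] at this

theorem cycLoop_mul_cycIdem : cycLoop extra * cycIdem extra 0 = cycLoop extra := by
  have := boundQuiverMk_rel (s := cycSrc 1 n) (t := cycTgt 1 n) (extra := extra)
    (Or.inr (Or.inr (Or.inr (Or.inl ⟨Sum.inl 0, rfl, rfl⟩))))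
  rw [map_mul] at this
  rwa [cycTgt, cycVL_eq] at this

theorem cycIdem_mul_cycArrow (j : ZMod n) :
    cycIdem extra j * cycArrow extra j = cycArrow extra j := by
  have := boundQuiverMk_rel (s := cycSrc 1 n) (t := cycTgt 1 n) (extra := extra)
    (Or.inr (Or.inr (Or.inl ⟨Sum.inr j, rfl, rfl⟩)))
  rwa [map_mul] at this

theorem cycArrow_mul_cycIdem (j : ZMod n) :
    cycArrow extra j * cycIdem extra (j + 1) = cycArrow extra j := by
  have := boundQuiverMk_rel (s := cycSrc 1 n) (t := cycTgt 1 n) (extra := extra)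
    (Or.inr (Or.inr (Or.inr (Or.inl ⟨Sum.inr j, rfl, rfl⟩))))
  rwa [map_mul] at this

theorem cycIdem_mul_cycShift (j : ZMod n) :
    cycIdem extra j * cycShift extra = cycArrow extra j := by
  rw [cycShift, Finset.mul_sum, Finset.sum_eq_single j]
  · exact cycIdem_mul_cycArrow extra j
  · intro i _ hij
    rw [← cycIdem_mul_cycArrow, ← mul_assoc, cycIdem_mul_cycIdem, if_neg hij.symm, zero_mul]
  · simp

theorem cycShift_mul_cycIdem (j : ZMod n) :
    cycShift extra * cycIdem extra (j + 1) = cycArrow extra j := by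
  rw [cycShift, Finset.sum_mul, Finset.sum_eq_single j]
  · exact cycArrow_mul_cycIdem extra j
  · intro i _ hij
    rw [← cycArrow_mul_cycIdem, mul_assoc, cycIdem_mul_cycIdem, if_neg, mul_zero]
    simpa using hij
  · simp

theorem cycMk_loopWord : cycMk extra (arrWord k (aw 1 n 0 1)) = cycLoop extra := by
  have h : aw 1 n 0 1 = [(Sum.inl 0 : CycE 1 n)] :=
    congrArg (fun x : ZMod 1 => ([Sum.inl x] : List (CycE 1 n))) (Subsingleton.elim _ _)
  rw [h]
  exact congrArg (cycMk extra) (arrWord_singleton _)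

theorem cycMk_cycleWord (st : ℕ) {len : ℕ} (hlen : 1 ≤ len) :
    cycMk extra (arrWord k (bw 1 n st len)) =
      cycIdem extra (st : ZMod n) * cycShift extra ^ len := by
  have hone : ∀ st : ℕ, cycMk extra (arrWord k (bw 1 n st 1)) =
      cycIdem extra (st : ZMod n) * cycShift extra := fun st => by
    rw [cycIdem_mul_cycShift]
    exact congrArg (cycMk extra) (arrWord_singleton _)
  have hshift : ∀ (i : ZMod n) (t : ℕ), cycShift extra ^ t * cycIdem extra (i + t) =
      cycIdem extra i * cycShift extra ^ t := by
    intro i t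
    induction t generalizing i with
    | zero => simp
    | succ t ih =>
      have := ih (i + 1)
      rw [add_assoc, add_comm 1] at this
      rw [pow_succ', Nat.cast_succ, mul_assoc, this, ← mul_assoc, cycShift_mul_cycIdem,
        ← cycIdem_mul_cycShift, mul_assoc]
  induction len, hlen using Nat.le_induction with
  | base => rw [pow_one, hone]
  | succ len _ ih =>
    rw [bw_succ, arrWord_append, map_mul, ih, hone, Nat.cast_add, ← mul_assoc, mul_assoc _ _ (cycIdem _ _),
      hshift, ← mul_assoc, cycIdem_mul_cycIdem, if_pos rfl, mul_assoc, ← pow_succ]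

theorem cycMk_turnWord : cycMk extra (arrWord k (bw 1 n (n - 1) 1 ++ bw 1 n 0 1)) =
    cycShift extra * cycIdem extra 0 * cycShift extra := by
  rw [arrWord_append, map_mul, cycMk_cycleWord extra _ le_rfl, cycMk_cycleWord extra _ le_rfl,
    pow_one, Nat.cast_zero, cycIdem_mul_cycShift, ← cycShift_mul_cycIdem, ← Nat.cast_succ,
    Nat.succ_eq_add_one, Nat.sub_add_cancel NeZero.one_le, ZMod.natCast_self, ← mul_assoc,
    mul_assoc (cycShift extra), cycIdem_mul_cycIdem, if_pos rfl]

theorem cycleSystem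
    (h : cycMk extra (arrWord k (bw 1 n (n - 1) 1 ++ bw 1 n 0 1)) = 0) :
    CycleSystem (cycIdem extra) (cycLoop extra) (cycShift extra) where
  orth := cycIdem_mul_cycIdem extra
  sum_eq_one := sum_cycIdem extra
  idem_mul := cycIdem_mul_cycLoop extra
  mul_idem := cycLoop_mul_cycIdem extra
  shift i := by rw [cycIdem_mul_cycShift, cycShift_mul_cycIdem]
  shift_idem_shift := by rw [← cycMk_turnWord, h]

theorem cycMk_generator (γ : CycV 1 n ⊕ CycE 1 n) :
    (∃ j, cycMk extra (FreeAlgebra.ι k γ) = cycIdem extra j) ∨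
    cycMk extra (FreeAlgebra.ι k γ) = cycLoop extra ∨
    ∃ j, cycMk extra (FreeAlgebra.ι k γ) = cycIdem extra j * cycShift extra := by
  rcases γ with v | i | j
  · obtain ⟨j, rfl⟩ := cycVR_surjective n v
    exact Or.inl ⟨j, rfl⟩
  · rw [Subsingleton.elim i 0]
    exact Or.inr (Or.inl rfl)
  · exact Or.inr (Or.inr ⟨j, (cycIdem_mul_cycShift extra j).symm⟩)

instance : Finite (CycV 1 n) := Finite.of_surjective _ (cycVR_surjective n)

instance : Finite (CycE 1 n) := inferInstanceAs (Finite (ZMod 1 ⊕ ZMod n))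

variable {extra}

theorem finite_and_tauTiltingFinite_of_cycle_eq_zero
    (h : cycMk extra (arrWord k (bw 1 n (n - 1) 1 ++ bw 1 n 0 1)) = 0)
    (hloop : cycLoop extra * cycLoop extra = 0)
    (hz : cycMk extra (arrWord k (bw 1 n 0 n)) = 0) :
    Module.Finite k (BoundQuiverAlg k (cycSrc 1 n) (cycTgt 1 n) extra) ∧
      TauTiltingFinite k (BoundQuiverAlg k (cycSrc 1 n) (cycTgt 1 n) extra) := by
  rw [cycMk_cycleWord extra 0 NeZero.one_le, Nat.cast_zero] at hz
  exact ⟨(cycleSystem extra h).finite hloop hz adjoin_range_boundQuiverMk (cycMk_generator extra),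
    (cycleSystem extra h).tauTiltingFinite hloop hz adjoin_range_boundQuiverMk
      (cycMk_generator extra)⟩

theorem cycle_mul_comm (h : cycMk extra (arrWord k (bw 1 n (n - 1) 1 ++ bw 1 n 0 1)) = 0)
    (ha : cycMk extra (arrWord k (bw 1 n 0 n)) * cycLoop extra =
      cycLoop extra * cycMk extra (arrWord k (bw 1 n 0 n)))
    (r : BoundQuiverAlg k (cycSrc 1 n) (cycTgt 1 n) extra) :
    cycMk extra (arrWord k (bw 1 n 0 n)) * r = r * cycMk extra (arrWord k (bw 1 n 0 n)) := by
  have hr : r ∈ Algebra.adjoin k (Set.range fun x => cycMk extra (FreeAlgebra.ι k x)) := by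
    rw [adjoin_range_boundQuiverMk]
    trivial
  have hs := cycleSystem extra h
  induction hr using Algebra.adjoin_induction with
  | mem x hx =>
    obtain ⟨γ, rfl⟩ := hx
    rw [cycMk_cycleWord extra 0 NeZero.one_le, Nat.cast_zero] at ha ⊢
    dsimp only
    rcases cycMk_generator extra γ with ⟨j, hj⟩ | hj | ⟨j, hj⟩
    · rw [hj, hs.cycle_mul_idem]
    · rw [hj, ha]
    · rw [hj, ← mul_assoc, hs.cycle_mul_idem, mul_assoc, hs.cycle_mul_shift, mul_assoc,
        hs.shift_mul_cycle]
  | algebraMap c => exact (Algebra.commutes c _).symm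
  | add x y _ _ hx hy => rw [mul_add, add_mul, hx, hy]
  | mul x y _ _ hx hy => rw [← mul_assoc, hx, mul_assoc, hy, mul_assoc]

theorem cycle_mul_cycle (h : cycMk extra (arrWord k (bw 1 n (n - 1) 1 ++ bw 1 n 0 1)) = 0) :
    cycMk extra (arrWord k (bw 1 n 0 n)) * cycMk extra (arrWord k (bw 1 n 0 n)) = 0 := by
  rw [cycMk_cycleWord extra 0 NeZero.one_le, Nat.cast_zero]
  exact (cycleSystem extra h).cycle_sq

variable (k n)

/-- The relations of the common quotient of `Ω(n)` and `A(1,n)` by the full cycle. -/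
def CommonRelExtra : FreeAlgebra k (CycV 1 n ⊕ CycE 1 n) →
    FreeAlgebra k (CycV 1 n ⊕ CycE 1 n) → Prop := fun x y =>
  OmRelExtra k n x y ∨ ARelExtra k 1 n x y ∨ (x = arrWord k (bw 1 n 0 n) ∧ y = 0)

theorem cycMk_common_cycle : cycMk (CommonRelExtra k n) (arrWord k (bw 1 n 0 n)) = 0 :=
  (boundQuiverMk_extra (Or.inr (Or.inr ⟨rfl, rfl⟩))).trans (map_zero _)

theorem finite_and_tauTiltingFinite_common :
    Module.Finite k (BoundQuiverAlg k (cycSrc 1 n) (cycTgt 1 n) (CommonRelExtra k n)) ∧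
      TauTiltingFinite k (BoundQuiverAlg k (cycSrc 1 n) (cycTgt 1 n) (CommonRelExtra k n)) := by
  refine finite_and_tauTiltingFinite_of_cycle_eq_zero ?_ ?_ (cycMk_common_cycle k n)
  · exact (boundQuiverMk_extra (Or.inl (Or.inr (Or.inr (Or.inl ⟨rfl, rfl⟩))))).trans (map_zero _)
  · have := boundQuiverMk_extra (s := cycSrc 1 n) (t := cycTgt 1 n) (extra := CommonRelExtra k n)
      (Or.inr (Or.inl (Or.inr (Or.inl ⟨rfl, rfl⟩))))
    rw [map_zero, arrWord_append, map_mul] at this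
    rwa [← cycMk_loopWord]

theorem exists_centralReduction_omega (hk : (2 : k) = 0) :
    ∃ φ : BoundQuiverAlg k (cycSrc 1 n) (cycTgt 1 n) (OmRelExtra k n) →ₐ[k]
      BoundQuiverAlg k (cycSrc 1 n) (cycTgt 1 n) (CommonRelExtra k n),
      CentralReduction φ.toRingHom (cycMk (OmRelExtra k n) (arrWord k (bw 1 n 0 n))) := by
  have ht : cycMk (OmRelExtra k n) (arrWord k (bw 1 n (n - 1) 1 ++ bw 1 n 0 1)) = 0 :=
    (boundQuiverMk_extra (Or.inr (Or.inr (Or.inl ⟨rfl, rfl⟩)))).trans (map_zero _)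
  have hcomm : cycMk (OmRelExtra k n) (arrWord k (bw 1 n 0 n)) * cycLoop (OmRelExtra k n) =
      cycLoop (OmRelExtra k n) * cycMk (OmRelExtra k n) (arrWord k (bw 1 n 0 n)) := by
    have := boundQuiverMk_extra (s := cycSrc 1 n) (t := cycTgt 1 n) (extra := OmRelExtra k n)
      (Or.inl ⟨rfl, rfl⟩)
    rw [map_zero, map_add, arrWord_append, arrWord_append, map_mul, map_mul,
      cycMk_loopWord] at this
    rw [eq_neg_of_add_eq_zero_left this, eq_comm, neg_eq_iff_add_eq_zero, ← two_smul k, hk,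
      zero_smul]
  have hsq : cycLoop (OmRelExtra k n) * cycLoop (OmRelExtra k n) =
      cycMk (OmRelExtra k n) (arrWord k (bw 1 n 0 n)) * cycLoop (OmRelExtra k n) := by
    have := boundQuiverMk_extra (s := cycSrc 1 n) (t := cycTgt 1 n) (extra := OmRelExtra k n)
      (Or.inr (Or.inl ⟨rfl, rfl⟩))
    rw [arrWord_append, arrWord_append, map_mul, map_mul, cycMk_loopWord] at this
    rw [this, hcomm]
  have hz := cycle_mul_comm ht hcomm
  refine exists_centralReduction_boundQuiver _ hz (cycle_mul_cycle ht) (cycMk_common_cycle k n)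
    (fun x y h => boundQuiverMk_extra (Or.inl h)) (fun x y h => ?_)
  rcases h with h | (⟨rfl, rfl⟩ | ⟨rfl, rfl⟩ | h | ⟨i, hi, hi', -, -⟩ | h) | ⟨rfl, rfl⟩
  · exact ⟨0, by rw [boundQuiverMk_extra h, sub_self, mul_zero]⟩
  · refine ⟨0, ?_⟩
    rw [arrWord_append, arrWord_append, map_mul, map_mul, cycMk_loopWord, hcomm, sub_self,
      mul_zero]
  · refine ⟨cycLoop _, ?_⟩
    rw [arrWord_append, map_mul, map_zero, sub_zero, ← hsq]
    exact congrArg₂ (· * ·) (cycMk_loopWord _) (cycMk_loopWord _)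
  · exact ⟨0, by
      rw [boundQuiverMk_extra (Or.inr (Or.inr (Or.inl h))), sub_self, mul_zero]⟩
  · omega
  · exact ⟨0, by
      rw [boundQuiverMk_extra (Or.inr (Or.inr (Or.inr h))), sub_self, mul_zero]⟩
  · exact ⟨1, by rw [map_zero, sub_zero, mul_one]⟩

theorem exists_centralReduction_a :
    ∃ φ : BoundQuiverAlg k (cycSrc 1 n) (cycTgt 1 n) (ARelExtra k 1 n) →ₐ[k]
      BoundQuiverAlg k (cycSrc 1 n) (cycTgt 1 n) (CommonRelExtra k n),
      CentralReduction φ.toRingHom (cycMk (ARelExtra k 1 n) (arrWord k (bw 1 n 0 n))) := by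
  have ht : cycMk (ARelExtra k 1 n) (arrWord k (bw 1 n (n - 1) 1 ++ bw 1 n 0 1)) = 0 :=
    (boundQuiverMk_extra (Or.inr (Or.inr (Or.inl ⟨rfl, rfl⟩)))).trans (map_zero _)
  have hcomm : cycMk (ARelExtra k 1 n) (arrWord k (bw 1 n 0 n)) * cycLoop (ARelExtra k 1 n) =
      cycLoop (ARelExtra k 1 n) * cycMk (ARelExtra k 1 n) (arrWord k (bw 1 n 0 n)) := by
    have := boundQuiverMk_extra (s := cycSrc 1 n) (t := cycTgt 1 n) (extra := ARelExtra k 1 n)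
      (Or.inl ⟨rfl, rfl⟩)
    rw [arrWord_append, arrWord_append, map_mul, map_mul, cycMk_loopWord] at this
    exact this.symm
  have hsq : cycLoop (ARelExtra k 1 n) * cycLoop (ARelExtra k 1 n) = 0 := by
    have := boundQuiverMk_extra (s := cycSrc 1 n) (t := cycTgt 1 n) (extra := ARelExtra k 1 n)
      (Or.inr (Or.inl ⟨rfl, rfl⟩))
    rw [map_zero, arrWord_append, map_mul] at this
    rwa [← cycMk_loopWord]
  have hz := cycle_mul_comm ht hcomm
  refine exists_centralReduction_boundQuiver _ hz (cycle_mul_cycle ht) (cycMk_common_cycle k n)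
    (fun x y h => boundQuiverMk_extra (Or.inr (Or.inl h))) (fun x y h => ?_)
  rcases h with (⟨rfl, rfl⟩ | ⟨rfl, rfl⟩ | h | h) | h | ⟨rfl, rfl⟩
  · refine ⟨cycLoop _ + cycLoop _, ?_⟩
    rw [map_add, arrWord_append, arrWord_append, map_mul, map_mul, cycMk_loopWord, map_zero,
      sub_zero, mul_add, hcomm]
  · refine ⟨-cycLoop _, ?_⟩
    rw [arrWord_append, arrWord_append, map_mul, map_mul, cycMk_loopWord, hsq, zero_sub, mul_neg,
      hcomm]
  · exact ⟨0, by
      rw [boundQuiverMk_extra (Or.inr (Or.inr (Or.inl h))), sub_self, mul_zero]⟩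
  · exact ⟨0, by
      rw [boundQuiverMk_extra (Or.inr (Or.inr (Or.inr (Or.inr h)))), sub_self, mul_zero]⟩
  · exact ⟨0, by rw [boundQuiverMk_extra h, sub_self, mul_zero]⟩
  · exact ⟨1, by rw [map_zero, sub_zero, mul_one]⟩

end CycleAlgebras

/-- If `char k = 2`, then for every `n ≥ 1` the algebra `Ω(n)` is τ-tilting finite; moreover
its poset of basic support τ-tilting modules is isomorphic to that of `A(1,n)` (where the
partial order is given by inclusion of the subcategories `Fac M`). -/
theorem statement16 (k : Type) [Field k] [IsAlgClosed k] (hchar : ringChar k = 2)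
    (n : ℕ) (hn : 1 ≤ n) :
    TauTiltingFinite k (OmAlg k n hn) ∧
    ∃ R : ModuleCat.{0} (OmAlg k n hn)ᵐᵒᵖ → ModuleCat.{0} (AAlg k 1 n Nat.one_pos hn)ᵐᵒᵖ →
        Prop,
      (∀ M N, R M N →
        (IsSupportTauTilting k (OmAlg k n hn) M ∧ IsBasicMod (OmAlg k n hn) M) ∧
        (IsSupportTauTilting k (AAlg k 1 n Nat.one_pos hn) N ∧
          IsBasicMod (AAlg k 1 n Nat.one_pos hn) N)) ∧
      (∀ M, IsSupportTauTilting k (OmAlg k n hn) M → IsBasicMod (OmAlg k n hn) M →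
        ∃ N, R M N) ∧
      (∀ N, IsSupportTauTilting k (AAlg k 1 n Nat.one_pos hn) N →
        IsBasicMod (AAlg k 1 n Nat.one_pos hn) N → ∃ M, R M N) ∧
      (∀ M M' N N', R M N → R M' N' →
        ((Nonempty (M ≃ₗ[(OmAlg k n hn)ᵐᵒᵖ] M') ↔
          Nonempty (N ≃ₗ[(AAlg k 1 n Nat.one_pos hn)ᵐᵒᵖ] N')) ∧
         (FacLE (OmAlg k n hn) M M' ↔ FacLE (AAlg k 1 n Nat.one_pos hn) N N'))) := by
  have : NeZero n := ⟨by omega⟩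
  have hk : (2 : k) = 0 := by
    have := ringChar.charP k
    rw [hchar] at this
    exact_mod_cast CharP.cast_eq_zero k 2
  obtain ⟨hfin, hcommon⟩ := finite_and_tauTiltingFinite_common k n
  obtain ⟨φ, hφ⟩ := exists_centralReduction_omega k n hk
  obtain ⟨φ', hφ'⟩ := exists_centralReduction_a k n
  have := Module.Finite.of_centralReduction hφ
  have := Module.Finite.of_centralReduction hφ'
  have htau := TauTiltingFinite.of_reduction hφ hcommon
  refine ⟨htau, ?_⟩
  obtain ⟨R, h₁, h₂, h₃, h₄⟩ := exists_isBasicSTT_correspondence (k := k) hφ hφ'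
  exact ⟨R, h₁, fun M hM hM' => h₂ M ⟨hM, hM'⟩, fun N hN hN' => h₃ N ⟨hN, hN'⟩, h₄⟩

end
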